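/- Suppose p_S < p < p_JL and fix n ≥ 1. Then λ_n(γ) oscillates around λ_n* infinitely many times as γ → ∞: for every Γ > 1 there exist γ₁ > Γ and γ₂ > Γ such that λ_n(γ₁) > λ_n* and λ_n(γ₂) < λ_n*. -/

import Mathlib

open Real Set Filter Topology MeasureTheory

noncomputable section

/-- The nonlinearity `f(u) = -u + u^p`. -/
def fNL (p u : ℝ) : ℝ := -u + u ^ p

/-- The Sobolev critical exponent `p_S = (N+2)/(N-2)`. -/
def pSob (N : ℕ) : ℝ := ((N : ℝ) + 2) / ((N : ℝ) - 2)

/-- `θ = 2/(p-1)`. -/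
def thetaP (p : ℝ) : ℝ := 2 / (p - 1)

/-- `A = (θ(N-2-θ))^{1/(p-1)}`. -/
def Aconst (N : ℕ) (p : ℝ) : ℝ :=
  (thetaP p * ((N : ℝ) - 2 - thetaP p)) ^ (1 / (p - 1))

/-- `m = (θ(N-2-θ))^{-1/2}`. -/
def mConst (N : ℕ) (p : ℝ) : ℝ :=
  (thetaP p * ((N : ℝ) - 2 - thetaP p)) ^ (-(1 / 2) : ℝ)

/-- `α = m(N-2-2θ)`. -/
def alphaConst (N : ℕ) (p : ℝ) : ℝ :=
  mConst N p * ((N : ℝ) - 2 - 2 * thetaP p)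

/-- The condition `p < p_JL`, where `p_JL = 1 + 4/(N-4-2√(N-1))` for `N ≥ 11` and
`p_JL = ∞` for `N ≤ 10`. -/
def pJLcond (N : ℕ) (p : ℝ) : Prop :=
  11 ≤ N → p < 1 + 4 / ((N : ℝ) - 4 - 2 * Real.sqrt ((N : ℝ) - 1))

/-- `y` is a C² solution of `y'' + α y' - y + y^p - m² e^{2mt} y = 0` on `(-∞, T]`
with `y → 1` as `t → -∞`; `y'`, `y''` are its first and second derivatives. -/
def IsSingODEOn (N : ℕ) (p T : ℝ) (y y' y'' : ℝ → ℝ) : Prop :=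
  (∀ t ∈ Iic T, HasDerivWithinAt y (y' t) (Iic T) t) ∧
  (∀ t ∈ Iic T, HasDerivWithinAt y' (y'' t) (Iic T) t) ∧
  ContinuousOn y'' (Iic T) ∧
  (∀ t ∈ Iic T, y'' t + alphaConst N p * y' t - y t + y t ^ p
      - (mConst N p) ^ 2 * Real.exp (2 * mConst N p * t) * y t = 0) ∧
  Tendsto y atBot (𝓝 1)

/-- `y` is a C² solution of `y'' + α y' - y + y^p - m² e^{2mt} y = 0` on all of `ℝ`
with `y → 1` as `t → -∞`. -/
def IsEntireSingODE (N : ℕ) (p : ℝ) (y y' y'' : ℝ → ℝ) : Prop :=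
  (∀ t : ℝ, HasDerivAt y (y' t) t) ∧
  (∀ t : ℝ, HasDerivAt y' (y'' t) t) ∧
  Continuous y'' ∧
  (∀ t : ℝ, y'' t + alphaConst N p * y' t - y t + y t ^ p
      - (mConst N p) ^ 2 * Real.exp (2 * mConst N p * t) * y t = 0) ∧
  Tendsto y atBot (𝓝 1)

/-- The singular solution `u*(s) = A s^{-θ} y*(m⁻¹ log s)` built from `y*`. -/
def ustar (N : ℕ) (p : ℝ) (y : ℝ → ℝ) (s : ℝ) : ℝ :=
  Aconst N p * s ^ (-(thetaP p)) * y (Real.log s / mConst N p)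

/-- `u` is a C² solution on `[0,∞)` of the IVP `u'' + ((N-1)/s)u' + f(u) = 0`,
`u(0) = γ`, `u'(0) = 0`, with nonlinearity `f(u) = -u + u^p`. -/
def IsIVPSol (N : ℕ) (p γ : ℝ) (u u' u'' : ℝ → ℝ) : Prop :=
  (∀ s ∈ Ici (0:ℝ), HasDerivWithinAt u (u' s) (Ici 0) s) ∧
  (∀ s ∈ Ici (0:ℝ), HasDerivWithinAt u' (u'' s) (Ici 0) s) ∧
  ContinuousOn u'' (Ici 0) ∧
  u 0 = γ ∧ u' 0 = 0 ∧
  (∀ s > (0:ℝ), u'' s + ((N : ℝ) - 1) / s * u' s + fNL p (u s) = 0)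

/-- `u` is a C² solution on `[0,∞)` of the IVP `u'' + ((N-1)/ρ)u' + u^p = 0`,
`u(0) = γ`, `u'(0) = 0`. -/
def IsBarSol (N : ℕ) (p γ : ℝ) (u u' u'' : ℝ → ℝ) : Prop :=
  (∀ ρ ∈ Ici (0:ℝ), HasDerivWithinAt u (u' ρ) (Ici 0) ρ) ∧
  (∀ ρ ∈ Ici (0:ℝ), HasDerivWithinAt u' (u'' ρ) (Ici 0) ρ) ∧
  ContinuousOn u'' (Ici 0) ∧
  u 0 = γ ∧ u' 0 = 0 ∧
  (∀ ρ > (0:ℝ), u'' ρ + ((N : ℝ) - 1) / ρ * u' ρ + u ρ ^ p = 0)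

/-- `s` is the `(k+1)`-th positive critical point of a function whose derivative is `u'`:
`s` is a positive critical point having exactly `k` positive critical points below it. -/
def IsNthCritPt (u' : ℝ → ℝ) (k : ℕ) (s : ℝ) : Prop :=
  0 < s ∧ u' s = 0 ∧ {x : ℝ | 0 < x ∧ x < s ∧ u' x = 0}.encard = (k : ℕ∞)

/-- `U` is a positive C² radial solution of the Neumann problem
`U'' + ((N-1)/r)U' + λ f(U) = 0` on `(0,1)`, `U'(0) = U'(1) = 0`, `U > 0` on `[0,1]`. -/
def NeumannSol (N : ℕ) (p lam : ℝ) (U U' U'' : ℝ → ℝ) : Prop :=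
  (∀ r ∈ Icc (0:ℝ) 1, HasDerivWithinAt U (U' r) (Icc 0 1) r) ∧
  (∀ r ∈ Icc (0:ℝ) 1, HasDerivWithinAt U' (U'' r) (Icc 0 1) r) ∧
  ContinuousOn U'' (Icc 0 1) ∧
  (∀ r ∈ Ioo (0:ℝ) 1, U'' r + ((N : ℝ) - 1) / r * U' r + lam * fNL p (U r) = 0) ∧
  U' 0 = 0 ∧ U' 1 = 0 ∧ (∀ r ∈ Icc (0:ℝ) 1, 0 < U r)

/-- `(lam, U)` is a singular solution of the Neumann problem whose graph meets `1`
exactly `n` times: `U` is C² on `(0,1)`, continuous on `(0,1]`, `U'(1) = 0`, it solves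
`U'' + ((N-1)/r)U' + λ f(U) = 0` on `(0,1)`, satisfies the asymptotics
`U(r) = A(√λ r)^{-θ}(1+o(1))` as `r ↓ 0` (i.e. `r^θ U(r) → A λ^{-θ/2}`),
`U - 1` has exactly `n` zeros in `(0,1]`, and `U > 0` on `(0,1]`. -/
def SingBVPSol (N : ℕ) (p lam : ℝ) (n : ℕ) (U U' U'' : ℝ → ℝ) : Prop :=
  (∀ r ∈ Ioc (0:ℝ) 1, HasDerivWithinAt U (U' r) (Ioc 0 1) r) ∧
  (∀ r ∈ Ioo (0:ℝ) 1, HasDerivAt U' (U'' r) r) ∧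
  ContinuousOn U (Ioc 0 1) ∧
  ContinuousOn U'' (Ioo 0 1) ∧
  (∀ r ∈ Ioo (0:ℝ) 1, U'' r + ((N : ℝ) - 1) / r * U' r + lam * fNL p (U r) = 0) ∧
  U' 1 = 0 ∧
  Tendsto (fun r => r ^ thetaP p * U r) (𝓝[>] (0:ℝ))
    (𝓝 (Aconst N p * lam ^ (-(thetaP p) / 2))) ∧
  {r ∈ Ioc (0:ℝ) 1 | U r = 1}.encard = (n : ℕ∞) ∧
  (∀ r ∈ Ioc (0:ℝ) 1, 0 < U r)

/-! ### Calculus tools -/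

lemma le_of_hasDerivAt_nonpos {f f' : ℝ → ℝ} {a b : ℝ} (hab : a ≤ b)
    (hc : ContinuousOn f (Icc a b)) (hd : ∀ x ∈ Ioo a b, HasDerivAt f (f' x) x)
    (hn : ∀ x ∈ Ioo a b, f' x ≤ 0) : f b ≤ f a := by
  have h := antitoneOn_of_deriv_nonpos (convex_Icc a b) hc
    (fun x hx => by
      rw [interior_Icc] at hx
      exact (hd x hx).differentiableAt.differentiableWithinAt)
    (fun x hx => by
      rw [interior_Icc] at hx
      rw [(hd x hx).deriv]; exact hn x hx)
  exact h (left_mem_Icc.2 hab) (right_mem_Icc.2 hab) hab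

lemma gronwall_affine {Q Q' : ℝ → ℝ} {a b K c : ℝ} (hab : a ≤ b) (hK : 0 ≤ K) (hc0 : 0 ≤ c)
    (hc : ContinuousOn Q (Icc a b)) (hd : ∀ x ∈ Ioo a b, HasDerivAt Q (Q' x) x)
    (hn : ∀ x ∈ Ioo a b, Q' x ≤ K * Q x + c) :
    Q b ≤ (Q a + c * (b - a)) * Real.exp (K * (b - a)) := by
  have h := le_of_hasDerivAt_nonpos (f := fun x => Q x * Real.exp (-(K * (x - a))) - c * (x - a))
    (f' := fun x => Q' x * Real.exp (-(K * (x - a)))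
      + Q x * (Real.exp (-(K * (x - a))) * (-(K * 1))) - c * 1) hab
    (by fun_prop)
    (fun x hx => by
      have h1 : HasDerivAt (fun x : ℝ => x - a) 1 x := (hasDerivAt_id x).sub_const a
      exact ((hd x hx).mul (h1.const_mul K).neg.exp).sub (h1.const_mul c))
    (fun x hx => by
      have e1 : Real.exp (-(K * (x - a))) ≤ 1 :=
        Real.exp_le_one_iff.2 (by have := mul_nonneg hK (sub_nonneg.2 hx.1.le); linarith)
      have e0 := Real.exp_pos (-(K * (x - a)))
      have := hn x hx
      nlinarith)
  simp only [sub_self, mul_zero, neg_zero, Real.exp_zero, mul_one, sub_zero] at h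
  have e2 : Real.exp (-(K * (b - a))) * Real.exp (K * (b - a)) = 1 := by
    rw [← Real.exp_add]; simp
  have e0 := Real.exp_pos (K * (b - a))
  calc Q b = Q b * Real.exp (-(K * (b - a))) * Real.exp (K * (b - a)) := by
        rw [mul_assoc, e2, mul_one]
    _ ≤ _ := by gcongr; linarith

lemma abs_sub_le_of_hasDerivAt {f f' : ℝ → ℝ} {a b C : ℝ}
    (hd : ∀ x ∈ uIcc a b, HasDerivAt f (f' x) x) (hC : ∀ x ∈ uIcc a b, |f' x| ≤ C) :
    |f b - f a| ≤ C * |b - a| :=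
  Convex.norm_image_sub_le_of_norm_hasDerivWithin_le (s := uIcc a b)
    (fun x hx => (hd x hx).hasDerivWithinAt) hC (convex_uIcc a b) left_mem_uIcc right_mem_uIcc

/-- If `f` converges at infinity and `f'` has a bounded derivative, then `f' → 0`. -/
lemma tendsto_deriv_zero {f f' f'' : ℝ → ℝ} {l C T : ℝ} (hl : Tendsto f atTop (𝓝 l))
    (hd : ∀ x, HasDerivAt f (f' x) x) (hd2 : ∀ x, HasDerivAt f' (f'' x) x)
    (hC : ∀ x ≥ T, |f'' x| ≤ C) : Tendsto f' atTop (𝓝 0) := by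
  have hC0 : 0 ≤ C := (abs_nonneg _).trans (hC T le_rfl)
  rw [Metric.tendsto_atTop] at hl ⊢
  intro ε hε
  set h : ℝ := ε / (4 * (C + 1)) with hh
  have hhpos : 0 < h := by positivity
  obtain ⟨S, hS⟩ := hl (ε * h / 8) (by positivity)
  refine ⟨max S T, fun t ht => ?_⟩
  have htS := (le_max_left S T).trans ht
  have htT := (le_max_right S T).trans ht
  obtain ⟨ξ, hξ, he⟩ := exists_hasDerivAt_eq_slope f f' (a := t) (b := t + h) (by linarith)
    (fun x _ => (hd x).continuousAt.continuousWithinAt) (fun x _ => hd x)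
  have h1 : |f' ξ| * h ≤ ε * h / 4 := by
    have e : f' ξ * h = f (t + h) - f t := by
      rw [he, add_sub_cancel_left, div_mul_cancel₀ _ hhpos.ne']
    rw [← abs_of_pos hhpos, ← abs_mul, abs_of_pos hhpos, e]
    have a1 := hS t htS
    have a2 := hS (t + h) (by linarith)
    rw [Real.dist_eq] at a1 a2
    have : f (t + h) - f t = (f (t + h) - l) - (f t - l) := by ring
    rw [this]
    refine (abs_sub _ _).trans ?_
    linarith
  have h1' : |f' ξ| ≤ ε / 4 := by
    by_contra hcon
    push Not at hcon
    nlinarith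
  have h2 : |f' ξ - f' t| ≤ C * |ξ - t| := abs_sub_le_of_hasDerivAt (fun x _ => hd2 x)
    (fun x hx => hC x (by rw [uIcc_of_le hξ.1.le] at hx; linarith [hx.1]))
  have h3 : |ξ - t| ≤ h := by rw [abs_of_pos (by linarith [hξ.1])]; linarith [hξ.2]
  have h4 : C * |ξ - t| ≤ ε / 4 := by
    calc C * |ξ - t| ≤ (C + 1) * h := by gcongr; linarith
      _ = ε / 4 := by rw [hh]; field_simp
  rw [Real.dist_eq, sub_zero]
  have : f' t = f' ξ - (f' ξ - f' t) := by ring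
  rw [this]
  refine (abs_sub _ _).trans_lt ?_
  linarith

/-- Continuation principle: a strict bound that reproduces itself holds throughout. -/
lemma lt_of_bootstrap {Q : ℝ → ℝ} {a b M : ℝ} (hc : ContinuousOn Q (Icc a b)) (ha : Q a < M)
    (h : ∀ t ∈ Icc a b, (∀ s ∈ Icc a t, Q s ≤ M) → Q t < M) : ∀ t ∈ Icc a b, Q t < M := by
  by_contra! hcon
  obtain ⟨t, ht, hMt⟩ := hcon
  set S := {x ∈ Icc a b | M ≤ Q x} with hS
  have hSc : IsClosed S := hc.preimage_isClosed_of_isClosed isClosed_Icc isClosed_Ici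
  have hSne : S.Nonempty := ⟨t, ht, hMt⟩
  have hSb : BddBelow S := ⟨a, fun x hx => hx.1.1⟩
  have hmem := hSc.csInf_mem hSne hSb
  set x := sInf S with hx
  have hlt : ∀ s ∈ Ico a x, Q s < M := fun s hs => by
    by_contra! hcon
    exact absurd (csInf_le hSb (show s ∈ S from ⟨⟨hs.1, hs.2.le.trans hmem.1.2⟩, hcon⟩))
      (not_le.2 hs.2)
  have hax : a < x := lt_of_le_of_ne hmem.1.1 (fun e => by
    have := hmem.2; rw [← e] at this; linarith)
  have hle : Q x ≤ M := by
    have hcw : ContinuousWithinAt Q (Ico a x) x :=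
      (hc x hmem.1).mono (fun y hy => ⟨hy.1, hy.2.le.trans hmem.1.2⟩)
    have : (𝓝[Ico a x] x).NeBot := by
      rw [nhdsWithin_Ico_eq_nhdsLT hax]; infer_instance
    exact le_of_tendsto hcw (eventually_nhdsWithin_of_forall fun s hs => (hlt s hs).le)
  have := h x hmem.1 (fun s hs => by
    rcases hs.2.eq_or_lt with e | e
    · rw [e]; exact hle
    · exact (hlt s ⟨hs.1, e⟩).le)
  linarith [hmem.2]

/-! ### Estimates for the power function -/

lemma hasDerivAt_rpow_of_one_lt {p : ℝ} (hp : 1 < p) (x : ℝ) :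
    HasDerivAt (fun x : ℝ => x ^ p) (p * x ^ (p - 1)) x :=
  Real.hasDerivAt_rpow_const (Or.inr hp.le)

lemma abs_rpow_sub_sub_le {p : ℝ} (hp : 1 < p) {a b c K : ℝ}
    (h : ∀ x ∈ uIcc a b, |p * x ^ (p - 1) - c| ≤ K) :
    |a ^ p - b ^ p - c * (a - b)| ≤ K * |a - b| := by
  have := abs_sub_le_of_hasDerivAt (f := fun x : ℝ => x ^ p - c * x)
    (f' := fun x => p * x ^ (p - 1) - c * 1) (a := b) (b := a) (C := K)
    (fun x _ => (hasDerivAt_rpow_of_one_lt hp x).sub ((hasDerivAt_id x).const_mul c))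
    (fun x hx => by rw [mul_one]; exact h x (by rwa [uIcc_comm]))
  convert this using 2
  ring

lemma exists_rpow_lipschitz {p : ℝ} (hp : 1 < p) (M : ℝ) :
    ∃ K ≥ 0, ∀ a b : ℝ, |a| ≤ M → |b| ≤ M → |a ^ p - b ^ p| ≤ K * |a - b| := by
  have hc : Continuous fun x : ℝ => p * x ^ (p - 1) :=
    continuous_const.mul (Real.continuous_rpow_const (by linarith))
  obtain ⟨K, hK⟩ := (isCompact_Icc (a := -M) (b := M)).exists_bound_of_continuousOn hc.continuousOn
  refine ⟨max K 0, le_max_right _ _, fun a b ha hb => ?_⟩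
  have := abs_rpow_sub_sub_le hp (a := a) (b := b) (c := 0) (K := max K 0) (fun x hx => by
    rw [sub_zero]
    exact (hK x (uIcc_subset_Icc (abs_le.1 ha) (abs_le.1 hb) hx)).trans (le_max_left _ _))
  simpa using this

lemma exists_rpow_linear_approx {p : ℝ} (hp : 1 < p) (M : ℝ) {ε : ℝ} (hε : 0 < ε) :
    ∃ δ > 0, ∀ a b : ℝ, |a| ≤ M → |b| ≤ M → |a - b| < δ →
      |a ^ p - b ^ p - p * b ^ (p - 1) * (a - b)| ≤ ε * |a - b| := by
  have hc : Continuous fun x : ℝ => p * x ^ (p - 1) :=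
    continuous_const.mul (Real.continuous_rpow_const (by linarith))
  have hu := (isCompact_Icc (a := -M) (b := M)).uniformContinuousOn_of_continuous hc.continuousOn
  rw [Metric.uniformContinuousOn_iff] at hu
  obtain ⟨δ, hδ, h⟩ := hu ε hε
  refine ⟨δ, hδ, fun a b ha hb hab => abs_rpow_sub_sub_le hp fun x hx => ?_⟩
  refine (h x (uIcc_subset_Icc (abs_le.1 ha) (abs_le.1 hb) hx) b (abs_le.1 hb) ?_).le
  rw [Real.dist_eq]
  exact (abs_sub_left_of_mem_uIcc (by rwa [uIcc_comm])).trans_lt hab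

lemma exists_rpow_quadratic {p : ℝ} (hp : 1 < p) :
    ∃ C ≥ 0, ∀ a b : ℝ, |a - 1| ≤ 1 / 2 → |b - 1| ≤ 1 / 2 →
      |a ^ p - b ^ p - p * (a - b)| ≤ C * (|a - 1| + |b - 1|) * |a - b| := by
  have hc : ContinuousOn (fun x : ℝ => p * ((p - 1) * x ^ (p - 1 - 1))) (Icc (1 / 2) (3 / 2)) :=
    fun x hx => ((Real.continuousAt_rpow_const x _ (Or.inl (by
      have := hx.1; linarith))).const_mul _ |>.const_mul _).continuousWithinAt
  obtain ⟨C, hC⟩ := isCompact_Icc.exists_bound_of_continuousOn hc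
  have hC0 : 0 ≤ C := (norm_nonneg _).trans (hC 1 (by norm_num))
  refine ⟨C, hC0, fun a b ha hb => abs_rpow_sub_sub_le hp fun x hx => ?_⟩
  rw [abs_le] at ha hb
  have hx' : x ∈ Icc (1 / 2 : ℝ) (3 / 2) :=
    uIcc_subset_Icc ⟨by linarith, by linarith⟩ ⟨by linarith, by linarith⟩ hx
  have := abs_sub_le_of_hasDerivAt (f := fun x : ℝ => p * x ^ (p - 1))
    (f' := fun x => p * ((p - 1) * x ^ (p - 1 - 1))) (a := 1) (b := x) (C := C)
    (fun z hz => by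
      have : z ∈ Icc (1 / 2 : ℝ) (3 / 2) := uIcc_subset_Icc (by norm_num) hx' hz
      exact (Real.hasDerivAt_rpow_const (Or.inl (by have := this.1; linarith))).const_mul p)
    (fun z hz => hC z (uIcc_subset_Icc (by norm_num) hx' hz))
  rw [Real.one_rpow, mul_one] at this
  refine this.trans (mul_le_mul_of_nonneg_left ?_ hC0)
  rcases le_total a b with h | h
  · rw [uIcc_of_le h] at hx
    rcases abs_cases (x - 1) with h1 | h1 <;> rcases abs_cases (a - 1) with h2 | h2 <;>
      rcases abs_cases (b - 1) with h3 | h3 <;> linarith [hx.1, hx.2]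
  · rw [uIcc_of_ge h] at hx
    rcases abs_cases (x - 1) with h1 | h1 <;> rcases abs_cases (a - 1) with h2 | h2 <;>
      rcases abs_cases (b - 1) with h3 | h3 <;> linarith [hx.1, hx.2]

lemma mul_rpow_of_pos_left {p c : ℝ} (hc : 0 < c) (x : ℝ) : (c * x) ^ p = c ^ p * x ^ p := by
  rcases le_or_gt 0 x with hx | hx
  · exact Real.mul_rpow hc.le hx
  · rw [Real.rpow_def_of_neg (mul_neg_of_pos_of_neg hc hx), Real.rpow_def_of_neg hx,
      Real.rpow_def_of_pos hc, Real.log_mul hc.ne' hx.ne, add_mul, Real.exp_add]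
    ring

/-! ### Radial solutions and the Emden–Fowler equation -/

/-- Radial solutions of `w'' + (d/s) w' - e w + w^p = 0` on `[0,∞)` with `w'(0) = 0`. -/
structure RadSol (d p e : ℝ) (w w' : ℝ → ℝ) : Prop where
  cont : ContinuousOn w (Ici 0)
  cont' : ContinuousOn w' (Ici 0)
  zero' : w' 0 = 0
  hd : ∀ s > 0, HasDerivAt w (w' s) s
  hd' : ∀ s > 0, HasDerivAt w' (-(d / s) * w' s + e * w s - w s ^ p) s

/-- Solutions on `ℝ` of `y'' + α y' - y + y^p - κ e^{2mt} y = 0`. -/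
structure EFSol (p α m κ : ℝ) (y y' : ℝ → ℝ) : Prop where
  hd : ∀ t, HasDerivAt y (y' t) t
  hd' : ∀ t, HasDerivAt y' (-α * y' t + y t - y t ^ p + κ * Real.exp (2 * m * t) * y t) t

/-- The relations between the constants of the Emden–Fowler change of variables. -/
structure EFConst (d p α m θ B : ℝ) : Prop where
  hp : 1 < p
  hd : 0 ≤ d
  hα : 0 < α
  hm : 0 < m
  hθ : 0 < θ
  hB : 0 < B
  hθp : θ * (p - 1) = 2
  hmθ : m ^ 2 * (θ * (d - 1 - θ)) = 1
  hαm : α = m * (d - 1 - 2 * θ)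
  hBp : B ^ (p - 1) = m ^ 2

/-- The Emden–Fowler transform of `w`. -/
def emden (m θ B : ℝ) (w : ℝ → ℝ) (t : ℝ) : ℝ :=
  B * Real.exp (m * θ * t) * w (Real.exp (m * t))

/-- The derivative of the Emden–Fowler transform of `w`, in terms of `w` and `w'`. -/
def emdenDeriv (m θ B : ℝ) (w w' : ℝ → ℝ) (t : ℝ) : ℝ :=
  m * B * Real.exp (m * θ * t) *
    (θ * w (Real.exp (m * t)) + Real.exp (m * t) * w' (Real.exp (m * t)))

lemma hasDerivAt_exp_mul (c t : ℝ) :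
    HasDerivAt (fun t : ℝ => Real.exp (c * t)) (c * Real.exp (c * t)) t := by
  have := ((hasDerivAt_id t).const_mul c).exp
  simpa [mul_comm] using this

lemma tendsto_exp_mul_atBot {c : ℝ} (hc : 0 < c) :
    Tendsto (fun t : ℝ => Real.exp (c * t)) atBot (𝓝 0) :=
  Real.tendsto_exp_atBot.comp (tendsto_id.const_mul_atBot hc)

lemma RadSol.efSol {d p α m θ B e : ℝ} {w w' : ℝ → ℝ} (hc : EFConst d p α m θ B)
    (h : RadSol d p e w w') :
    EFSol p α m (m ^ 2 * e) (emden m θ B w) (emdenDeriv m θ B w w') := by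
  have hE := fun t => hasDerivAt_exp_mul m t
  have hF := fun t => hasDerivAt_exp_mul (m * θ) t
  constructor
  · intro t
    have h1 := ((hF t).const_mul B).mul ((h.hd _ (Real.exp_pos (m * t))).comp t (hE t))
    refine h1.congr_deriv ?_
    simp only [emdenDeriv, Function.comp]; ring
  · intro t
    have h1 := (h.hd _ (Real.exp_pos (m * t))).comp t (hE t)
    have h2 := (h.hd' _ (Real.exp_pos (m * t))).comp t (hE t)
    have h3 := ((hF t).const_mul (m * B)).mul ((h1.const_mul θ).add ((hE t).mul h2))
    refine h3.congr_deriv ?_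
    have hpow : (B * Real.exp (m * θ * t) * w (Real.exp (m * t))) ^ p
        = m ^ 2 * B * Real.exp (m * θ * t) * Real.exp (m * t) ^ 2 * w (Real.exp (m * t)) ^ p := by
      rw [mul_rpow_of_pos_left (mul_pos hc.hB (Real.exp_pos _)),
        Real.mul_rpow hc.hB.le (Real.exp_pos _).le, ← Real.exp_mul, ← hc.hBp]
      have e1 : B ^ p = B ^ (p - 1) * B := by
        rw [← Real.rpow_add_one hc.hB.ne']; ring_nf
      have e2 : Real.exp (m * θ * t * p) = Real.exp (m * θ * t) * Real.exp (m * t) ^ 2 := by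
        rw [← Real.exp_nat_mul, ← Real.exp_add]
        congr 1
        have := hc.hθp
        push_cast
        linear_combination m * t * this
      rw [e1, e2]; ring
    have hne := (Real.exp_pos (m * t)).ne'
    have e3 : Real.exp (2 * m * t) = Real.exp (m * t) ^ 2 := by
      rw [← Real.exp_nat_mul]; congr 1; push_cast; ring
    simp only [emden, emdenDeriv, hpow, Pi.add_apply, Pi.mul_apply, Function.comp, e3]
    rw [hc.hαm]
    field_simp
    have := hc.hmθ
    linear_combination (w (Real.exp (m * t)) * B) * this

lemma RadSol.tendsto_exp {d p e : ℝ} {w w' : ℝ → ℝ} {m : ℝ} (hm : 0 < m)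
    (h : RadSol d p e w w') :
    Tendsto (fun t => w (Real.exp (m * t))) atBot (𝓝 (w 0)) ∧
      Tendsto (fun t => w' (Real.exp (m * t))) atBot (𝓝 0) := by
  have hE : Tendsto (fun t : ℝ => Real.exp (m * t)) atBot (𝓝[Ici 0] 0) :=
    tendsto_nhdsWithin_iff.2 ⟨tendsto_exp_mul_atBot hm, Eventually.of_forall fun t =>
      (Real.exp_pos _).le⟩
  refine ⟨(h.cont 0 self_mem_Ici).tendsto.comp hE, ?_⟩
  have := (h.cont' 0 self_mem_Ici).tendsto.comp hE
  rwa [h.zero'] at this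

lemma RadSol.tendsto_emden {d p α m θ B e : ℝ} {w w' : ℝ → ℝ} (hc : EFConst d p α m θ B)
    (h : RadSol d p e w w') :
    Tendsto (emden m θ B w) atBot (𝓝 0) ∧ Tendsto (emdenDeriv m θ B w w') atBot (𝓝 0) := by
  obtain ⟨h1, h2⟩ := h.tendsto_exp hc.hm
  have hF := tendsto_exp_mul_atBot (mul_pos hc.hm hc.hθ)
  have hE := tendsto_exp_mul_atBot hc.hm
  constructor
  · have := (hF.const_mul B).mul h1
    simp only [zero_mul, mul_zero] at this
    exact this
  · have := (hF.const_mul (m * B)).mul ((h1.const_mul θ).add (hE.mul h2))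
    simp only [zero_mul, mul_zero] at this
    exact this

/-- The energy of a solution of the Emden–Fowler equation. -/
def efEnergy (p m κ : ℝ) (y y' : ℝ → ℝ) (t : ℝ) : ℝ :=
  y' t ^ 2 / 2 - (1 + κ * Real.exp (2 * m * t)) * y t ^ 2 / 2 + y t ^ (p + 1) / (p + 1)

namespace EFSol

variable {p α m κ : ℝ} {y y' : ℝ → ℝ}

lemma hasDerivAt_energy (hp : 1 < p) (h : EFSol p α m κ y y') (t : ℝ) :
    HasDerivAt (efEnergy p m κ y y')
      (-α * y' t ^ 2 - m * κ * Real.exp (2 * m * t) * y t ^ 2) t := by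
  have hE := hasDerivAt_exp_mul (2 * m) t
  have hr : HasDerivAt (fun t => y t ^ (p + 1)) ((p + 1) * y t ^ p * y' t) t := by
    have := (hasDerivAt_rpow_of_one_lt (p := p + 1) (by linarith) (y t)).comp t (h.hd t)
    rwa [add_sub_cancel_right] at this
  have h1 := ((((h.hd' t).pow 2).div_const 2).sub
    ((((hE.const_mul κ).const_add 1).mul ((h.hd t).pow 2)).div_const 2)).add (hr.div_const (p + 1))
  refine h1.congr_deriv ?_
  have : p + 1 ≠ 0 := by linarith
  simp only [Pi.pow_apply]
  field_simp
  ring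

lemma energy_antitone (hp : 1 < p) (hα : 0 ≤ α) (hm : 0 ≤ m) (hκ : 0 ≤ κ)
    (h : EFSol p α m κ y y') : Antitone (efEnergy p m κ y y') := fun a b hab =>
  le_of_hasDerivAt_nonpos hab
    (fun x _ => (h.hasDerivAt_energy hp x).continuousAt.continuousWithinAt)
    (fun x _ => h.hasDerivAt_energy hp x)
    (fun x _ => by
      have e1 : 0 ≤ α * y' x ^ 2 := by positivity
      have e2 : 0 ≤ m * κ * Real.exp (2 * m * x) * y x ^ 2 := by positivity
      linarith)

lemma energy_neg (hp : 1 < p) (hα : 0 < α) (hm : 0 < m) (hκ : 0 ≤ κ) (h : EFSol p α m κ y y')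
    (h0 : Tendsto y atBot (𝓝 0)) (h0' : Tendsto y' atBot (𝓝 0))
    (hne : ∀ᶠ t in atBot, y t ≠ 0) (t : ℝ) : efEnergy p m κ y y' t < 0 := by
  have hanti := h.energy_antitone hp hα.le hm.le hκ
  have hlim : Tendsto (efEnergy p m κ y y') atBot (𝓝 0) := by
    have hE := tendsto_exp_mul_atBot (c := 2 * m) (by linarith)
    have hr : Tendsto (fun t => y t ^ (p + 1)) atBot (𝓝 0) := by
      have := ((Real.continuous_rpow_const (q := p + 1) (by linarith)).tendsto 0).comp h0
      rwa [Real.zero_rpow (by linarith)] at this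
    have := ((h0'.pow 2).div_const 2).sub
      ((((hE.const_mul κ).const_add 1).mul (h0.pow 2)).div_const 2) |>.add (hr.div_const (p + 1))
    simp only [ne_eq, OfNat.ofNat_ne_zero, not_false_eq_true, zero_pow, zero_div, mul_zero,
      sub_zero, add_zero] at this
    exact this
  have hle : ∀ s, efEnergy p m κ y y' s ≤ 0 := fun s =>
    ge_of_tendsto hlim ((eventually_le_atBot s).mono fun r hr => hanti hr)
  by_contra! hcon
  have hz : ∀ s ≤ t, efEnergy p m κ y y' s = 0 := fun s hs =>
    le_antisymm (hle s) (hcon.trans (hanti hs))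
  have hy' : ∀ s < t, y' s = 0 := fun s hs => by
    have h1 := h.hasDerivAt_energy hp s
    have h2 : HasDerivAt (efEnergy p m κ y y') 0 s :=
      (hasDerivAt_const s (0 : ℝ)).congr_of_eventuallyEq
        ((eventually_lt_nhds hs).mono fun r hr => hz r hr.le)
    have h3 := h1.unique h2
    have e1 : 0 ≤ α * y' s ^ 2 := by positivity
    have e2 : 0 ≤ m * κ * Real.exp (2 * m * s) * y s ^ 2 := by positivity
    have : α * y' s ^ 2 = 0 := by linarith
    simpa [hα.ne'] using this
  obtain ⟨s, hs1, hs2⟩ := (hne.and (eventually_lt_atBot t)).exists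
  have hconst : ∀ r < s, y r = y s := fun r hr => by
    have := abs_sub_le_of_hasDerivAt (f := y) (f' := y') (a := r) (b := s) (C := 0)
      (fun x _ => h.hd x) (fun x hx => by
        rw [uIcc_of_le hr.le] at hx
        rw [hy' x (hx.2.trans_lt hs2), abs_zero])
    rw [zero_mul, abs_nonpos_iff] at this
    linarith
  exact hs1 (tendsto_nhds_unique
    (tendsto_const_nhds.congr' ((eventually_lt_atBot s).mono fun r hr => (hconst r hr).symm)) h0)

lemma ne_zero_of_energy_neg (hp : 1 < p) {t : ℝ} (h : efEnergy p m κ y y' t < 0) : y t ≠ 0 := by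
  intro h0
  rw [efEnergy, h0, Real.zero_rpow (by linarith)] at h
  norm_num at h
  nlinarith [sq_nonneg (y' t)]

end EFSol

namespace RadSol

variable {d p α m θ B e : ℝ} {w w' : ℝ → ℝ}

lemma emden_energy_neg (hc : EFConst d p α m θ B) (he : 0 ≤ e)
    (h : RadSol d p e w w') (hw : 0 < w 0) (t : ℝ) :
    efEnergy p m (m ^ 2 * e) (emden m θ B w) (emdenDeriv m θ B w w') t < 0 := by
  obtain ⟨h0, h0'⟩ := h.tendsto_emden hc
  refine (h.efSol hc).energy_neg hc.hp hc.hα hc.hm (by positivity) h0 h0' ?_ t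
  filter_upwards [(h.tendsto_exp hc.hm).1.eventually (lt_mem_nhds hw)] with s hs
  have := hc.hB
  rw [emden]; positivity

lemma emden_pos (hc : EFConst d p α m θ B) (he : 0 ≤ e)
    (h : RadSol d p e w w') (hw : 0 < w 0) (t : ℝ) : 0 < emden m θ B w t := by
  have hne : ∀ t, emden m θ B w t ≠ 0 := fun t =>
    EFSol.ne_zero_of_energy_neg hc.hp (h.emden_energy_neg hc he hw t)
  obtain ⟨s, hs⟩ := ((h.tendsto_exp hc.hm).1.eventually (lt_mem_nhds hw)).exists
  have hs' : 0 < emden m θ B w s := by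
    have := hc.hB
    rw [emden]; positivity
  by_contra! hcon
  have hcont : Continuous (emden m θ B w) :=
    continuous_iff_continuousAt.2 fun x => ((h.efSol hc).hd x).continuousAt
  obtain ⟨x, hx⟩ := mem_range_of_exists_le_of_exists_ge hcont ⟨t, hcon⟩ ⟨s, hs'.le⟩
  exact hne x hx

lemma pos (hc : EFConst d p α m θ B) (he : 0 ≤ e)
    (h : RadSol d p e w w') (hw : 0 < w 0) {s : ℝ} (hs : 0 ≤ s) : 0 < w s := by
  rcases hs.eq_or_lt with rfl | hs
  · exact hw
  · have := h.emden_pos hc he hw (Real.log s / m)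
    rw [emden, mul_div_cancel₀ _ hc.hm.ne', Real.exp_log hs] at this
    exact pos_of_mul_pos_right this (mul_pos hc.hB (Real.exp_pos _)).le

/-- Solutions starting at `1` stay below `1` when `e ≤ 1`. -/
lemma le_one (hc : EFConst d p α m θ B) (he1 : e ≤ 1)
    (h : RadSol d p e w w') (hw : w 0 = 1) {s : ℝ} (hs : 0 ≤ s) : w s ≤ 1 := by
  have hp := hc.hp
  set F : ℝ → ℝ := fun u => u ^ (p + 1) / (p + 1) - e * u ^ 2 / 2 with hF
  have hFd : ∀ u, HasDerivAt F (u ^ p - e * u) u := fun u => by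
    have h1 := ((hasDerivAt_rpow_of_one_lt (p := p + 1) (by linarith) u).div_const (p + 1)).sub
      ((((hasDerivAt_id u).pow 2).const_mul e).div_const 2)
    refine h1.congr_deriv ?_
    have : p + 1 ≠ 0 := by linarith
    simp
    field_simp
  have hFc : Continuous F := continuous_iff_continuousAt.2 fun u => (hFd u).continuousAt
  have hmono := le_of_hasDerivAt_nonpos (f := fun r => w' r ^ 2 / 2 + F (w r))
    (f' := fun r => -(d / r) * w' r ^ 2) hs
    (by
      have h1 := h.cont.mono ((Icc_subset_Ici_self : Icc 0 s ⊆ Ici 0))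
      have h2 := h.cont'.mono ((Icc_subset_Ici_self : Icc 0 s ⊆ Ici 0))
      exact ((h2.pow 2).div_const 2).add (hFc.comp_continuousOn h1))
    (fun r hr => by
      have h1 := (((h.hd' r hr.1).pow 2).div_const 2).add ((hFd (w r)).comp r (h.hd r hr.1))
      refine h1.congr_deriv ?_
      have := hr.1.ne'
      simp
      field_simp
      ring)
    (fun r hr => by
      have := div_nonneg hc.hd hr.1.le
      nlinarith [mul_nonneg this (sq_nonneg (w' r))])
  by_contra! hcon
  simp only [h.zero', hw] at hmono
  have hsm : StrictMonoOn F (Ici 1) := by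
    refine strictMonoOn_of_deriv_pos (convex_Ici 1) hFc.continuousOn fun x hx => ?_
    rw [interior_Ici] at hx
    rw [(hFd x).deriv]
    have : x < x ^ p := by
      conv_lhs => rw [← Real.rpow_one x]
      exact Real.rpow_lt_rpow_of_exponent_lt hx hp
    have hx' : (1 : ℝ) < x := hx
    nlinarith
  have := hsm self_mem_Ici hcon.le hcon
  nlinarith [sq_nonneg (w' s)]

end RadSol

/-! ### The limit of rescaled radial solutions -/

lemma RadSol.sq_dist_le {d p e₁ e₂ K R : ℝ} {w₁ w₁' w₂ w₂' : ℝ → ℝ} (hd : 0 ≤ d) (hK0 : 0 ≤ K)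
    (hK : ∀ a b : ℝ, |a| ≤ 1 → |b| ≤ 1 → |a ^ p - b ^ p| ≤ K * |a - b|)
    (h₁ : RadSol d p e₁ w₁ w₁') (h₂ : RadSol d p e₂ w₂ w₂') (h0 : w₁ 0 = w₂ 0)
    (he₁ : 0 ≤ e₁) (he₂ : 0 ≤ e₂) (hb₁ : ∀ s ≥ 0, |w₁ s| ≤ 1) (hb₂ : ∀ s ≥ 0, |w₂ s| ≤ 1)
    {s : ℝ} (hs : s ∈ Icc 0 R) :
    (w₁ s - w₂ s) ^ 2 + (w₁' s - w₂' s) ^ 2 ≤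
      (e₁ + e₂) ^ 2 * (R * Real.exp ((K + 2) * R)) := by
  have hsub : Icc 0 s ⊆ Ici 0 := Icc_subset_Ici_self
  have h := gronwall_affine (Q := fun s => (w₁ s - w₂ s) ^ 2 + (w₁' s - w₂' s) ^ 2)
    (Q' := fun s => 2 * (w₁ s - w₂ s) * (w₁' s - w₂' s) + 2 * (w₁' s - w₂' s) *
      ((-(d / s) * w₁' s + e₁ * w₁ s - w₁ s ^ p) - (-(d / s) * w₂' s + e₂ * w₂ s - w₂ s ^ p)))
    (K := K + 2) (c := (e₁ + e₂) ^ 2) hs.1 (by positivity) (by positivity)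
    ((((h₁.cont.mono hsub).sub (h₂.cont.mono hsub)).pow 2).add
      (((h₁.cont'.mono hsub).sub (h₂.cont'.mono hsub)).pow 2))
    (fun x hx => by
      refine ((((h₁.hd x hx.1).sub (h₂.hd x hx.1)).pow 2).add
        (((h₁.hd' x hx.1).sub (h₂.hd' x hx.1)).pow 2)).congr_deriv ?_
      simp)
    (fun x hx => by
      set u := w₁ x - w₂ x
      set v := w₁' x - w₂' x with hv
      have b1 := hb₁ x hx.1.le
      have b2 := hb₂ x hx.1.le
      have hq : 0 ≤ d / x := div_nonneg hd hx.1.le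
      have hpw := hK _ _ b1 b2
      have e : (-(d / x) * w₁' x + e₁ * w₁ x - w₁ x ^ p) -
          (-(d / x) * w₂' x + e₂ * w₂ x - w₂ x ^ p)
          = -(d / x) * v + (e₁ * w₁ x - e₂ * w₂ x) - (w₁ x ^ p - w₂ x ^ p) := by rw [hv]; ring
      have g1 : |e₁ * w₁ x - e₂ * w₂ x| ≤ e₁ + e₂ := by
        refine (abs_sub _ _).trans ?_
        rw [abs_mul, abs_mul, abs_of_nonneg he₁, abs_of_nonneg he₂]
        nlinarith
      have g2 : 2 * v * (e₁ * w₁ x - e₂ * w₂ x) ≤ v ^ 2 + (e₁ + e₂) ^ 2 := by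
        have := sq_le_sq' (abs_le.1 g1).1 (abs_le.1 g1).2
        nlinarith [sq_nonneg (v - (e₁ * w₁ x - e₂ * w₂ x))]
      have g3 : -(2 * v * (w₁ x ^ p - w₂ x ^ p)) ≤ K * (u ^ 2 + v ^ 2) := by
        have : -(v * (w₁ x ^ p - w₂ x ^ p)) ≤ |v| * (K * |u|) := by
          refine (neg_le_abs _).trans ?_
          rw [abs_mul]; gcongr
        have h2 : 2 * (|v| * |u|) ≤ u ^ 2 + v ^ 2 := by
          rw [← sq_abs u, ← sq_abs v]; nlinarith [sq_nonneg (|u| - |v|)]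
        nlinarith
      have g4 : 0 ≤ (d / x) * v ^ 2 := by positivity
      simp only [e]
      nlinarith [sq_nonneg (u - v)])
  simp only [h0, h₁.zero', h₂.zero', sub_self, ne_eq, OfNat.ofNat_ne_zero, not_false_eq_true,
    zero_pow, add_zero, zero_add, sub_zero] at h
  refine h.trans ?_
  rw [mul_assoc]
  have := hs.1
  have := hs.2
  have : 0 ≤ R := hs.1.trans hs.2
  gcongr

lemma exists_limit_radSol {ι : Type*} {l : Filter ι} [l.NeBot] {d p α m θ B : ℝ}
    (hc : EFConst d p α m θ B) {e : ι → ℝ} {w w' : ι → ℝ → ℝ} (he : Tendsto e l (𝓝 0))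
    (h : ∀ᶠ i in l, 0 ≤ e i ∧ e i ≤ 1 ∧ RadSol d p (e i) (w i) (w' i) ∧ w i 0 = 1) :
    ∃ w₀ w₀' : ℝ → ℝ, RadSol d p 0 w₀ w₀' ∧ w₀ 0 = 1 ∧
      ∀ R, TendstoUniformlyOn w w₀ l (Icc 0 R) ∧ TendstoUniformlyOn w' w₀' l (Icc 0 R) := by
  obtain ⟨K, hK0, hK⟩ := exists_rpow_lipschitz hc.hp 1
  have hbd : ∀ᶠ i in l, ∀ s ≥ 0, |w i s| ≤ 1 := by
    filter_upwards [h] with i hi s hs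
    have hp := hi.2.2.1.pos hc hi.1 (by rw [hi.2.2.2]; norm_num) hs
    rw [abs_of_pos hp]
    exact hi.2.2.1.le_one hc hi.2.1 hi.2.2.2 hs
  have hclose : ∀ R, ∀ ε > 0, ∀ᶠ q in l ×ˢ l, ∀ s ∈ Icc 0 R,
      |w q.1 s - w q.2 s| < ε ∧ |w' q.1 s - w' q.2 s| < ε := by
    intro R ε hε
    have hlim : Tendsto (fun q : ι × ι => (e q.1 + e q.2) ^ 2 * (R * Real.exp ((K + 2) * R)))
        (l ×ˢ l) (𝓝 0) := by
      have := (((he.comp tendsto_fst).add (he.comp tendsto_snd)).pow 2).mul_const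
        (R * Real.exp ((K + 2) * R))
      simpa using this
    filter_upwards [hlim.eventually (gt_mem_nhds (show (0 : ℝ) < ε ^ 2 by positivity)),
      tendsto_fst.eventually (h.and hbd), tendsto_snd.eventually (h.and hbd)] with q hq h1 h2 s hs
    have := h1.1.2.2.1.sq_dist_le hc.hd hK0 hK h2.1.2.2.1 (by rw [h1.1.2.2.2, h2.1.2.2.2])
      h1.1.1 h2.1.1 h1.2 h2.2 hs
    constructor
    · refine abs_lt_of_sq_lt_sq ?_ hε.le
      nlinarith [sq_nonneg (w' q.1 s - w' q.2 s)]
    · refine abs_lt_of_sq_lt_sq ?_ hε.le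
      nlinarith [sq_nonneg (w q.1 s - w q.2 s)]
  have hC : ∀ R, UniformCauchySeqOn w l (Icc 0 R) := fun R => by
    intro V hV
    obtain ⟨ε, hε, hεV⟩ := Metric.mem_uniformity_dist.1 hV
    filter_upwards [hclose R ε hε] with q hq s hs
    exact hεV (by rw [Real.dist_eq]; exact (hq s hs).1)
  have hC' : ∀ R, UniformCauchySeqOn w' l (Icc 0 R) := fun R => by
    intro V hV
    obtain ⟨ε, hε, hεV⟩ := Metric.mem_uniformity_dist.1 hV
    filter_upwards [hclose R ε hε] with q hq s hs
    exact hεV (by rw [Real.dist_eq]; exact (hq s hs).2)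
  have hex : ∀ s : ℝ, ∃ a b : ℝ, 0 ≤ s →
      Tendsto (fun i => w i s) l (𝓝 a) ∧ Tendsto (fun i => w' i s) l (𝓝 b) := fun s => by
    by_cases hs : 0 ≤ s
    · obtain ⟨a, ha⟩ := CompleteSpace.complete ((hC s).cauchy_map (right_mem_Icc.2 hs))
      obtain ⟨b, hb⟩ := CompleteSpace.complete ((hC' s).cauchy_map (right_mem_Icc.2 hs))
      exact ⟨a, b, fun _ => ⟨ha, hb⟩⟩
    · exact ⟨0, 0, fun h => absurd h hs⟩
  choose w₀ w₀' hw using hex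
  have hU : ∀ R, TendstoUniformlyOn w w₀ l (Icc 0 R) := fun R =>
    (hC R).tendstoUniformlyOn_of_tendsto fun s hs => (hw s hs.1).1
  have hU' : ∀ R, TendstoUniformlyOn w' w₀' l (Icc 0 R) := fun R =>
    (hC' R).tendstoUniformlyOn_of_tendsto fun s hs => (hw s hs.1).2
  have hcontOn : ∀ {v : ι → ℝ → ℝ} {v₀ : ℝ → ℝ}, (∀ R, TendstoUniformlyOn v v₀ l (Icc 0 R)) →
      (∀ᶠ i in l, ContinuousOn (v i) (Ici 0)) → ContinuousOn v₀ (Ici 0) := by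
    intro v v₀ hv hvc s hs
    have h1 : ContinuousOn v₀ (Icc 0 (s + 1)) := (hv (s + 1)).continuousOn
      (hvc.mono fun i hi => hi.mono Icc_subset_Ici_self).frequently
    have h2 := h1 s ⟨hs, by linarith⟩
    refine h2.mono_of_mem_nhdsWithin ?_
    rw [← Ici_inter_Iic]
    exact inter_mem self_mem_nhdsWithin
      (mem_nhdsWithin_of_mem_nhds (Iic_mem_nhds (by linarith)))
  have hb0 : ∀ s ≥ 0, |w₀ s| ≤ 1 := fun s hs =>
    le_of_tendsto (hw s hs).1.abs (hbd.mono fun i hi => hi s hs)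
  refine ⟨w₀, w₀', ⟨?_, ?_, ?_, ?_, ?_⟩, ?_, fun R => ⟨hU R, hU' R⟩⟩
  · exact hcontOn hU (h.mono fun i hi => hi.2.2.1.cont)
  · exact hcontOn hU' (h.mono fun i hi => hi.2.2.1.cont')
  · exact tendsto_nhds_unique (hw 0 le_rfl).2
      (tendsto_const_nhds.congr' (h.mono fun i hi => hi.2.2.1.zero'.symm))
  · intro s hs
    refine hasDerivAt_of_tendstoUniformlyOn (f := w) (f' := w') (isOpen_Ioo (a := 0) (b := s + 1))
      ((hU' (s + 1)).mono Ioo_subset_Icc_self)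
      (h.mono fun i hi x hx => hi.2.2.1.hd x hx.1) (fun x hx => (hw x hx.1.le).1)
      ⟨hs, by linarith⟩
  · intro s hs
    refine hasDerivAt_of_tendstoUniformlyOn (f := w')
      (f' := fun i s => -(d / s) * w' i s + e i * w i s - w i s ^ p)
      (g' := fun s => -(d / s) * w₀' s + 0 * w₀ s - w₀ s ^ p)
      (isOpen_Ioo (a := s / 2) (b := s + 1)) ?_
      (h.mono fun i hi x hx => hi.2.2.1.hd' x (by linarith [hx.1]))
      (fun x hx => (hw x (by linarith [hx.1])).2)
      ⟨by linarith, by linarith⟩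
    rw [Metric.tendstoUniformlyOn_iff]
    intro ε hε
    have hd0 := hc.hd
    set D := d / (s / 2) with hD
    have hD0 : 0 ≤ D := by positivity
    have u1 := Metric.tendstoUniformlyOn_iff.1 (hU (s + 1)) (ε / (3 * (K + 1))) (by positivity)
    have u2 := Metric.tendstoUniformlyOn_iff.1 (hU' (s + 1)) (ε / (3 * (D + 1))) (by positivity)
    filter_upwards [u1, u2, he.eventually (gt_mem_nhds (show (0 : ℝ) < ε / 3 by positivity)), hbd,
      h] with i h1 h2 h3 h4 h5 x hx
    have hx0 : 0 < x := by linarith [hx.1]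
    have hxI : x ∈ Icc 0 (s + 1) := ⟨hx0.le, hx.2.le⟩
    have k1 := h1 x hxI
    have k2 := h2 x hxI
    rw [Real.dist_eq] at k1 k2 ⊢
    have hDx : d / x ≤ D := by
      rw [hD]; gcongr; exact hx.1.le
    have hDx0 : 0 ≤ d / x := by positivity
    have a1 : |(d / x) * (w₀' x - w' i x)| < ε / 3 := by
      rw [abs_mul, abs_of_nonneg hDx0]
      calc d / x * |w₀' x - w' i x| ≤ D * (ε / (3 * (D + 1))) := by gcongr
        _ < (D + 1) * (ε / (3 * (D + 1))) := by gcongr; linarith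
        _ = ε / 3 := by field_simp
    have a2 : |w₀ x ^ p - w i x ^ p| < ε / 3 := by
      calc |w₀ x ^ p - w i x ^ p| ≤ K * |w₀ x - w i x| := hK _ _ (hb0 x hx0.le) (h4 x hx0.le)
        _ ≤ K * (ε / (3 * (K + 1))) := by gcongr
        _ < (K + 1) * (ε / (3 * (K + 1))) := by gcongr; linarith
        _ = ε / 3 := by field_simp
    have a3 : |e i * w i x| ≤ ε / 3 := by
      rw [abs_mul, abs_of_nonneg h5.1]
      have := h4 x hx0.le
      nlinarith [h5.1]
    rw [abs_lt] at a1 a2 ⊢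
    rw [abs_le] at a3
    constructor <;> nlinarith
  · exact tendsto_nhds_unique (hw 0 le_rfl).1
      (tendsto_const_nhds.congr' (h.mono fun i hi => hi.2.2.2.symm))

/-! ### Asymptotics of the autonomous Emden–Fowler equation -/

lemma rpow_add_one_eq_mul_sq {p y : ℝ} (hy : 0 < y) : y ^ (p + 1) = y ^ (p - 1) * y ^ 2 := by
  rw [← Real.rpow_natCast, ← Real.rpow_add hy]; congr 1; push_cast; ring

namespace EFSol

variable {p α m κ : ℝ} {y y' : ℝ → ℝ}

lemma bounds_of_energy_neg (hp : 1 < p) {t : ℝ} (hy : 0 < y t)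
    (hE : efEnergy p m κ y y' t < 0) :
    y t ^ (p - 1) ≤ (p + 1) / 2 * (1 + κ * Real.exp (2 * m * t)) ∧
      y' t ^ 2 ≤ (1 + κ * Real.exp (2 * m * t)) * y t ^ 2 := by
  have hpp : 0 < p + 1 := by linarith
  have h1 := Real.rpow_nonneg hy.le (p - 1)
  have hy2 : 0 < y t ^ 2 := by positivity
  rw [efEnergy, rpow_add_one_eq_mul_sq hy] at hE
  have h2 : 0 ≤ y t ^ (p - 1) * y t ^ 2 / (p + 1) := by positivity
  constructor
  · by_contra! hcon
    have : (1 + κ * Real.exp (2 * m * t)) / 2 < y t ^ (p - 1) / (p + 1) := by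
      rw [div_lt_div_iff₀ two_pos hpp]; linarith
    have := mul_lt_mul_of_pos_right this hy2
    have e : y t ^ (p - 1) / (p + 1) * y t ^ 2 = y t ^ (p - 1) * y t ^ 2 / (p + 1) := by ring
    nlinarith [sq_nonneg (y' t)]
  · linarith

lemma le_of_rpow_le {a c : ℝ} (hp : 1 < p) (ha : 0 < a) (h : a ^ (p - 1) ≤ c) :
    a ≤ c ^ (1 / (p - 1)) := by
  have h1 : 0 < p - 1 := by linarith
  calc a = (a ^ (p - 1)) ^ (1 / (p - 1)) := by
        rw [← Real.rpow_mul ha.le, mul_one_div_cancel h1.ne', Real.rpow_one]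
    _ ≤ _ := Real.rpow_le_rpow (Real.rpow_nonneg ha.le _) h (by positivity)

/-- Positive solutions of negative energy of the autonomous equation converge to `(1, 0)`. -/
lemma tendsto_one (hp : 1 < p) (hα : 0 < α) (hm : 0 < m) (h : EFSol p α m 0 y y')
    (hy : ∀ t, 0 < y t) (hE : ∀ t, efEnergy p m 0 y y' t < 0) :
    Tendsto y atTop (𝓝 1) ∧ Tendsto y' atTop (𝓝 0) := by
  set M : ℝ := ((p + 1) / 2) ^ (1 / (p - 1)) with hM
  have hM0 : 0 ≤ M := Real.rpow_nonneg (by linarith) _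
  have hyM : ∀ t, y t ≤ M := fun t =>
    le_of_rpow_le hp (hy t) (by simpa using (bounds_of_energy_neg hp (hy t) (hE t)).1)
  have hy'M : ∀ t, |y' t| ≤ M := fun t => by
    have := (bounds_of_energy_neg hp (hy t) (hE t)).2
    rw [zero_mul, add_zero, one_mul] at this
    exact (abs_le_of_sq_le_sq this (hy t).le).trans (hyM t)
  set G : ℝ → ℝ := fun t => -α * y' t + y t - y t ^ p with hG
  have hdG : ∀ t, HasDerivAt y' (G t) t := fun t => by
    have := h.hd' t
    simpa [hG] using this
  have hypM : ∀ t, |y t ^ p| ≤ M ^ p := fun t => by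
    rw [abs_of_pos (Real.rpow_pos_of_pos (hy t) _)]
    exact Real.rpow_le_rpow (hy t).le (hyM t) (by linarith)
  set C := α * M + M + M ^ p with hC
  have hGC : ∀ t, |G t| ≤ C := fun t => by
    have h1 := abs_le.1 (hy'M t)
    have h2 := abs_le.1 (hypM t)
    have h3 := hy t
    have h4 := hyM t
    rw [abs_le]; constructor <;> simp only [hG, hC] <;> nlinarith
  have hC0 : 0 ≤ C := (abs_nonneg _).trans (hGC 0)
  have hanti := h.energy_antitone hp hα.le hm.le le_rfl
  have hbdd : BddBelow (range (efEnergy p m 0 y y')) := by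
    refine ⟨-(M ^ 2 / 2), ?_⟩
    rintro _ ⟨t, rfl⟩
    have h1 := Real.rpow_nonneg (hy t).le (p + 1)
    have h2 : 0 ≤ y t ^ (p + 1) / (p + 1) := div_nonneg h1 (by linarith)
    have h3 : y t ^ 2 ≤ M ^ 2 := pow_le_pow_left₀ (hy t).le (hyM t) 2
    simp only [efEnergy]
    nlinarith [sq_nonneg (y' t)]
  have hElim := tendsto_atTop_ciInf hanti hbdd
  have hEd : ∀ t, HasDerivAt (efEnergy p m 0 y y') (-α * y' t ^ 2) t := fun t => by
    simpa using h.hasDerivAt_energy hp t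
  have hd1 := tendsto_deriv_zero (f := efEnergy p m 0 y y') (f' := fun t => -α * y' t ^ 2)
    (f'' := fun t => -α * (2 * y' t * G t)) (C := α * (2 * M * C)) (T := 0) hElim hEd
    (fun t => by
      refine (((hdG t).pow 2).const_mul (-α)).congr_deriv ?_
      simp)
    (fun t _ => by
      rw [abs_mul, abs_neg, abs_of_pos hα, abs_mul, abs_mul, abs_two]
      have := hy'M t
      have := hGC t
      gcongr)
  have hy'0 : Tendsto y' atTop (𝓝 0) := by
    have h1 := (hd1.const_mul (-α⁻¹)).sqrt
    rw [mul_zero, Real.sqrt_zero] at h1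
    refine (tendsto_zero_iff_abs_tendsto_zero _).2 (h1.congr fun t => ?_)
    rw [Function.comp, ← Real.sqrt_sq_eq_abs]
    congr 1
    field_simp
  have hd2 := tendsto_deriv_zero (f := y') (f' := G)
    (f'' := fun t => -α * G t + y' t - p * y t ^ (p - 1) * y' t)
    (C := α * C + M + p * M ^ (p - 1) * M) (T := 0) hy'0 hdG
    (fun t => (((hdG t).const_mul (-α)).add (h.hd t)).sub
      ((hasDerivAt_rpow_of_one_lt hp (y t)).comp t (h.hd t)))
    (fun t _ => by
      have h1 : |p * y t ^ (p - 1) * y' t| ≤ p * M ^ (p - 1) * M := by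
        have h2 := Real.rpow_nonneg (hy t).le (p - 1)
        rw [abs_mul, abs_mul, abs_of_nonneg h2, abs_of_pos (by linarith)]
        have h3 : y t ^ (p - 1) ≤ M ^ (p - 1) :=
          Real.rpow_le_rpow (hy t).le (hyM t) (by linarith)
        have := hy'M t
        have := Real.rpow_nonneg hM0 (p - 1)
        gcongr
      have h4 : |-α * G t| ≤ α * C := by
        rw [abs_mul, abs_neg, abs_of_pos hα]
        have := hGC t
        gcongr
      exact (abs_sub _ _).trans (add_le_add ((abs_add_le _ _).trans (add_le_add h4 (hy'M t))) h1))
  refine ⟨?_, hy'0⟩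
  have hdiff : Tendsto (fun t => y t - y t ^ p) atTop (𝓝 0) := by
    have := hd2.add (hy'0.const_mul α)
    rw [mul_zero, add_zero] at this
    exact this.congr fun t => by simp only [hG]; ring
  set c := Real.sqrt (-2 * efEnergy p m 0 y y' 0) with hc
  have hc0 : 0 < c := Real.sqrt_pos.2 (by linarith [hE 0])
  have hyc : ∀ t ≥ 0, c ≤ y t := fun t ht => by
    rw [hc, Real.sqrt_le_left (hy t).le]
    have h1 := hanti ht
    have h2 : 0 ≤ y t ^ (p + 1) / (p + 1) :=
      div_nonneg (Real.rpow_nonneg (hy t).le _) (by linarith)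
    have h3 : efEnergy p m 0 y y' t = y' t ^ 2 / 2 - y t ^ 2 / 2 + y t ^ (p + 1) / (p + 1) := by
      simp [efEnergy]
    nlinarith [sq_nonneg (y' t)]
  have hr : Tendsto (fun t => y t ^ (p - 1)) atTop (𝓝 1) := by
    have h1 : Tendsto (fun t => 1 - y t ^ (p - 1)) atTop (𝓝 0) := by
      refine squeeze_zero_norm' ?_ (by simpa using hdiff.abs.div_const c)
      filter_upwards [eventually_ge_atTop 0] with t ht
      rw [le_div_iff₀ hc0, Real.norm_eq_abs]
      have e : y t - y t ^ p = (1 - y t ^ (p - 1)) * y t := by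
        rw [sub_mul, one_mul, ← Real.rpow_add_one (hy t).ne']; ring_nf
      rw [e, abs_mul, abs_of_pos (hy t)]
      exact mul_le_mul_of_nonneg_left (hyc t ht) (abs_nonneg _)
    simpa using h1.const_sub 1
  have h1 := hr.rpow_const (p := 1 / (p - 1)) (Or.inl one_ne_zero)
  rw [Real.one_rpow] at h1
  refine h1.congr fun t => ?_
  rw [← Real.rpow_mul (hy t).le, mul_one_div_cancel (by linarith), Real.rpow_one]

/-- A nonconstant solution of the autonomous equation does not meet the equilibrium `(1, 0)`. -/
lemma ne_equilibrium (hp : 1 < p) (hα : 0 < α) (h : EFSol p α m 0 y y')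
    {M : ℝ} (hM : ∀ t, |y t| ≤ M) (h0 : Tendsto y atBot (𝓝 0)) (t : ℝ) :
    ¬ (y t = 1 ∧ y' t = 0) := by
  rintro ⟨h1, h2⟩
  obtain ⟨K, hK0, hK⟩ := exists_rpow_lipschitz hp (max M 1)
  have hz : ∀ s ≤ t, y s = 1 := fun s hs => by
    have hg := gronwall_affine
      (Q := fun r => (y (t - r) - 1) ^ 2 + y' (t - r) ^ 2)
      (Q' := fun r => 2 * (y (t - r) - 1) * (-y' (t - r)) + 2 * y' (t - r) *
        (-(-α * y' (t - r) + y (t - r) - y (t - r) ^ p)))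
      (a := 0) (b := t - s) (K := 2 * α + K + 2) (c := 0) (by linarith)
      (by positivity) le_rfl
      (by
        have c1 : Continuous y := continuous_iff_continuousAt.2 fun x => (h.hd x).continuousAt
        have c2 : Continuous y' := continuous_iff_continuousAt.2 fun x => (h.hd' x).continuousAt
        fun_prop)
      (fun r _ => by
        have hs : HasDerivAt (fun r : ℝ => t - r) (-1) r := by
          simpa using (hasDerivAt_id r).const_sub t
        refine (((((h.hd (t - r)).comp r hs).sub_const 1).pow 2).add
          (((h.hd' (t - r)).comp r hs).pow 2)).congr_deriv ?_
        simp [Function.comp])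
      (fun r _ => by
        have hk := hK (y (t - r)) 1 ((hM _).trans (le_max_left _ _))
          (by rw [abs_one]; exact le_max_right _ _)
        rw [Real.one_rpow] at hk
        set u := y (t - r) - 1 with hu
        set v := y' (t - r)
        set g := y (t - r) ^ p - 1 with hg
        have e : -α * v + y (t - r) - y (t - r) ^ p = -α * v + u - g := by rw [hu, hg]; ring
        rw [e]
        have h3 : 2 * (v * g) ≤ K * (u ^ 2 + v ^ 2) := by
          have h4 : v * g ≤ |v| * (K * |u|) := by
            refine (le_abs_self _).trans ?_
            rw [abs_mul]; gcongr
          have h5 : 2 * (|v| * |u|) ≤ u ^ 2 + v ^ 2 := by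
            rw [← sq_abs u, ← sq_abs v]; nlinarith [sq_nonneg (|u| - |v|)]
          nlinarith
        nlinarith [sq_nonneg (u + v), mul_nonneg hα.le (sq_nonneg u)])
    simp only [sub_zero, h1, h2, sub_self, sub_sub_cancel, ne_eq, OfNat.ofNat_ne_zero,
      not_false_eq_true, zero_pow, add_zero, zero_mul] at hg
    have : (y s - 1) ^ 2 = 0 := le_antisymm (by nlinarith [sq_nonneg (y' s)]) (sq_nonneg _)
    have := pow_eq_zero_iff (two_ne_zero) |>.1 this
    linarith
  have := tendsto_nhds_unique
    (tendsto_const_nhds.congr' ((eventually_le_atBot t).mono fun r hr => (hz r hr).symm)) h0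
  exact one_ne_zero this

end EFSol

/-! ### Behaviour near the equilibrium -/

/-- The quadratic form adapted to the linearization `h'' + α h' + (α²/4 + ω²) h = 0`
at the equilibrium `1`, evaluated along a solution. -/
def eqForm (α ω : ℝ) (y y' : ℝ → ℝ) (t : ℝ) : ℝ :=
  (y' t + α / 2 * (y t - 1)) ^ 2 + ω ^ 2 * (y t - 1) ^ 2

lemma eqForm_nonneg (α ω : ℝ) (y y' : ℝ → ℝ) (t : ℝ) : 0 ≤ eqForm α ω y y' t := by
  rw [eqForm]; positivity

lemma abs_sub_one_le_of_eqForm {α ω c : ℝ} {y y' : ℝ → ℝ} {t : ℝ} (hω : 0 < ω) (hc : 0 ≤ c)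
    (h : eqForm α ω y y' t ≤ c ^ 2) : |y t - 1| ≤ c / ω := by
  rw [le_div_iff₀ hω]
  refine abs_le_of_sq_le_sq' ?_ hc |>.2
  rw [mul_pow, sq_abs]
  rw [eqForm] at h
  linarith [sq_nonneg (y' t + α / 2 * (y t - 1)), mul_comm (ω ^ 2) ((y t - 1) ^ 2)]

/-- The pointwise inequality behind the decay of `eqForm`: here `X` and `u` are its two
components, `g` is the nonlinear remainder and `F` the forcing term. -/
lemma eqForm_deriv_bound {α ω κ c X u g F E : ℝ} (hα : 0 < α) (hc : c ≤ α * ω / 4) (hg : |g| ≤ c * |u|) (hF : |F| ≤ κ * E * 2) :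
    -α * (X ^ 2 + ω ^ 2 * u ^ 2) + 2 * X * (-g + F) + α / 2 * (X ^ 2 + ω ^ 2 * u ^ 2)
      ≤ 16 * κ ^ 2 / α * E ^ 2 := by
  have hXu : 2 * ω * (|X| * |u|) ≤ X ^ 2 + ω ^ 2 * u ^ 2 := by
    have := sq_nonneg (|X| - ω * |u|)
    rw [← sq_abs X, ← sq_abs u]
    linarith [show (|X| - ω * |u|) ^ 2
      = |X| ^ 2 + ω ^ 2 * |u| ^ 2 - 2 * ω * (|X| * |u|) by ring]
  have t1 : -(2 * X * g) ≤ α / 4 * (X ^ 2 + ω ^ 2 * u ^ 2) := by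
    have a1 : -(X * g) ≤ |X| * (c * |u|) := by
      refine (neg_le_abs _).trans ?_
      rw [abs_mul]
      gcongr
    have a2 : |X| * (c * |u|) ≤ α * ω / 4 * (|X| * |u|) := by
      calc |X| * (c * |u|) = c * (|X| * |u|) := by ring
        _ ≤ _ := by gcongr
    have a3 := mul_le_mul_of_nonneg_left hXu (by positivity : 0 ≤ α / 4)
    linarith [show α / 4 * (2 * ω * (|X| * |u|)) = 2 * (α * ω / 4 * (|X| * |u|)) by ring]
  have t2 : 2 * X * F ≤ α / 4 * X ^ 2 + 16 * κ ^ 2 / α * E ^ 2 := by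
    have a1 : X * F ≤ |X| * (κ * E * 2) := by
      refine (le_abs_self _).trans ?_
      rw [abs_mul]
      gcongr
    have e : α / 4 * X ^ 2 + 16 * κ ^ 2 / α * E ^ 2 - 4 * κ * E * |X|
        = α / 4 * (|X| - 8 * κ * E / α) ^ 2 := by
      rw [← sq_abs X]; field_simp; ring
    have : 0 ≤ α / 4 * (|X| - 8 * κ * E / α) ^ 2 := by positivity
    linarith
  have t3 : 0 ≤ α / 4 * (ω ^ 2 * u ^ 2) := by positivity
  linarith

namespace EFSol

variable {p α m κ ω : ℝ} {y y' : ℝ → ℝ}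

lemma continuous_fst (h : EFSol p α m κ y y') : Continuous y :=
  continuous_iff_continuousAt.2 fun x => (h.hd x).continuousAt

lemma continuous_snd (h : EFSol p α m κ y y') : Continuous y' :=
  continuous_iff_continuousAt.2 fun x => (h.hd' x).continuousAt

lemma hasDerivAt_eqForm (hω : α ^ 2 / 4 + ω ^ 2 = p - 1) (h : EFSol p α m κ y y') (t : ℝ) :
    HasDerivAt (eqForm α ω y y') (-α * eqForm α ω y y' t + 2 * (y' t + α / 2 * (y t - 1)) *
      (-(y t ^ p - 1 - p * (y t - 1)) + κ * Real.exp (2 * m * t) * y t)) t := by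
  have h1 := (((h.hd' t).add (((h.hd t).sub_const 1).const_mul (α / 2))).pow 2).add
    ((((h.hd t).sub_const 1).pow 2).const_mul (ω ^ 2))
  refine h1.congr_deriv ?_
  simp [eqForm]
  have : ω ^ 2 = p - 1 - α ^ 2 / 4 := by linarith
  rw [this]
  ring

/-- Near the equilibrium, `eqForm` decays exponentially up to the forcing `e^{4mt}`. -/
lemma eqForm_decay (hp : 1 < p) (hα : 0 < α) (hm : 0 < m) (hκ : 0 ≤ κ) (hω0 : 0 < ω)
    (hω : α ^ 2 / 4 + ω ^ 2 = p - 1) :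
    ∃ δ > 0, ∃ C ≥ 0, δ ≤ 1 / 2 ∧ ∀ y y' : ℝ → ℝ, EFSol p α m κ y y' → ∀ a b : ℝ,
      eqForm α ω y y' a + C * Real.exp (4 * m * b) < (ω * δ) ^ 2 → ∀ t ∈ Icc a b,
        eqForm α ω y y' t < (ω * δ) ^ 2 ∧
        eqForm α ω y y' t ≤
          eqForm α ω y y' a * Real.exp (-(α / 2 * (t - a))) + C * Real.exp (4 * m * t) := by
  obtain ⟨C₂, hC₂, hquad⟩ := exists_rpow_quadratic hp
  set δ : ℝ := min (1 / 2) (α * ω / (4 * (C₂ + 1))) with hδ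
  have hδ0 : 0 < δ := by rw [hδ]; positivity
  have hδ1 : δ ≤ 1 / 2 := min_le_left _ _
  have hδ2 : C₂ * δ ≤ α * ω / 4 := by
    calc C₂ * δ ≤ (C₂ + 1) * (α * ω / (4 * (C₂ + 1))) := by
          gcongr
          · linarith
          · exact min_le_right _ _
      _ = α * ω / 4 := by field_simp
  set C : ℝ := 16 * κ ^ 2 / α / (α / 2 + 4 * m) with hC
  have hC0 : 0 ≤ C := by positivity
  have key : ∀ y y' : ℝ → ℝ, EFSol p α m κ y y' → ∀ a t : ℝ, a ≤ t →
      (∀ s ∈ Icc a t, eqForm α ω y y' s ≤ (ω * δ) ^ 2) →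
      eqForm α ω y y' t ≤
        eqForm α ω y y' a * Real.exp (-(α / 2 * (t - a))) + C * Real.exp (4 * m * t) := by
    intro y y' h a t hat hs
    have hmono := le_of_hasDerivAt_nonpos
      (f := fun s => eqForm α ω y y' s * Real.exp (α / 2 * s) -
        C * Real.exp ((α / 2 + 4 * m) * s))
      (f' := fun s => (-α * eqForm α ω y y' s + 2 * (y' s + α / 2 * (y s - 1)) *
        (-(y s ^ p - 1 - p * (y s - 1)) + κ * Real.exp (2 * m * s) * y s)) * Real.exp (α / 2 * s)
        + eqForm α ω y y' s * (α / 2 * Real.exp (α / 2 * s)) -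
        C * ((α / 2 + 4 * m) * Real.exp ((α / 2 + 4 * m) * s))) hat
      (by
        have c1 := h.continuous_fst
        have c2 := h.continuous_snd
        unfold eqForm
        fun_prop)
      (fun s _ => ((h.hasDerivAt_eqForm hω s).mul (hasDerivAt_exp_mul (α / 2) s)).sub
        ((hasDerivAt_exp_mul (α / 2 + 4 * m) s).const_mul C))
      (fun s hs' => by
        have hq := hs s (Ioo_subset_Icc_self hs')
        have hy1 : |y s - 1| ≤ δ := by
          have := abs_sub_one_le_of_eqForm hω0 (by positivity) hq
          rwa [mul_div_cancel_left₀ _ hω0.ne'] at this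
        have hg := hquad (y s) 1 (hy1.trans hδ1) (by norm_num)
        rw [Real.one_rpow, sub_self, abs_zero, add_zero] at hg
        set E := Real.exp (2 * m * s) with hE
        have hE0 : 0 < E := Real.exp_pos _
        set X := y' s + α / 2 * (y s - 1) with hX
        set u := y s - 1 with hu
        have hqe : eqForm α ω y y' s = X ^ 2 + ω ^ 2 * u ^ 2 := rfl
        have hy2 : |y s| ≤ 2 := by
          have : y s = u + 1 := by rw [hu]; ring
          rw [this]
          refine (abs_add_le _ _).trans ?_
          rw [abs_one]; linarith
        have hE4 : Real.exp ((α / 2 + 4 * m) * s) = Real.exp (α / 2 * s) * E ^ 2 := by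
          rw [hE, ← Real.exp_nat_mul, ← Real.exp_add]; congr 1; push_cast; ring
        have hCE : C * ((α / 2 + 4 * m) * Real.exp ((α / 2 + 4 * m) * s))
            = Real.exp (α / 2 * s) * (16 * κ ^ 2 / α * E ^ 2) := by
          rw [hE4, hC]; field_simp
        rw [hCE, hqe]
        have hfin := eqForm_deriv_bound (X := X) hα hδ2
          (by refine hg.trans ?_; gcongr) (F := κ * E * y s) (by
            rw [abs_mul, abs_of_nonneg (by positivity : 0 ≤ κ * E)]; gcongr)
        have := mul_le_mul_of_nonneg_left hfin (Real.exp_pos (α / 2 * s)).le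
        linarith)
    have hpos := Real.exp_pos (-(α / 2 * t))
    have e1 : Real.exp (α / 2 * t) * Real.exp (-(α / 2 * t)) = 1 := by
      rw [← Real.exp_add]; simp
    have e2 : Real.exp (α / 2 * a) * Real.exp (-(α / 2 * t)) = Real.exp (-(α / 2 * (t - a))) := by
      rw [← Real.exp_add]; congr 1; ring
    have e3 : Real.exp ((α / 2 + 4 * m) * t) * Real.exp (-(α / 2 * t)) = Real.exp (4 * m * t) := by
      rw [← Real.exp_add]; congr 1; ring
    have hge : 0 ≤ C * Real.exp ((α / 2 + 4 * m) * a) := by positivity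
    calc eqForm α ω y y' t
        = eqForm α ω y y' t * Real.exp (α / 2 * t) * Real.exp (-(α / 2 * t)) := by
          rw [mul_assoc, e1, mul_one]
      _ ≤ (eqForm α ω y y' a * Real.exp (α / 2 * a) + C * Real.exp ((α / 2 + 4 * m) * t)) *
          Real.exp (-(α / 2 * t)) := by gcongr; linarith
      _ = _ := by rw [add_mul, mul_assoc, e2, mul_assoc, e3]
  refine ⟨δ, hδ0, C, hC0, hδ1, fun y y' h a b hab => ?_⟩
  have hlt := lt_of_bootstrap (Q := eqForm α ω y y') (a := a) (b := b) (M := (ω * δ) ^ 2)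
    (fun x _ => (h.hasDerivAt_eqForm hω x).continuousAt.continuousWithinAt)
    (by have := Real.exp_pos (4 * m * b); nlinarith)
    (fun t ht hs => by
      refine (key y y' h a t ht.1 hs).trans_lt (lt_of_le_of_lt ?_ hab)
      have h1 : Real.exp (-(α / 2 * (t - a))) ≤ 1 := Real.exp_le_one_iff.2 (by
        have := mul_nonneg (half_pos hα).le (sub_nonneg.2 ht.1); linarith)
      have h2 : Real.exp (4 * m * t) ≤ Real.exp (4 * m * b) := Real.exp_le_exp.2 (by
        have := ht.2; gcongr)
      have h3 := mul_le_of_le_one_right (eqForm_nonneg α ω y y' a) h1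
      gcongr)
  exact fun t ht => ⟨hlt t ht, key y y' h a t ht.1 fun s hs => (hlt s ⟨hs.1, hs.2.trans ht.2⟩).le⟩

lemma tendsto_deriv_atBot (hα : 0 < α) (hm : 0 < m) (h : EFSol p α m κ y y')
    (h1 : Tendsto y atBot (𝓝 1)) : Tendsto y' atBot (𝓝 0) := by
  have hr : Tendsto (fun t => y t - y t ^ p + κ * Real.exp (2 * m * t) * y t) atBot (𝓝 0) := by
    have e1 := h1.rpow_const (p := p) (Or.inl one_ne_zero)
    have e2 := (tendsto_exp_mul_atBot (c := 2 * m) (by linarith)).const_mul κ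
    have := (h1.sub e1).add (e2.mul h1)
    simpa using this
  rw [Metric.tendsto_nhds] at h1 hr ⊢
  intro ε hε
  set η : ℝ := ε / (4 * (1 + α)) with hη
  have hη0 : 0 < η := by positivity
  have hηε : (3 + 2 * α) * η < ε := by
    have : ε = 4 * (1 + α) * η := by rw [hη]; field_simp
    nlinarith [mul_pos hα hη0]
  obtain ⟨T, hT⟩ := eventually_atBot.1 ((h1 η hη0).and (hr η hη0))
  filter_upwards [eventually_le_atBot (T - 1)] with t ht
  obtain ⟨ξ, hξ, he⟩ := exists_hasDerivAt_eq_slope y y' (a := t) (b := t + 1) (by linarith)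
    (fun x _ => (h.hd x).continuousAt.continuousWithinAt) (fun x _ => h.hd x)
  rw [add_sub_cancel_left, div_one] at he
  have k1 := abs_lt.1 (hT t (by linarith)).1
  have k2 := abs_lt.1 (hT (t + 1) (by linarith)).1
  have k3 := abs_lt.1 (hT ξ (by linarith [hξ.2])).1
  have hg := abs_sub_le_of_hasDerivAt (f := fun s => y' s + α * y s)
    (f' := fun s => y s - y s ^ p + κ * Real.exp (2 * m * s) * y s) (a := t) (b := ξ) (C := η)
    (fun x _ => ((h.hd' x).add ((h.hd x).const_mul α)).congr_deriv (by ring))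
    (fun x hx => by
      rw [uIcc_of_le hξ.1.le] at hx
      have := (hT x (by linarith [hx.2, hξ.2])).2.le
      rwa [Real.dist_eq, sub_zero] at this)
  have hξt : |ξ - t| ≤ 1 := by rw [abs_of_pos (by linarith [hξ.1])]; linarith [hξ.2]
  have hg' := abs_le.1 (hg.trans (mul_le_of_le_one_right hη0.le hξt))
  rw [Real.dist_eq, sub_zero, abs_lt]
  constructor <;> nlinarith

/-- The singular solution approaches the equilibrium at rate `e^{2mt}`. -/
lemma eqForm_singular_le (hα : 0 < α) (hm : 0 < m) (h : EFSol p α m κ y y')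
    (h1 : Tendsto y atBot (𝓝 1)) {C M b : ℝ} (hb : C * Real.exp (4 * m * b) < M)
    (hdecay : ∀ a b : ℝ, eqForm α ω y y' a + C * Real.exp (4 * m * b) < M → ∀ t ∈ Icc a b,
        eqForm α ω y y' t ≤
          eqForm α ω y y' a * Real.exp (-(α / 2 * (t - a))) + C * Real.exp (4 * m * t))
    {t : ℝ} (ht : t ≤ b) : eqForm α ω y y' t ≤ C * Real.exp (4 * m * t) := by
  have h2 := h.tendsto_deriv_atBot hα hm h1
  have hq : Tendsto (eqForm α ω y y') atBot (𝓝 0) := by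
    have := ((h2.add ((h1.sub_const 1).const_mul (α / 2))).pow 2).add
      (((h1.sub_const 1).pow 2).const_mul (ω ^ 2))
    simp only [sub_self, mul_zero, add_zero, ne_eq, OfNat.ofNat_ne_zero, not_false_eq_true,
      zero_pow] at this
    exact this
  have hq' := hq.add_const (C * Real.exp (4 * m * t))
  rw [zero_add] at hq'
  refine ge_of_tendsto hq' ?_
  have hq2 := hq.add_const (C * Real.exp (4 * m * b))
  rw [zero_add] at hq2
  filter_upwards [hq2.eventually (gt_mem_nhds hb), eventually_le_atBot t] with a ha hat
  refine (hdecay a b ha t ⟨hat, ht⟩).trans ?_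
  have h1 : Real.exp (-(α / 2 * (t - a))) ≤ 1 := Real.exp_le_one_iff.2 (by
    have := mul_nonneg (half_pos hα).le (sub_nonneg.2 hat); linarith)
  have h3 := mul_le_of_le_one_right (eqForm_nonneg α ω y y' a) h1
  linarith

end EFSol

/-! ### Transport of the phase of a difference of solutions -/

/-- Solutions of `z' = μ z + g` with `‖g‖ ≤ k₀ ‖z‖` stay close to those of `z' = μ z`. -/
lemma norm_exp_mul_sub_le {μ : ℂ} {z g : ℝ → ℂ} {k₀ k P : ℝ → ℝ} {a b : ℝ} (hab : a ≤ b)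
    (hz : ∀ t ∈ Icc a b, HasDerivAt z (μ * z t + g t) t)
    (hg : ∀ t ∈ Icc a b, ‖g t‖ ≤ k₀ t * ‖z t‖) (hP : ∀ t, HasDerivAt P (k t) t)
    (hk0 : ∀ t, 0 ≤ k₀ t) (hk : ∀ t, k₀ t < k t) (hza : z a ≠ 0) :
    ‖Complex.exp (-μ * (b - a)) * z b - z a‖ ≤ ‖z a‖ * (Real.exp (P b - P a) - 1) := by
  have hexp : ∀ t : ℝ, HasDerivAt (fun t : ℝ => Complex.exp (-μ * (t - a)))
      (Complex.exp (-μ * (t - a)) * -μ) t := fun t => by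
    have h1 : HasDerivAt (fun t : ℝ => -μ * ((t : ℂ) - a)) (-μ * 1) t :=
      (((hasDerivAt_id t).ofReal_comp).sub_const (a : ℂ)).const_mul (-μ)
    simpa using h1.cexp
  have hf : ∀ t ∈ Icc a b, HasDerivAt (fun t : ℝ => Complex.exp (-μ * (t - a)) * z t - z a)
      (Complex.exp (-μ * (t - a)) * g t) t := fun t ht =>
    (((hexp t).mul (hz t ht)).sub_const (z a)).congr_deriv (by ring)
  have hB : ∀ t, HasDerivAt (fun t => ‖z a‖ * (Real.exp (P t - P a) - 1))
      (‖z a‖ * (Real.exp (P t - P a) * k t)) t := fun t =>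
    ((((hP t).sub_const (P a)).exp).sub_const 1).const_mul _
  refine image_norm_le_of_norm_deriv_right_lt_deriv_boundary'
    (f := fun t : ℝ => Complex.exp (-μ * (t - a)) * z t - z a)
    (f' := fun t : ℝ => Complex.exp (-μ * (t - a)) * g t)
    (B := fun t => ‖z a‖ * (Real.exp (P t - P a) - 1))
    (B' := fun t => ‖z a‖ * (Real.exp (P t - P a) * k t))
    (fun t ht => (hf t ht).continuousAt.continuousWithinAt)
    (fun t ht => (hf t (Ico_subset_Icc_self ht)).hasDerivWithinAt) (by simp)
    (fun t _ => (hB t).continuousAt.continuousWithinAt)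
    (fun t _ => (hB t).hasDerivWithinAt) ?_ (right_mem_Icc.2 hab)
  intro t ht heq
  have hza' : 0 < ‖z a‖ := norm_pos_iff.2 hza
  have h1 : ‖Complex.exp (-μ * (t - a)) * z t‖ ≤ ‖z a‖ * Real.exp (P t - P a) := by
    calc ‖Complex.exp (-μ * (t - a)) * z t‖
        = ‖(Complex.exp (-μ * (t - a)) * z t - z a) + z a‖ := by rw [sub_add_cancel]
      _ ≤ ‖z a‖ * (Real.exp (P t - P a) - 1) + ‖z a‖ := (norm_add_le _ _).trans_eq (by rw [heq])
      _ = _ := by ring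
  calc ‖Complex.exp (-μ * (t - a)) * g t‖
      = ‖Complex.exp (-μ * (t - a))‖ * ‖g t‖ := norm_mul _ _
    _ ≤ ‖Complex.exp (-μ * (t - a))‖ * (k₀ t * ‖z t‖) := by
        gcongr; exact hg t (Ico_subset_Icc_self ht)
    _ = k₀ t * ‖Complex.exp (-μ * (t - a)) * z t‖ := by rw [norm_mul]; ring
    _ ≤ k₀ t * (‖z a‖ * Real.exp (P t - P a)) := mul_le_mul_of_nonneg_left h1 (hk0 t)
    _ < k t * (‖z a‖ * Real.exp (P t - P a)) := by
        have := Real.exp_pos (P t - P a)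
        exact mul_lt_mul_of_pos_right (hk t) (by positivity)
    _ = _ := by ring

/-- The complex coordinate `v' + (α/2) v + i ω v` diagonalizing the linearization at `1`. -/
def phase (α ω : ℝ) (v v' : ℝ → ℝ) (t : ℝ) : ℂ :=
  ((v' t + α / 2 * v t : ℝ) : ℂ) + ((ω * v t : ℝ) : ℂ) * Complex.I

/-- The eigenvalue of the linearization at `1`. -/
def phaseRate (α ω : ℝ) : ℂ := ((-(α / 2) : ℝ) : ℂ) + (ω : ℂ) * Complex.I

lemma phase_im (α ω : ℝ) (v v' : ℝ → ℝ) (t : ℝ) : (phase α ω v v' t).im = ω * v t := by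
  simp [phase]

lemma phase_re (α ω : ℝ) (v v' : ℝ → ℝ) (t : ℝ) :
    (phase α ω v v' t).re = v' t + α / 2 * v t := by
  simp [phase]

lemma mul_abs_le_norm_phase {ω : ℝ} (α : ℝ) (hω : 0 < ω) (v v' : ℝ → ℝ) (t : ℝ) :
    ω * |v t| ≤ ‖phase α ω v v' t‖ := by
  have := Complex.abs_im_le_norm (phase α ω v v' t)
  rwa [phase_im, abs_mul, abs_of_pos hω] at this

namespace EFSol

variable {p α m κ ω : ℝ} {y₁ y₁' y₂ y₂' : ℝ → ℝ}

lemma hasDerivAt_phase_sub (hω : α ^ 2 / 4 + ω ^ 2 = p - 1) (h₁ : EFSol p α m κ y₁ y₁')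
    (h₂ : EFSol p α m κ y₂ y₂') (t : ℝ) :
    HasDerivAt (phase α ω (y₁ - y₂) (y₁' - y₂'))
      (phaseRate α ω * phase α ω (y₁ - y₂) (y₁' - y₂') t +
        ((-(y₁ t ^ p - y₂ t ^ p - p * (y₁ t - y₂ t)) +
          κ * Real.exp (2 * m * t) * (y₁ t - y₂ t) : ℝ) : ℂ)) t := by
  have d1 := (h₁.hd t).sub (h₂.hd t)
  have d2 := (h₁.hd' t).sub (h₂.hd' t)
  have h := ((d2.add (d1.const_mul (α / 2))).ofReal_comp).add
    (((d1.const_mul ω).ofReal_comp).mul_const Complex.I)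
  refine h.congr_deriv ?_
  have hp : p = 1 + α ^ 2 / 4 + ω ^ 2 := by linarith
  apply Complex.ext
  · simp [phase, phaseRate]
    linear_combination -(y₁ t - y₂ t) * hp
  · simp [phase, phaseRate]
    ring

/-- Near `-∞`, the phase of `y₁ - y₂` (with `y₂ → 1`) is transported almost linearly as long
as `y₁` starts close to the equilibrium. -/
lemma exists_transport (hp : 1 < p) (hα : 0 < α) (hm : 0 < m) (hκ : 0 ≤ κ) (hω0 : 0 < ω)
    (hω : α ^ 2 / 4 + ω ^ 2 = p - 1) {ε : ℝ} (hε : 0 < ε) (T : ℝ) :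
    ∃ δ > 0, ∃ t₀ ≤ T, ∀ y₁ y₁' y₂ y₂' : ℝ → ℝ, EFSol p α m κ y₁ y₁' → EFSol p α m κ y₂ y₂' →
      Tendsto y₂ atBot (𝓝 1) → ∀ a ≤ t₀, eqForm α ω y₁ y₁' a ≤ δ →
      phase α ω (y₁ - y₂) (y₁' - y₂') a ≠ 0 →
      ‖Complex.exp (-phaseRate α ω * (t₀ - a)) * phase α ω (y₁ - y₂) (y₁' - y₂') t₀ -
        phase α ω (y₁ - y₂) (y₁' - y₂') a‖ ≤ ε * ‖phase α ω (y₁ - y₂) (y₁' - y₂') a‖ ∧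
      ∀ t ∈ Icc a t₀, eqForm α ω y₁ y₁' t ≤ ε ^ 2 := by
  obtain ⟨δ, hδ, C, hC, hδ1, hdecay⟩ := eqForm_decay hp hα hm hκ hω0 hω
  obtain ⟨C₂, hC₂, hquad⟩ := exists_rpow_quadratic hp
  set c := √C with hc
  have hc2 : c ^ 2 = C := Real.sq_sqrt hC
  have hc0 : 0 ≤ c := Real.sqrt_nonneg _
  set D : ℝ := C₂ / ω ^ 2 * (1 + 2 * c) + κ / ω + 1 with hD
  have hD0 : 0 < D := by positivity
  have hE := tendsto_exp_mul_atBot (c := 2 * m) (by linarith)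
  have e1 : ∀ᶠ t in atBot, Real.exp (2 * m * t) ^ 2 + C * Real.exp (2 * m * t) ^ 2
      < (ω * δ) ^ 2 := by
    have : Tendsto (fun t => Real.exp (2 * m * t) ^ 2 + C * Real.exp (2 * m * t) ^ 2) atBot
        (𝓝 (0 ^ 2 + C * 0 ^ 2)) := (hE.pow 2).add ((hE.pow 2).const_mul C)
    exact this.eventually (gt_mem_nhds (by norm_num; positivity))
  have e2 : ∀ᶠ t in atBot, Real.exp (2 * m * t) + c * Real.exp (2 * m * t) < ε := by
    have : Tendsto (fun t => Real.exp (2 * m * t) + c * Real.exp (2 * m * t)) atBot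
        (𝓝 (0 + c * 0)) := hE.add (hE.const_mul c)
    exact this.eventually (gt_mem_nhds (by simpa using hε))
  have e3 : ∀ᶠ t in atBot, Real.exp (D * (4 / α * Real.exp (2 * m * t) +
      Real.exp (2 * m * t) / (2 * m))) - 1 < ε := by
    have : Tendsto (fun t => Real.exp (D * (4 / α * Real.exp (2 * m * t) +
      Real.exp (2 * m * t) / (2 * m))) - 1) atBot
        (𝓝 (Real.exp (D * (4 / α * 0 + 0 / (2 * m))) - 1)) :=
      (((((hE.const_mul (4 / α)).add (hE.div_const _)).const_mul D).rexp)).sub_const 1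
    exact this.eventually (gt_mem_nhds (by simpa using hε))
  obtain ⟨t₀, ⟨⟨⟨h1, h2⟩, h3⟩, hT⟩⟩ := (((e1.and e2).and e3).and (eventually_le_atBot T)).exists
  set q := Real.exp (2 * m * t₀) with hq
  have hq0 : 0 < q := Real.exp_pos _
  have hE4 : ∀ t, Real.exp (4 * m * t) = Real.exp (2 * m * t) ^ 2 := fun t => by
    rw [← Real.exp_nat_mul]; congr 1; push_cast; ring
  refine ⟨q ^ 2, by positivity, t₀, hT, ?_⟩
  intro y₁ y₁' y₂ y₂' hy₁ hy₂ h₂ a ha hsm hza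
  have hb₁ : ∀ t ∈ Icc a t₀, eqForm α ω y₁ y₁' t ≤
      (q * Real.exp (-(α / 4) * (t - a)) + c * Real.exp (2 * m * t)) ^ 2 := fun t ht => by
    refine (hdecay y₁ y₁' hy₁ a t₀ (by rw [hE4]; linarith) t ht).2.trans ?_
    have e5 : Real.exp (-(α / 2 * (t - a))) = Real.exp (-(α / 4) * (t - a)) ^ 2 := by
      rw [← Real.exp_nat_mul]; congr 1; push_cast; ring
    rw [e5, hE4, ← hc2]
    have e6 := mul_le_mul_of_nonneg_right hsm (sq_nonneg (Real.exp (-(α / 4) * (t - a))))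
    have e7 : 0 ≤ 2 * (q * Real.exp (-(α / 4) * (t - a))) * (c * Real.exp (2 * m * t)) := by
      positivity
    linarith [show (q * Real.exp (-(α / 4) * (t - a)) + c * Real.exp (2 * m * t)) ^ 2
      = q ^ 2 * Real.exp (-(α / 4) * (t - a)) ^ 2 + c ^ 2 * Real.exp (2 * m * t) ^ 2 +
        2 * (q * Real.exp (-(α / 4) * (t - a))) * (c * Real.exp (2 * m * t)) by ring]
  have hCt : C * Real.exp (4 * m * t₀) < (ω * δ) ^ 2 := by
    rw [hE4]; linarith [sq_nonneg q]
  have hb₂ : ∀ t ∈ Icc a t₀, eqForm α ω y₂ y₂' t ≤ (c * Real.exp (2 * m * t)) ^ 2 :=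
    fun t ht => by
    have := hy₂.eqForm_singular_le hα hm h₂ hCt
      (fun a b h t ht => (hdecay y₂ y₂' hy₂ a b h t ht).2) ht.2
    rwa [mul_pow, hc2, ← hE4]
  have hd₁ : ∀ t ∈ Icc a t₀, |y₁ t - 1| ≤ 1 / 2 := fun t ht => by
    have := abs_sub_one_le_of_eqForm hω0 (by positivity)
      (hdecay y₁ y₁' hy₁ a t₀ (by rw [hE4]; linarith) t ht).1.le
    rw [mul_div_cancel_left₀ _ hω0.ne'] at this
    exact this.trans hδ1
  have hle : ∀ t ∈ Icc a t₀, Real.exp (2 * m * t) ≤ q := fun t ht =>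
    Real.exp_le_exp.2 (mul_le_mul_of_nonneg_left ht.2 (by linarith))
  have hd₂ : ∀ t ∈ Icc a t₀, |y₂ t - 1| ≤ 1 / 2 := fun t ht => by
    have h4 : eqForm α ω y₂ y₂' t ≤ (ω * δ) ^ 2 := by
      refine (hb₂ t ht).trans (le_trans ?_ h1.le)
      rw [mul_pow, hc2]
      have : C * Real.exp (2 * m * t) ^ 2 ≤ C * q ^ 2 := by gcongr; exact hle t ht
      linarith [sq_nonneg q]
    have := abs_sub_one_le_of_eqForm hω0 (by positivity) h4
    rw [mul_div_cancel_left₀ _ hω0.ne'] at this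
    exact this.trans hδ1
  constructor
  · have key := norm_exp_mul_sub_le (μ := phaseRate α ω)
      (z := phase α ω (y₁ - y₂) (y₁' - y₂'))
      (g := fun t => ((-(y₁ t ^ p - y₂ t ^ p - p * (y₁ t - y₂ t)) +
          κ * Real.exp (2 * m * t) * (y₁ t - y₂ t) : ℝ) : ℂ))
      (k₀ := fun t => (C₂ / ω * (q * Real.exp (-(α / 4) * (t - a)) +
        2 * c * Real.exp (2 * m * t)) + κ * Real.exp (2 * m * t)) / ω)
      (k := fun t => D * (q * Real.exp (-(α / 4) * (t - a)) + Real.exp (2 * m * t)))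
      (P := fun t => D * (-(4 / α) * (q * Real.exp (-(α / 4) * (t - a))) +
        Real.exp (2 * m * t) / (2 * m))) ha
      (fun t _ => hasDerivAt_phase_sub hω hy₁ hy₂ t) ?_ ?_ (fun t => by positivity) ?_ hza
    · refine key.trans ?_
      rw [mul_comm]
      gcongr
      refine le_trans ?_ h3.le
      gcongr
      rw [← mul_sub]
      gcongr
      have p1 := Real.exp_pos (-(α / 4) * (t₀ - a))
      have p2 := Real.exp_pos (2 * m * a)
      have p3 : 0 ≤ 4 / α * (q * Real.exp (-(α / 4) * (t₀ - a))) := by positivity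
      have p4 : 0 ≤ Real.exp (2 * m * a) / (2 * m) := by positivity
      simp only [sub_self, mul_zero, Real.exp_zero, mul_one]
      linarith
    · intro t ht
      rw [Complex.norm_real, Real.norm_eq_abs]
      have s1 := abs_sub_one_le_of_eqForm hω0 (by positivity) (hb₁ t ht)
      have s2 := abs_sub_one_le_of_eqForm hω0 (by positivity) (hb₂ t ht)
      have s3 := hquad (y₁ t) (y₂ t) (hd₁ t ht) (hd₂ t ht)
      have s4 : |y₁ t - y₂ t| ≤ ‖phase α ω (y₁ - y₂) (y₁' - y₂') t‖ / ω := by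
        rw [le_div_iff₀ hω0, mul_comm]
        exact mul_abs_le_norm_phase α hω0 (y₁ - y₂) (y₁' - y₂') t
      calc _ ≤ C₂ * (|y₁ t - 1| + |y₂ t - 1|) * |y₁ t - y₂ t| +
            κ * Real.exp (2 * m * t) * |y₁ t - y₂ t| := by
            refine (abs_add_le _ _).trans ?_
            rw [abs_neg, abs_mul (κ * _), abs_of_nonneg (by positivity : 0 ≤ κ * Real.exp (2 * m * t))]
            gcongr
        _ ≤ (C₂ * ((q * Real.exp (-(α / 4) * (t - a)) + c * Real.exp (2 * m * t)) / ω +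
              c * Real.exp (2 * m * t) / ω) + κ * Real.exp (2 * m * t)) *
              (‖phase α ω (y₁ - y₂) (y₁' - y₂') t‖ / ω) := by
            rw [← add_mul]
            gcongr
        _ = _ := by field_simp; ring
    · intro t
      have r1 := hasDerivAt_exp_mul (2 * m) t
      have r2 := (((hasDerivAt_id t).sub_const a).const_mul (-(α / 4))).exp
      refine ((((r2.const_mul q).const_mul (-(4 / α))).add (r1.div_const (2 * m))).const_mul
        D).congr_deriv ?_
      simp only [id]
      field_simp
    · intro t
      have p1 := Real.exp_pos (-(α / 4) * (t - a))
      have p2 := Real.exp_pos (2 * m * t)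
      rw [← sub_pos]
      have : D * (q * Real.exp (-(α / 4) * (t - a)) + Real.exp (2 * m * t)) -
          (C₂ / ω * (q * Real.exp (-(α / 4) * (t - a)) +
        2 * c * Real.exp (2 * m * t)) + κ * Real.exp (2 * m * t)) / ω =
        (C₂ / ω ^ 2 * (2 * c) + κ / ω + 1) * (q * Real.exp (-(α / 4) * (t - a))) +
        (C₂ / ω ^ 2 + 1) * Real.exp (2 * m * t) := by
        rw [hD]; field_simp; ring
      rw [this]
      positivity
  · intro t ht
    refine (hb₁ t ht).trans ?_
    have p1 : Real.exp (-(α / 4) * (t - a)) ≤ 1 := Real.exp_le_one_iff.2 (by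
      have := mul_nonneg (by linarith : 0 ≤ α / 4) (sub_nonneg.2 ht.1); linarith)
    have p2 := mul_le_of_le_one_right hq0.le p1
    gcongr
    have := mul_le_mul_of_nonneg_left (hle t ht) hc0
    linarith

end EFSol

/-! ### The family of regular solutions with large initial value -/

namespace RadSol

variable {d p α m θ B e : ℝ} {w w' u u' : ℝ → ℝ}

/-- A radial solution decreases strictly as long as it stays above the equilibrium `1`. -/
lemma deriv_neg (hp : 1 < p) (hd : 0 ≤ d) (h : RadSol d p 1 u u') {R : ℝ}
    (h1 : ∀ s ∈ Ioc 0 R, 1 < u s) {s : ℝ} (hs : s ∈ Ioc 0 R) : u' s < 0 := by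
  have hanti : StrictAntiOn (fun s => s ^ d * u' s) (Icc 0 R) := by
    refine strictAntiOn_of_hasDerivWithinAt_neg (convex_Icc 0 R)
      (f' := fun s => d * s ^ (d - 1) * u' s + s ^ d * (-(d / s) * u' s + 1 * u s - u s ^ p))
      ((Real.continuous_rpow_const hd).continuousOn.mul
        (h.cont'.mono fun x hx => hx.1)) (fun x hx => ?_) (fun x hx => ?_)
    · rw [interior_Icc] at hx
      exact ((Real.hasDerivAt_rpow_const (Or.inl hx.1.ne')).mul (h.hd' x hx.1)).hasDerivWithinAt
    · rw [interior_Icc] at hx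
      have hx1 := h1 x ⟨hx.1, hx.2.le⟩
      have e1 : x ^ (d - 1) = x ^ d / x := by rw [Real.rpow_sub_one hx.1.ne']
      have e2 : d * x ^ (d - 1) * u' x + x ^ d * (-(d / x) * u' x + 1 * u x - u x ^ p)
          = -(x ^ d * (u x ^ p - u x)) := by rw [e1]; ring
      rw [e2]
      have := Real.self_lt_rpow_of_one_lt hx1 hp
      have := Real.rpow_pos_of_pos hx.1 d
      exact neg_neg_of_pos (mul_pos this (by linarith))
  have h2 := hanti (left_mem_Icc.2 (hs.1.le.trans hs.2)) (Ioc_subset_Icc_self hs) hs.1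
  simp only [h.zero', mul_zero] at h2
  exact (pos_iff_neg_of_mul_neg h2).1 (Real.rpow_pos_of_pos hs.1 d)

/-- The rescaling which normalizes the initial value `e^{mθL}`. -/
lemma rescale (hc : EFConst d p α m θ B) (h : RadSol d p 1 u u') (L : ℝ) :
    RadSol d p (Real.exp (-(2 * m) * L))
      (fun ρ => Real.exp (-(m * θ * L)) * u (Real.exp (-(m * L)) * ρ))
      (fun ρ => Real.exp (-(m * θ * L)) * (Real.exp (-(m * L)) * u' (Real.exp (-(m * L)) * ρ))) := by
  set r := Real.exp (-(m * L)) with hr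
  set c := Real.exp (-(m * θ * L)) with hcc
  have hr0 : 0 < r := Real.exp_pos _
  have hc0 : 0 < c := Real.exp_pos _
  have hmaps : MapsTo (fun ρ => r * ρ) (Ici (0 : ℝ)) (Ici 0) := fun x hx =>
    mul_nonneg hr0.le hx
  have hid : ∀ ρ : ℝ, HasDerivAt (fun ρ => r * ρ) r ρ := fun ρ => by
    simpa using (hasDerivAt_id ρ).const_mul r
  refine ⟨?_, ?_, ?_, fun s hs => ?_, fun s hs => ?_⟩
  · exact continuousOn_const.mul (h.cont.comp (by fun_prop) hmaps)
  · exact continuousOn_const.mul (continuousOn_const.mul (h.cont'.comp (by fun_prop) hmaps))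
  · simp [h.zero']
  · refine (((h.hd _ (mul_pos hr0 hs)).comp s (hid s)).const_mul c).congr_deriv ?_
    ring
  · refine (((((h.hd' _ (mul_pos hr0 hs)).comp s (hid s))).const_mul r).const_mul c).congr_deriv ?_
    have e1 : Real.exp (-(2 * m) * L) = r ^ 2 := by
      rw [hr, ← Real.exp_nat_mul]; congr 1; push_cast; ring
    have e2 : (c * u (r * s)) ^ p = c * r ^ 2 * u (r * s) ^ p := by
      rw [mul_rpow_of_pos_left hc0, hcc, hr, ← Real.exp_mul, ← Real.exp_nat_mul, ← Real.exp_add]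
      congr 2
      have := hc.hθp
      push_cast
      linear_combination -(m * L) * this
    rw [e1, e2]
    field_simp

end RadSol

lemma emden_rescale (m θ B L τ : ℝ) (u : ℝ → ℝ) :
    emden m θ B (fun ρ => Real.exp (-(m * θ * L)) * u (Real.exp (-(m * L)) * ρ)) τ
      = emden m θ B u (τ - L) := by
  have e1 : Real.exp (-(m * L)) * Real.exp (m * τ) = Real.exp (m * (τ - L)) := by
    rw [← Real.exp_add]; congr 1; ring
  have e2 : Real.exp (m * θ * (τ - L)) = Real.exp (m * θ * τ) * Real.exp (-(m * θ * L)) := by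
    rw [← Real.exp_add]; congr 1; ring
  simp only [emden]
  rw [e1, e2]
  ring

lemma emdenDeriv_rescale (m θ B L τ : ℝ) (u u' : ℝ → ℝ) :
    emdenDeriv m θ B (fun ρ => Real.exp (-(m * θ * L)) * u (Real.exp (-(m * L)) * ρ))
      (fun ρ => Real.exp (-(m * θ * L)) * (Real.exp (-(m * L)) * u' (Real.exp (-(m * L)) * ρ))) τ
      = emdenDeriv m θ B u u' (τ - L) := by
  have e1 : Real.exp (m * (τ - L)) = Real.exp (-(m * L)) * Real.exp (m * τ) := by
    rw [← Real.exp_add]; congr 1; ring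
  have e2 : Real.exp (m * θ * (τ - L)) = Real.exp (m * θ * τ) * Real.exp (-(m * θ * L)) := by
    rw [← Real.exp_add]; congr 1; ring
  simp only [emdenDeriv]
  rw [e1, e2]
  ring

/-- A zero of the phase is a common zero of the function and its derivative. -/
lemma eq_zero_of_phase_eq_zero {α ω : ℝ} (hω : 0 < ω) {v v' : ℝ → ℝ} {t : ℝ}
    (h : phase α ω v v' t = 0) : v t = 0 ∧ v' t = 0 := by
  have h1 := phase_im α ω v v' t
  have h2 := phase_re α ω v v' t
  rw [h, Complex.zero_im] at h1
  rw [h, Complex.zero_re] at h2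
  have h3 : v t = 0 := (mul_eq_zero.1 h1.symm).resolve_left hω.ne'
  rw [h3, mul_zero, add_zero] at h2
  exact ⟨h3, h2.symm⟩

lemma tendsto_phase {ι : Type*} {l : Filter ι} {α ω a b : ℝ} {v v' : ι → ℝ → ℝ} {t : ι → ℝ}
    (h : Tendsto (fun i => v i (t i)) l (𝓝 a)) (h' : Tendsto (fun i => v' i (t i)) l (𝓝 b)) :
    Tendsto (fun i => phase α ω (v i) (v' i) (t i)) l
      (𝓝 (phase α ω (fun _ => a) (fun _ => b) 0)) :=
  ((Complex.continuous_ofReal.tendsto _).comp (h'.add (h.const_mul (α / 2)))).add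
    (((Complex.continuous_ofReal.tendsto _).comp (h.const_mul ω)).mul_const Complex.I)

/-- Along the family of regular solutions with initial value `e^{mθL}`, the difference to a
solution tending to `1` at `-∞` has, at the time `τ₀ - L`, a nonzero limiting phase. -/
lemma exists_initial_data {d p α m θ B ω : ℝ} (hc : EFConst d p α m θ B) (hω : 0 < ω)
    {u u' : ℝ → ℝ → ℝ} (hu : ∀ L > 0, RadSol d p 1 (u L) (u' L) ∧ u L 0 = Real.exp (m * θ * L))
    {y y' : ℝ → ℝ} (hy : Tendsto y atBot (𝓝 1)) (hy' : Tendsto y' atBot (𝓝 0))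
    {δ : ℝ} (hδ : 0 < δ) :
    ∃ τ₀ : ℝ, ∃ z₀ : ℂ, z₀ ≠ 0 ∧
      (∀ᶠ L in atTop, eqForm α ω (emden m θ B (u L)) (emdenDeriv m θ B (u L) (u' L)) (τ₀ - L) ≤ δ) ∧
      Tendsto (fun L => phase α ω (emden m θ B (u L) - y) (emdenDeriv m θ B (u L) (u' L) - y')
        (τ₀ - L)) atTop (𝓝 z₀) ∧
      ∀ᶠ L in atTop, ∀ s ∈ Ioc 0 (Real.exp (m * (τ₀ - L))), u' L s < 0 := by
  set w : ℝ → ℝ → ℝ := fun L ρ => Real.exp (-(m * θ * L)) * u L (Real.exp (-(m * L)) * ρ) with hw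
  set w' : ℝ → ℝ → ℝ := fun L ρ =>
    Real.exp (-(m * θ * L)) * (Real.exp (-(m * L)) * u' L (Real.exp (-(m * L)) * ρ)) with hw'
  have h2m : 0 < 2 * m := by linarith [hc.hm]
  have he : Tendsto (fun L => Real.exp (-(2 * m) * L)) atTop (𝓝 0) :=
    Real.tendsto_exp_atBot.comp (tendsto_id.const_mul_atTop_of_neg (by linarith))
  obtain ⟨w₀, w₀', hw₀, hw₀0, hunif⟩ := exists_limit_radSol (l := atTop) hc he (w := w) (w' := w') (by
    filter_upwards [eventually_gt_atTop 0] with L hL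
    refine ⟨(Real.exp_pos _).le, Real.exp_le_one_iff.2 ?_, (hu L hL).1.rescale hc L, ?_⟩
    · have := mul_pos h2m hL; linarith
    · simp only [hw, mul_zero, (hu L hL).2]
      rw [← Real.exp_add]; simp)
  have hη := hw₀.efSol hc
  rw [mul_zero] at hη
  have hpos := fun t => hw₀.emden_pos hc le_rfl (by rw [hw₀0]; norm_num) t
  have hneg := fun t => hw₀.emden_energy_neg hc le_rfl (by rw [hw₀0]; norm_num) t
  rw [mul_zero] at hneg
  obtain ⟨hη1, hη1'⟩ := hη.tendsto_one hc.hp hc.hα hc.hm hpos hneg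
  have hne := fun t => hη.ne_equilibrium hc.hp hc.hα (M := ((p + 1) / 2) ^ (1 / (p - 1)))
    (fun t => by
      rw [abs_of_pos (hpos t)]
      exact EFSol.le_of_rpow_le hc.hp (hpos t)
        (by simpa using (EFSol.bounds_of_energy_neg hc.hp (hpos t) (hneg t)).1))
    (hw₀.tendsto_emden hc).1 t
  have hQ : Tendsto (eqForm α ω (emden m θ B w₀) (emdenDeriv m θ B w₀ w₀')) atTop (𝓝 0) := by
    have := ((hη1'.add ((hη1.sub_const 1).const_mul (α / 2))).pow 2).add
      (((hη1.sub_const 1).pow 2).const_mul (ω ^ 2))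
    simp only [sub_self, mul_zero, add_zero, ne_eq, OfNat.ofNat_ne_zero, not_false_eq_true,
      zero_pow] at this
    exact this
  obtain ⟨τ₀, hτ₀⟩ := (hQ.eventually (gt_mem_nhds hδ)).exists
  have hR := Real.exp_pos (m * τ₀)
  have hmem : Real.exp (m * τ₀) ∈ Icc 0 (Real.exp (m * τ₀)) := right_mem_Icc.2 hR.le
  have hl : Tendsto (fun L => emden m θ B (u L) (τ₀ - L)) atTop (𝓝 (emden m θ B w₀ τ₀)) := by
    have := ((hunif (Real.exp (m * τ₀))).1.tendsto_at hmem).const_mul (B * Real.exp (m * θ * τ₀))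
    exact this.congr fun L => emden_rescale m θ B L τ₀ (u L)
  have hl' : Tendsto (fun L => emdenDeriv m θ B (u L) (u' L) (τ₀ - L)) atTop
      (𝓝 (emdenDeriv m θ B w₀ w₀' τ₀)) := by
    have := ((((hunif (Real.exp (m * τ₀))).1.tendsto_at hmem).const_mul θ).add
      (((hunif (Real.exp (m * τ₀))).2.tendsto_at hmem).const_mul (Real.exp (m * τ₀)))).const_mul
      (m * B * Real.exp (m * θ * τ₀))
    exact this.congr fun L => emdenDeriv_rescale m θ B L τ₀ (u L) (u' L)
  have hshift : Tendsto (fun L : ℝ => τ₀ - L) atTop atBot :=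
    tendsto_atBot_add_const_left _ τ₀ tendsto_neg_atTop_atBot
  refine ⟨τ₀, _, ?_, ?_, tendsto_phase (hl.sub (hy.comp hshift)) (hl'.sub (hy'.comp hshift)), ?_⟩
  · intro h0
    obtain ⟨h1, h2⟩ := eq_zero_of_phase_eq_zero hω h0
    exact hne τ₀ ⟨by linarith, by linarith⟩
  · have hq := ((hl'.add ((hl.sub_const 1).const_mul (α / 2))).pow 2).add
      (((hl.sub_const 1).pow 2).const_mul (ω ^ 2))
    filter_upwards [hq.eventually (gt_mem_nhds hτ₀)] with L hL using hL.le
  · have hcomp : IsCompact (Icc 0 (Real.exp (m * τ₀))) := isCompact_Icc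
    obtain ⟨ρ, hρ, hmin⟩ := hcomp.exists_isMinOn ⟨_, hmem⟩
      (hw₀.cont.mono fun x hx => hx.1)
    have hc0 : 0 < w₀ ρ := hw₀.pos hc le_rfl (by rw [hw₀0]; norm_num) hρ.1
    have hbig : Tendsto (fun L => Real.exp (m * θ * L)) atTop atTop :=
      Real.tendsto_exp_atTop.comp (tendsto_id.const_mul_atTop (mul_pos hc.hm hc.hθ))
    filter_upwards [eventually_gt_atTop 0, hbig.eventually_gt_atTop (2 / w₀ ρ),
      Metric.tendstoUniformlyOn_iff.1 (hunif (Real.exp (m * τ₀))).1 (w₀ ρ / 2) (by linarith)]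
      with L hL hLb hLu s hs
    refine (hu L hL).1.deriv_neg hc.hp hc.hd (fun x hx => ?_) hs
    have hx' : Real.exp (m * L) * x ∈ Icc 0 (Real.exp (m * τ₀)) := by
      refine ⟨mul_nonneg (Real.exp_pos _).le hx.1.le, ?_⟩
      calc Real.exp (m * L) * x ≤ Real.exp (m * L) * Real.exp (m * (τ₀ - L)) := by
            gcongr; exact hx.2
        _ = Real.exp (m * τ₀) := by rw [← Real.exp_add]; congr 1; ring
    have h1 := hLu _ hx'
    have h2 := isMinOn_iff.1 hmin _ hx'
    rw [Real.dist_eq] at h1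
    have h3 : w₀ ρ / 2 < w L (Real.exp (m * L) * x) := by linarith [(abs_lt.1 h1).2]
    have h4 : w L (Real.exp (m * L) * x) = Real.exp (-(m * θ * L)) * u L x := by
      simp only [hw]
      rw [← mul_assoc (Real.exp (-(m * L))), ← Real.exp_add]; simp
    rw [h4] at h3
    have h5 : Real.exp (m * θ * L) * (Real.exp (-(m * θ * L)) * u L x) = u L x := by
      rw [← mul_assoc, ← Real.exp_add]; simp
    rw [← h5]
    rw [div_lt_iff₀ hc0] at hLb
    have h6 := mul_lt_mul_of_pos_left h3 (Real.exp_pos (m * θ * L))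
    linarith

/-! ### Directions of the differences -/

lemma norm_exp_phaseRate_mul (α ω s : ℝ) :
    ‖Complex.exp (phaseRate α ω * s)‖ = Real.exp (-(α / 2 * s)) := by
  rw [Complex.norm_exp]; simp [phaseRate]

open ComplexConjugate in
/-- If `e^{-μs₁} z₁` and `e^{-μs₂} z₂` are both close to `z₀ ≠ 0`, then the oriented angle from
`z₁` to `z₂` is close to `ω (s₂ - s₁)`. -/
lemma cross_ge {α ω s₁ s₂ : ℝ} {z₀ z₁ z₂ : ℂ}
    (h₁ : ‖Complex.exp (-phaseRate α ω * s₁) * z₁ - z₀‖ ≤ 1 / 8 * ‖z₀‖)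
    (h₂ : ‖Complex.exp (-phaseRate α ω * s₂) * z₂ - z₀‖ ≤ 1 / 8 * ‖z₀‖)
    (hs : 3 / 4 ≤ Real.sin (ω * (s₂ - s₁))) :
    1 / 4 * (‖z₁‖ * ‖z₂‖) ≤ (conj z₁ * z₂).im := by
  set x₁ := Complex.exp (-phaseRate α ω * s₁) * z₁ with hx₁
  set x₂ := Complex.exp (-phaseRate α ω * s₂) * z₂ with hx₂
  have e₁ : z₁ = Complex.exp (phaseRate α ω * s₁) * x₁ := by
    rw [hx₁, ← mul_assoc, ← Complex.exp_add]; simp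
  have e₂ : z₂ = Complex.exp (phaseRate α ω * s₂) * x₂ := by
    rw [hx₂, ← mul_assoc, ← Complex.exp_add]; simp
  have hx : conj z₁ * z₂ = ((Real.exp (-(α / 2 * s₁)) * Real.exp (-(α / 2 * s₂)) : ℝ) : ℂ) *
      (Complex.exp ((ω * (s₂ - s₁) : ℝ) * Complex.I) * (conj x₁ * x₂)) := by
    rw [e₁, e₂, map_mul, ← Complex.exp_conj, ← Real.exp_add, Complex.ofReal_exp,
      mul_mul_mul_comm, ← Complex.exp_add,
      ← mul_assoc (Complex.exp _) (Complex.exp _), ← Complex.exp_add]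
    congr 2
    simp only [phaseRate, map_mul, map_add, Complex.conj_ofReal, Complex.conj_I]
    push_cast
    ring
  have hn₁ : ‖x₁‖ ≤ 9 / 8 * ‖z₀‖ := by
    have := norm_add_le (x₁ - z₀) z₀; rw [sub_add_cancel] at this; linarith
  have hn₂ : ‖x₂‖ ≤ 9 / 8 * ‖z₀‖ := by
    have := norm_add_le (x₂ - z₀) z₀; rw [sub_add_cancel] at this; linarith
  have hη : ‖conj x₁ * x₂ - ((‖z₀‖ ^ 2 : ℝ) : ℂ)‖ ≤ 17 / 64 * ‖z₀‖ ^ 2 := by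
    have : conj x₁ * x₂ - ((‖z₀‖ ^ 2 : ℝ) : ℂ) = conj (x₁ - z₀) * x₂ + conj z₀ * (x₂ - z₀) := by
      push_cast
      rw [← Complex.conj_mul', map_sub]; ring
    rw [this]
    refine (norm_add_le _ _).trans ?_
    rw [norm_mul (conj _), norm_mul (conj _), Complex.norm_conj, Complex.norm_conj]
    calc _ ≤ 1 / 8 * ‖z₀‖ * (9 / 8 * ‖z₀‖) + ‖z₀‖ * (1 / 8 * ‖z₀‖) := by gcongr
      _ = _ := by ring
  have him : 31 / 64 * ‖z₀‖ ^ 2 ≤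
      (Complex.exp ((ω * (s₂ - s₁) : ℝ) * Complex.I) * (conj x₁ * x₂)).im := by
    have e : Complex.exp ((ω * (s₂ - s₁) : ℝ) * Complex.I) * (conj x₁ * x₂) =
        ((‖z₀‖ ^ 2 : ℝ) : ℂ) * Complex.exp ((ω * (s₂ - s₁) : ℝ) * Complex.I) +
        Complex.exp ((ω * (s₂ - s₁) : ℝ) * Complex.I) *
          (conj x₁ * x₂ - ((‖z₀‖ ^ 2 : ℝ) : ℂ)) := by ring
    rw [e, Complex.add_im, Complex.im_ofReal_mul, Complex.exp_ofReal_mul_I_im]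
    have h3 := (abs_le.1 ((Complex.abs_im_le_norm (Complex.exp ((ω * (s₂ - s₁) : ℝ) * Complex.I) *
      (conj x₁ * x₂ - ((‖z₀‖ ^ 2 : ℝ) : ℂ)))).trans (by
        simpa only [norm_mul, Complex.norm_exp_ofReal_mul_I, one_mul] using hη))).1
    have h4 := mul_le_mul_of_nonneg_left hs (sq_nonneg ‖z₀‖)
    linarith
  have hz₁ : ‖z₁‖ = Real.exp (-(α / 2 * s₁)) * ‖x₁‖ := by
    rw [e₁, norm_mul, norm_exp_phaseRate_mul]
  have hz₂ : ‖z₂‖ = Real.exp (-(α / 2 * s₂)) * ‖x₂‖ := by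
    rw [e₂, norm_mul, norm_exp_phaseRate_mul]
  rw [hx, Complex.im_ofReal_mul, hz₁, hz₂]
  have h5 : ‖x₁‖ * ‖x₂‖ ≤ 81 / 64 * ‖z₀‖ ^ 2 := by
    calc ‖x₁‖ * ‖x₂‖ ≤ 9 / 8 * ‖z₀‖ * (9 / 8 * ‖z₀‖) := by gcongr
      _ = _ := by ring
  calc 1 / 4 * (Real.exp (-(α / 2 * s₁)) * ‖x₁‖ * (Real.exp (-(α / 2 * s₂)) * ‖x₂‖))
      = Real.exp (-(α / 2 * s₁)) * Real.exp (-(α / 2 * s₂)) * (1 / 4 * (‖x₁‖ * ‖x₂‖)) := by ring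
    _ ≤ _ := by
      gcongr
      refine le_trans ?_ him
      linarith [sq_nonneg ‖z₀‖]

lemma emdenDeriv_sub (m θ B t : ℝ) (w w' : ℝ → ℝ) :
    emdenDeriv m θ B w w' t - m * θ * emden m θ B w t =
      m * B * Real.exp (m * θ * t) * Real.exp (m * t) * w' (Real.exp (m * t)) := by
  simp only [emden, emdenDeriv]; ring

lemma emdenDeriv_sub_neg_iff {d p α m θ B : ℝ} (hc : EFConst d p α m θ B) (t : ℝ) (w w' : ℝ → ℝ) :
    emdenDeriv m θ B w w' t - m * θ * emden m θ B w t < 0 ↔ w' (Real.exp (m * t)) < 0 := by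
  have hm := hc.hm
  have hB := hc.hB
  rw [emdenDeriv_sub]
  have h0 : 0 < m * B * Real.exp (m * θ * t) * Real.exp (m * t) := by positivity
  exact ⟨fun h => (pos_iff_neg_of_mul_neg h).1 h0, mul_neg_of_pos_of_neg h0⟩

/-- For large `L`, all regular solutions with initial value `e^{mθL}` decrease up to a fixed
time `t₀`, where the differences to the singular solution are small, nonzero, and take three
directions surrounding the origin along arithmetic progressions of values of `L`. -/
lemma exists_directions {d p α m θ B ω : ℝ} (hc : EFConst d p α m θ B) (hω0 : 0 < ω)
    (hω : α ^ 2 / 4 + ω ^ 2 = p - 1)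
    {u u' : ℝ → ℝ → ℝ} (hu : ∀ L > 0, RadSol d p 1 (u L) (u' L) ∧ u L 0 = Real.exp (m * θ * L))
    {y y' : ℝ → ℝ} (h : EFSol p α m (m ^ 2) y y') (hy : Tendsto y atBot (𝓝 1)) (T : ℝ) :
    ∃ t₀ ≤ T, ∃ Z : ℝ → ℂ,
      (∀ L, Z L = phase α ω (emden m θ B (u L) - y) (emdenDeriv m θ B (u L) (u' L) - y') t₀) ∧
      (∀ᶠ L in atTop, ∀ s ∈ Ioc 0 (Real.exp (m * t₀)), u' L s < 0) ∧
      Tendsto Z atTop (𝓝 0) ∧ (∀ᶠ L in atTop, Z L ≠ 0) ∧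
      ∃ R : ℝ, ∀ L₁ ≥ R, ∀ L₂ ≥ R, 3 / 4 ≤ Real.sin (ω * (L₂ - L₁)) →
        1 / 4 * (‖Z L₁‖ * ‖Z L₂‖) ≤ (starRingEnd ℂ (Z L₁) * Z L₂).im := by
  have hm := hc.hm
  have hθ := hc.hθ
  have hα := hc.hα
  have hy' := h.tendsto_deriv_atBot hα hm hy
  set K : ℝ := 1 + α / (2 * ω) + m * θ / ω with hK
  have hK0 : 0 < K := by positivity
  set ε : ℝ := min (1 / 20) (m * θ / (2 * K)) with hε
  have hε0 : 0 < ε := by positivity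
  have hε1 : ε ≤ 1 / 20 := min_le_left _ _
  have hεK : ε * K < m * θ := by
    have : ε * K ≤ m * θ / (2 * K) * K := by gcongr; exact min_le_right _ _
    have h2 : m * θ / (2 * K) * K = m * θ / 2 := by field_simp
    linarith [mul_pos hm hθ]
  obtain ⟨δ, hδ, t₀, ht₀, htr⟩ := EFSol.exists_transport hc.hp hα hm (sq_nonneg m) hω0 hω hε0 T
  obtain ⟨τ₀, z₀, hz₀, hq, hlim, hdec⟩ := exists_initial_data hc hω0 hu hy hy' (α := α) hδ
  set Z : ℝ → ℂ := fun L =>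
    phase α ω (emden m θ B (u L) - y) (emdenDeriv m θ B (u L) (u' L) - y') t₀ with hZ
  set W : ℝ → ℂ := fun L =>
    phase α ω (emden m θ B (u L) - y) (emdenDeriv m θ B (u L) (u' L) - y') (τ₀ - L) with hW
  have hz₀' : 0 < ‖z₀‖ := norm_pos_iff.2 hz₀
  have hmain : ∀ᶠ L in atTop,
      ‖Complex.exp (-phaseRate α ω * ((t₀ - (τ₀ - L) : ℝ) : ℂ)) * Z L - z₀‖ ≤ 1 / 8 * ‖z₀‖ ∧
      ∀ s ∈ Ioc 0 (Real.exp (m * t₀)), u' L s < 0 := by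
    filter_upwards [hq, hdec, eventually_gt_atTop 0, eventually_ge_atTop (τ₀ - t₀),
      hlim.eventually (Metric.closedBall_mem_nhds z₀ (by positivity : 0 < 1 / 20 * ‖z₀‖))]
      with L hL1 hL2 hL3 hL4 hL5
    rw [dist_eq_norm] at hL5
    have hWn : W L ≠ 0 := by
      intro h0
      rw [h0, zero_sub, norm_neg] at hL5
      linarith
    have hsol := (hu L hL3).1.efSol hc
    rw [mul_one] at hsol
    obtain ⟨h1, h2⟩ := htr _ _ y y' hsol h hy (τ₀ - L) (by linarith) hL1 hWn
    constructor
    · have h3 : ‖W L‖ ≤ 21 / 20 * ‖z₀‖ := by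
        have := norm_add_le (W L - z₀) z₀; rw [sub_add_cancel] at this; linarith
      have h4 := norm_add_le (Complex.exp (-phaseRate α ω * ((t₀ - (τ₀ - L) : ℝ) : ℂ)) * Z L - W L)
        (W L - z₀)
      rw [sub_add_sub_cancel] at h4
      rw [← Complex.ofReal_sub] at h1
      have h5 := h1.trans (mul_le_mul hε1 h3 (norm_nonneg _) (by norm_num))
      linarith
    · intro s hs
      by_cases hsa : s ≤ Real.exp (m * (τ₀ - L))
      · exact hL2 s ⟨hs.1, hsa⟩
      set t := Real.log s / m with ht
      have hst : Real.exp (m * t) = s := by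
        rw [ht, mul_div_cancel₀ _ hm.ne', Real.exp_log hs.1]
      rw [← hst] at hsa hs ⊢
      have hta : t ∈ Icc (τ₀ - L) t₀ := by
        rw [not_le, Real.exp_lt_exp] at hsa
        have h6 := Real.exp_le_exp.1 hs.2
        exact ⟨(lt_of_mul_lt_mul_left hsa hm.le).le, le_of_mul_le_mul_left h6 hm⟩
      have h7 := h2 t hta
      have h8 := abs_le.1 (abs_sub_one_le_of_eqForm hω0 hε0.le h7)
      rw [← emdenDeriv_sub_neg_iff hc]
      rw [eqForm] at h7
      have h9 := (abs_le_of_sq_le_sq' (le_trans (le_add_of_nonneg_right (by positivity)) h7)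
        hε0.le).2
      have h10 := mul_le_mul_of_nonneg_left h8.1 (by positivity : 0 ≤ α / 2)
      have h11 := mul_le_mul_of_nonneg_left h8.1 (by positivity : 0 ≤ m * θ)
      have h12 : ε * K = ε + α / 2 * (ε / ω) + m * θ * (ε / ω) := by rw [hK]; field_simp
      linarith
  refine ⟨t₀, ht₀, Z, fun _ => rfl, hmain.mono fun L hL => hL.2, ?_, ?_, ?_⟩
  · have hexp : Tendsto (fun L : ℝ => Real.exp (-(α / 2 * (t₀ - (τ₀ - L)))) * (9 / 8 * ‖z₀‖)) atTop
        (𝓝 (0 * (9 / 8 * ‖z₀‖))) := by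
      refine Tendsto.mul_const _ (Real.tendsto_exp_atBot.comp ?_)
      refine tendsto_neg_atTop_atBot.comp (Tendsto.const_mul_atTop (by positivity) ?_)
      exact (tendsto_atTop_add_const_left _ (t₀ - τ₀) tendsto_id).congr fun L => by
        simp only [id]; ring
    rw [zero_mul] at hexp
    refine squeeze_zero_norm' ?_ hexp
    filter_upwards [hmain] with L hL
    have h1 := norm_add_le
      (Complex.exp (-phaseRate α ω * ((t₀ - (τ₀ - L) : ℝ) : ℂ)) * Z L - z₀) z₀
    rw [sub_add_cancel] at h1
    have h2 : Z L = Complex.exp (phaseRate α ω * ((t₀ - (τ₀ - L) : ℝ) : ℂ)) *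
        (Complex.exp (-phaseRate α ω * ((t₀ - (τ₀ - L) : ℝ) : ℂ)) * Z L) := by
      rw [← mul_assoc, ← Complex.exp_add]; simp
    rw [h2, norm_mul, norm_exp_phaseRate_mul]
    gcongr
    linarith [hL.1]
  · filter_upwards [hmain] with L hL h0
    have := hL.1
    rw [h0, mul_zero, zero_sub, norm_neg] at this
    linarith
  · obtain ⟨R, hR⟩ := eventually_atTop.1 hmain
    refine ⟨R, fun L₁ h₁ L₂ h₂ hs => cross_ge (hR L₁ h₁).1 (hR L₂ h₂).1 ?_⟩
    rwa [show t₀ - (τ₀ - L₂) - (t₀ - (τ₀ - L₁)) = L₂ - L₁ by ring]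

/-! ### Propagation of the directions over compact time intervals -/

lemma sq_add_sq_le_norm_phase {α ω : ℝ} (hα : 0 ≤ α) (hω : 0 < ω) (v v' : ℝ → ℝ) (t : ℝ) :
    v t ^ 2 + v' t ^ 2 ≤ ((1 / ω) ^ 2 + (1 + α / (2 * ω)) ^ 2) * ‖phase α ω v v' t‖ ^ 2 := by
  have h1 : |v t| ≤ 1 / ω * ‖phase α ω v v' t‖ := by
    have := mul_abs_le_norm_phase α hω v v' t
    rw [one_div, ← div_eq_inv_mul, le_div_iff₀ hω]
    linarith
  have h2 : |v' t| ≤ (1 + α / (2 * ω)) * ‖phase α ω v v' t‖ := by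
    have h3 := Complex.abs_re_le_norm (phase α ω v v' t)
    rw [phase_re] at h3
    have h4 := abs_sub (v' t + α / 2 * v t) (α / 2 * v t)
    rw [add_sub_cancel_right, abs_mul, abs_of_nonneg (by positivity : 0 ≤ α / 2)] at h4
    have h5 := mul_le_mul_of_nonneg_left h1 (by positivity : 0 ≤ α / 2)
    have h6 : α / 2 * (1 / ω * ‖phase α ω v v' t‖) = α / (2 * ω) * ‖phase α ω v v' t‖ := by
      field_simp
    linarith
  have h3 := pow_le_pow_left₀ (abs_nonneg _) h1 2
  have h4 := pow_le_pow_left₀ (abs_nonneg _) h2 2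
  rw [sq_abs, mul_pow] at h3 h4
  linarith

namespace EFSol

variable {p α m κ ω : ℝ}

/-- Continuous dependence on compact intervals, measured by the initial phase. -/
lemma exists_bound_sub (hp : 1 < p) (hα : 0 ≤ α) (hm : 0 ≤ m) (hκ : 0 ≤ κ) (hω : 0 < ω)
    (M t₀ t₁ : ℝ) :
    ∃ C ≥ 0, ∀ y₁ y₁' y₂ y₂' : ℝ → ℝ, EFSol p α m κ y₁ y₁' → EFSol p α m κ y₂ y₂' →
      (∀ t ∈ Icc t₀ t₁, |y₁ t| ≤ M) → (∀ t ∈ Icc t₀ t₁, |y₂ t| ≤ M) → ∀ t ∈ Icc t₀ t₁,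
      |y₁ t - y₂ t| ≤ C * ‖phase α ω (y₁ - y₂) (y₁' - y₂') t₀‖ ∧
      |y₁' t - y₂' t| ≤ C * ‖phase α ω (y₁ - y₂) (y₁' - y₂') t₀‖ := by
  obtain ⟨K, hK, hlip⟩ := exists_rpow_lipschitz hp M
  set K' : ℝ := 2 + K + κ * Real.exp (2 * m * t₁) with hK'
  have hK0 : 0 ≤ K' := by positivity
  set c : ℝ := (1 / ω) ^ 2 + (1 + α / (2 * ω)) ^ 2 with hc
  have hc0 : 0 ≤ c := by positivity
  set C : ℝ := √(c * Real.exp (K' * (t₁ - t₀))) with hC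
  have hC2 : C ^ 2 = c * Real.exp (K' * (t₁ - t₀)) := Real.sq_sqrt (by positivity)
  have hC0 : 0 ≤ C := Real.sqrt_nonneg _
  refine ⟨C, hC0, fun y₁ y₁' y₂ y₂' h₁ h₂ hb₁ hb₂ t ht => ?_⟩
  have hd : ∀ s, HasDerivAt (fun s => (y₁ s - y₂ s) ^ 2 + (y₁' s - y₂' s) ^ 2)
      (2 * (y₁ s - y₂ s) * (y₁' s - y₂' s) + 2 * (y₁' s - y₂' s) *
        (-α * (y₁' s - y₂' s) + (y₁ s - y₂ s) - (y₁ s ^ p - y₂ s ^ p) +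
          κ * Real.exp (2 * m * s) * (y₁ s - y₂ s))) s := fun s => by
    refine ((((h₁.hd s).sub (h₂.hd s)).pow 2).add
      (((h₁.hd' s).sub (h₂.hd' s)).pow 2)).congr_deriv ?_
    simp only [Nat.cast_ofNat, Nat.add_one_sub_one, pow_one, Pi.sub_apply]
    ring
  have hg := gronwall_affine (c := 0) ht.1 hK0 le_rfl
    (fun s _ => (hd s).continuousAt.continuousWithinAt) (fun s _ => hd s) (fun s hs => by
      have hs' : s ∈ Icc t₀ t₁ := ⟨hs.1.le, hs.2.le.trans ht.2⟩
      have hl := hlip _ _ (hb₁ s hs') (hb₂ s hs')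
      set v := y₁ s - y₂ s
      set v' := y₁' s - y₂' s
      set Δ := y₁ s ^ p - y₂ s ^ p
      have hE : Real.exp (2 * m * s) ≤ Real.exp (2 * m * t₁) :=
        Real.exp_le_exp.2 (mul_le_mul_of_nonneg_left hs'.2 (by linarith))
      have hvv : |v| * |v'| ≤ (v ^ 2 + v' ^ 2) / 2 := by
        rw [← sq_abs v, ← sq_abs v']; linarith [two_mul_le_add_sq |v| |v'|]
      have a1 : v * v' ≤ |v| * |v'| := (le_abs_self _).trans_eq (abs_mul _ _)
      have a2 : -(v' * Δ) ≤ K * (|v| * |v'|) := by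
        refine (neg_le_abs _).trans ?_
        rw [abs_mul]
        calc |v'| * |Δ| ≤ |v'| * (K * |v|) := by gcongr
          _ = _ := by ring
      have a3 : κ * Real.exp (2 * m * s) * (v * v') ≤
          κ * Real.exp (2 * m * t₁) * (|v| * |v'|) := by
        calc κ * Real.exp (2 * m * s) * (v * v') ≤ κ * Real.exp (2 * m * s) * (|v| * |v'|) := by
              gcongr
          _ ≤ _ := by gcongr
      have a4 : 0 ≤ α * v' ^ 2 := by positivity
      have a5 := mul_le_mul_of_nonneg_left hvv hK0
      have a6 : K' * (|v| * |v'|) = 2 * (|v| * |v'|) + K * (|v| * |v'|) +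
          κ * Real.exp (2 * m * t₁) * (|v| * |v'|) := by rw [hK']; ring
      linarith)
  rw [zero_mul, add_zero] at hg
  have hQ : (y₁ t - y₂ t) ^ 2 + (y₁' t - y₂' t) ^ 2 ≤
      (C * ‖phase α ω (y₁ - y₂) (y₁' - y₂') t₀‖) ^ 2 := by
    refine hg.trans ?_
    rw [mul_pow, hC2]
    have h1 := sq_add_sq_le_norm_phase hα hω (y₁ - y₂) (y₁' - y₂') t₀
    have h2 : Real.exp (K' * (t - t₀)) ≤ Real.exp (K' * (t₁ - t₀)) :=
      Real.exp_le_exp.2 (mul_le_mul_of_nonneg_left (by linarith [ht.2]) hK0)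
    calc _ ≤ c * ‖phase α ω (y₁ - y₂) (y₁' - y₂') t₀‖ ^ 2 * Real.exp (K' * (t₁ - t₀)) := by
          gcongr; exact h1
      _ = _ := by ring
  have hn : 0 ≤ C * ‖phase α ω (y₁ - y₂) (y₁' - y₂') t₀‖ := by positivity
  exact ⟨abs_le_of_sq_le_sq (by linarith [sq_nonneg (y₁' t - y₂' t)]) hn,
    abs_le_of_sq_le_sq (by linarith [sq_nonneg (y₁ t - y₂ t)]) hn⟩

/-- The orientation of two small differences to a common solution persists. -/
lemma exists_cross_pos (hp : 1 < p) (hα : 0 < α) (hm : 0 ≤ m) (hκ : 0 ≤ κ) (hω : 0 < ω)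
    {M t₀ t₁ : ℝ} {y y' : ℝ → ℝ} (h : EFSol p α m κ y y') (hM : ∀ t ∈ Icc t₀ t₁, |y t| ≤ M) :
    ∃ η > 0, ∀ y₁ y₁' y₂ y₂' : ℝ → ℝ, EFSol p α m κ y₁ y₁' → EFSol p α m κ y₂ y₂' →
      (∀ t ∈ Icc t₀ t₁, |y₁ t| ≤ M) → (∀ t ∈ Icc t₀ t₁, |y₂ t| ≤ M) →
      phase α ω (y₁ - y) (y₁' - y') t₀ ≠ 0 → phase α ω (y₂ - y) (y₂' - y') t₀ ≠ 0 →
      ‖phase α ω (y₁ - y) (y₁' - y') t₀‖ < η → ‖phase α ω (y₂ - y) (y₂' - y') t₀‖ < η →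
      1 / 4 * (‖phase α ω (y₁ - y) (y₁' - y') t₀‖ * ‖phase α ω (y₂ - y) (y₂' - y') t₀‖) ≤
        (starRingEnd ℂ (phase α ω (y₁ - y) (y₁' - y') t₀) *
          phase α ω (y₂ - y) (y₂' - y') t₀).im →
      ∀ t ∈ Icc t₀ t₁,
        0 < (y₁' t - y' t) * (y₂ t - y t) - (y₁ t - y t) * (y₂' t - y' t) := by
  obtain ⟨C, hC, hbd⟩ := exists_bound_sub hp hα.le hm hκ hω M t₀ t₁ (α := α)
  set G := Real.exp (α * (|t₁ - t₀|)) with hG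
  set ε : ℝ := 1 / (16 * ω * (C ^ 2 + 1) * G * (|t₁ - t₀| + 1)) with hε
  have hG0 : 0 < G := Real.exp_pos _
  have hε0 : 0 < ε := by positivity
  obtain ⟨δ, hδ, hlin⟩ := exists_rpow_linear_approx hp M hε0
  refine ⟨δ / (C + 1), by positivity, ?_⟩
  intro y₁ y₁' y₂ y₂' h₁ h₂ hb₁ hb₂ hz₁ hz₂ hs₁ hs₂ hX t ht
  set z₁ := phase α ω (y₁ - y) (y₁' - y') t₀ with hz₁'
  set z₂ := phase α ω (y₂ - y) (y₂' - y') t₀ with hz₂'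
  have hn₁ : 0 < ‖z₁‖ := norm_pos_iff.2 hz₁
  have hn₂ : 0 < ‖z₂‖ := norm_pos_iff.2 hz₂
  have hsmall : ∀ z : ℂ, ‖z‖ < δ / (C + 1) → C * ‖z‖ < δ := fun z hz => by
    rw [lt_div_iff₀ (by positivity)] at hz
    linarith [norm_nonneg z]
  have hd : ∀ s, HasDerivAt (fun s => -(Real.exp (α * (s - t₀)) *
        ((y₁' s - y' s) * (y₂ s - y s) - (y₁ s - y s) * (y₂' s - y' s))))
      (-(Real.exp (α * (s - t₀)) *
        (-(y₁ s ^ p - y s ^ p - p * y s ^ (p - 1) * (y₁ s - y s)) * (y₂ s - y s) +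
        (y₁ s - y s) * (y₂ s ^ p - y s ^ p - p * y s ^ (p - 1) * (y₂ s - y s))))) s := fun s => by
    have e1 := (((hasDerivAt_id s).sub_const t₀).const_mul α).exp
    have e2 := (((h₁.hd' s).sub (h.hd' s)).mul ((h₂.hd s).sub (h.hd s))).sub
      (((h₁.hd s).sub (h.hd s)).mul ((h₂.hd' s).sub (h.hd' s)))
    refine (e1.mul e2).neg.congr_deriv ?_
    simp
    ring
  set A : ℝ := 2 * ε * G * C ^ 2 * (‖z₁‖ * ‖z₂‖) with hA
  have hA0 : 0 ≤ A := by positivity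
  have hg := gronwall_affine (K := 0) (c := A) ht.1 le_rfl hA0
    (fun s _ => (hd s).continuousAt.continuousWithinAt) (fun s _ => hd s) (fun s hs => by
      have hs' : s ∈ Icc t₀ t₁ := ⟨hs.1.le, hs.2.le.trans ht.2⟩
      have b₁ := (hbd _ _ _ _ h₁ h hb₁ hM s hs').1
      have b₂ := (hbd _ _ _ _ h₂ h hb₂ hM s hs').1
      have r₁ := hlin _ _ (hb₁ s hs') (hM s hs') (b₁.trans_lt (hsmall _ hs₁))
      have r₂ := hlin _ _ (hb₂ s hs') (hM s hs') (b₂.trans_lt (hsmall _ hs₂))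
      set g₁ := y₁ s ^ p - y s ^ p - p * y s ^ (p - 1) * (y₁ s - y s)
      set g₂ := y₂ s ^ p - y s ^ p - p * y s ^ (p - 1) * (y₂ s - y s)
      set v₁ := y₁ s - y s
      set v₂ := y₂ s - y s
      have hexp : Real.exp (α * (s - t₀)) ≤ G := Real.exp_le_exp.2 (by
        have : s - t₀ ≤ |t₁ - t₀| := (by linarith [hs'.2] : s - t₀ ≤ t₁ - t₀).trans (le_abs_self _)
        gcongr)
      have k1 : |-(-g₁ * v₂ + v₁ * g₂)| ≤ 2 * ε * (C ^ 2 * (‖z₁‖ * ‖z₂‖)) := by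
        rw [abs_neg]
        refine (abs_add_le _ _).trans ?_
        rw [abs_mul, abs_mul, abs_neg]
        calc |g₁| * |v₂| + |v₁| * |g₂| ≤ ε * |v₁| * |v₂| + |v₁| * (ε * |v₂|) := by gcongr
          _ = 2 * ε * (|v₁| * |v₂|) := by ring
          _ ≤ 2 * ε * (C * ‖z₁‖ * (C * ‖z₂‖)) := by gcongr
          _ = _ := by ring
      rw [zero_mul, zero_add, ← mul_neg]
      calc Real.exp (α * (s - t₀)) * -(-g₁ * v₂ + v₁ * g₂)
          ≤ Real.exp (α * (s - t₀)) * (2 * ε * (C ^ 2 * (‖z₁‖ * ‖z₂‖))) := by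
            gcongr; exact (le_abs_self _).trans k1
        _ ≤ G * (2 * ε * (C ^ 2 * (‖z₁‖ * ‖z₂‖))) := by gcongr
        _ = A := by rw [hA]; ring)
  have hX' : (starRingEnd ℂ z₁ * z₂).im =
      ω * ((y₁' t₀ - y' t₀) * (y₂ t₀ - y t₀) - (y₁ t₀ - y t₀) * (y₂' t₀ - y' t₀)) := by
    rw [Complex.mul_im, Complex.conj_re, Complex.conj_im, hz₁', hz₂', phase_im, phase_im,
      phase_re, phase_re]
    simp only [Pi.sub_apply]
    ring
  rw [hX'] at hX
  simp only [sub_self, mul_zero, Real.exp_zero, one_mul, zero_mul, mul_one] at hg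
  have hAb : ω * (A * (t - t₀)) ≤ 1 / 8 * (‖z₁‖ * ‖z₂‖) := by
    have k2 : t - t₀ ≤ |t₁ - t₀| + 1 := by
      have := le_abs_self (t₁ - t₀); linarith [ht.2]
    calc ω * (A * (t - t₀)) ≤ ω * (2 * ε * G * (C ^ 2 + 1) * (‖z₁‖ * ‖z₂‖) * (|t₁ - t₀| + 1)) := by
          rw [hA]
          have := sub_nonneg.2 ht.1
          gcongr
          linarith
      _ = 1 / 8 * (‖z₁‖ * ‖z₂‖) := by rw [hε]; field_simp; ring
  have hfin : 0 < Real.exp (α * (t - t₀)) *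
      ((y₁' t - y' t) * (y₂ t - y t) - (y₁ t - y t) * (y₂' t - y' t)) := by
    have k3 : 0 < ω * (Real.exp (α * (t - t₀)) *
      ((y₁' t - y' t) * (y₂ t - y t) - (y₁ t - y t) * (y₂' t - y' t))) := by
      have k4 := mul_le_mul_of_nonneg_left hg hω.le
      have k5 := mul_pos hn₁ hn₂
      linarith
    exact (mul_pos_iff_of_pos_left hω).1 k3
  exact (mul_pos_iff_of_pos_left (Real.exp_pos _)).1 hfin

end EFSol

lemma three_quarters_le_sin_two_pi_div_three : 3 / 4 ≤ Real.sin (2 * π / 3) := by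
  have : 2 * π / 3 = π - π / 3 := by ring
  rw [this, Real.sin_pi_sub, Real.sin_pi_div_three]
  have : (3 / 2 : ℝ) ≤ √3 := Real.le_sqrt_of_sq_le (by norm_num)
  linarith

/-- Vectors `(v₁, b₁), (v₂, b₂), (v₃, b₃)` surrounding the origin have second components of
both signs. -/
lemma exists_signs_of_cross_pos {v b : Fin 3 → ℝ} (h₁ : 0 < b 0 * v 1 - v 0 * b 1)
    (h₂ : 0 < b 1 * v 2 - v 1 * b 2) (h₃ : 0 < b 2 * v 0 - v 2 * b 0) :
    (∃ i, 0 < b i) ∧ ∃ i, b i < 0 := by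
  have key : b 2 * (b 0 * v 1 - v 0 * b 1) + b 0 * (b 1 * v 2 - v 1 * b 2) +
      b 1 * (b 2 * v 0 - v 2 * b 0) = 0 := by ring
  constructor <;> by_contra! hb
  · have k1 := mul_nonneg (neg_nonneg.2 (hb 2)) h₁.le
    have k2 := mul_nonneg (neg_nonneg.2 (hb 0)) h₂.le
    have k3 := mul_nonneg (neg_nonneg.2 (hb 1)) h₃.le
    have e0 : b 0 = 0 := (mul_eq_zero.1 (by linarith : b 0 * (b 1 * v 2 - v 1 * b 2) = 0)).resolve_right h₂.ne'
    have e1 : b 1 = 0 := (mul_eq_zero.1 (by linarith : b 1 * (b 2 * v 0 - v 2 * b 0) = 0)).resolve_right h₃.ne'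
    simp [e0, e1] at h₁
  · have k1 := mul_nonneg (hb 2) h₁.le
    have k2 := mul_nonneg (hb 0) h₂.le
    have k3 := mul_nonneg (hb 1) h₃.le
    have e0 : b 0 = 0 := (mul_eq_zero.1 (by linarith : b 0 * (b 1 * v 2 - v 1 * b 2) = 0)).resolve_right h₂.ne'
    have e1 : b 1 = 0 := (mul_eq_zero.1 (by linarith : b 1 * (b 2 * v 0 - v 2 * b 0) = 0)).resolve_right h₃.ne'
    simp [e0, e1] at h₁

/-- The regular solutions converge to the singular one in `C¹` on `[t₀, t₁]`, and the
differences have slopes of both signs relative to any prescribed direction. -/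
lemma exists_convergence {d p α m θ B ω : ℝ} (hc : EFConst d p α m θ B) (hω0 : 0 < ω)
    (hω : α ^ 2 / 4 + ω ^ 2 = p - 1)
    {u u' : ℝ → ℝ → ℝ} (hu : ∀ L > 0, RadSol d p 1 (u L) (u' L) ∧ u L 0 = Real.exp (m * θ * L))
    {y y' : ℝ → ℝ} (h : EFSol p α m (m ^ 2) y y') (hy : Tendsto y atBot (𝓝 1)) (T t₁ : ℝ) :
    ∃ t₀ ≤ T,
      (∀ᶠ L in atTop, ∀ s ∈ Ioc 0 (Real.exp (m * t₀)), u' L s < 0) ∧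
      (∀ η > 0, ∀ᶠ L in atTop, ∀ t ∈ Icc t₀ t₁, |emden m θ B (u L) t - y t| < η ∧
        |emdenDeriv m θ B (u L) (u' L) t - y' t| < η) ∧
      ∀ t ∈ Icc t₀ t₁, ∀ c : ℝ,
        (∃ᶠ L in atTop, 0 < emdenDeriv m θ B (u L) (u' L) t - y' t -
          c * (emden m θ B (u L) t - y t)) ∧
        ∃ᶠ L in atTop, emdenDeriv m θ B (u L) (u' L) t - y' t -
          c * (emden m θ B (u L) t - y t) < 0 := by
  have hm := hc.hm
  have hp := hc.hp
  obtain ⟨t₀, ht₀, Z, hZ, hdec, hZ0, hZne, R, hR⟩ := exists_directions hc hω0 hω hu h hy T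
  obtain ⟨M₁, hM₁⟩ := (isCompact_Icc (a := t₀) (b := t₁)).exists_bound_of_continuousOn
    h.continuous_fst.continuousOn
  set M := max M₁ (((p + 1) / 2 * (1 + m ^ 2 * Real.exp (2 * m * t₁))) ^ (1 / (p - 1))) with hM
  have hbM : ∀ t ∈ Icc t₀ t₁, |y t| ≤ M := fun t ht => (hM₁ t ht).trans (le_max_left _ _)
  have hsol : ∀ L > 0, EFSol p α m (m ^ 2) (emden m θ B (u L)) (emdenDeriv m θ B (u L) (u' L)) :=
    fun L hL => by
    have := (hu L hL).1.efSol hc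
    rwa [mul_one] at this
  have hbL : ∀ L > 0, ∀ t ∈ Icc t₀ t₁, |emden m θ B (u L) t| ≤ M := fun L hL t ht => by
    have hu0 : 0 < u L 0 := by rw [(hu L hL).2]; exact Real.exp_pos _
    have hpos := (hu L hL).1.emden_pos hc zero_le_one hu0 t
    have hneg := (hu L hL).1.emden_energy_neg hc zero_le_one hu0 t
    rw [mul_one] at hneg
    rw [abs_of_pos hpos]
    refine le_trans (EFSol.le_of_rpow_le hp hpos ?_) (le_max_right _ _)
    refine (EFSol.bounds_of_energy_neg hp hpos hneg).1.trans ?_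
    have : Real.exp (2 * m * t) ≤ Real.exp (2 * m * t₁) :=
      Real.exp_le_exp.2 (mul_le_mul_of_nonneg_left ht.2 (by linarith))
    gcongr
  obtain ⟨C, hC, hbd⟩ := EFSol.exists_bound_sub hp hc.hα.le hm.le (sq_nonneg m) hω0 M t₀ t₁ (α := α)
  obtain ⟨η, hη, hcross⟩ := EFSol.exists_cross_pos hp hc.hα hm.le (sq_nonneg m) hω0 h hbM
  refine ⟨t₀, ht₀, hdec, fun η hη => ?_, fun t ht c => ?_⟩
  · have hlim := hZ0.norm.const_mul C
    rw [norm_zero, mul_zero] at hlim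
    filter_upwards [hlim.eventually (gt_mem_nhds hη), eventually_gt_atTop 0] with L h1 h2 t ht
    have := hbd _ _ _ _ (hsol L h2) h (hbL L h2) hbM t ht
    rw [← hZ L] at this
    exact ⟨this.1.trans_lt h1, this.2.trans_lt h1⟩
  · have hev : ∀ᶠ L in atTop, (0 < L ∧ R ≤ L) ∧ Z L ≠ 0 ∧ ‖Z L‖ < η := by
      have hlim := hZ0.norm
      rw [norm_zero] at hlim
      exact ((eventually_gt_atTop 0).and (eventually_ge_atTop R)).and
        (hZne.and (hlim.eventually (gt_mem_nhds hη)))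
    obtain ⟨S, hS⟩ := eventually_atTop.1 hev
    have hpair : ∀ L₁ ≥ S, ∀ L₂ ≥ S, 3 / 4 ≤ Real.sin (ω * (L₂ - L₁)) →
        0 < (emdenDeriv m θ B (u L₁) (u' L₁) t - y' t) * (emden m θ B (u L₂) t - y t) -
          (emden m θ B (u L₁) t - y t) * (emdenDeriv m θ B (u L₂) (u' L₂) t - y' t) := by
      intro L₁ h₁ L₂ h₂ hs
      obtain ⟨⟨a1, a2⟩, a3, a4⟩ := hS L₁ h₁
      obtain ⟨⟨b1, b2⟩, b3, b4⟩ := hS L₂ h₂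
      have hX := hR L₁ a2 L₂ b2 hs
      rw [hZ] at a3 a4 b3 b4
      rw [hZ, hZ] at hX
      exact hcross _ _ _ _ (hsol L₁ a1) (hsol L₂ b1) (hbL L₁ a1) (hbL L₂ b1) a3 b3 a4 b4 hX t ht
    set P := 2 * π / 3 / ω with hP
    have hP0 : 0 < P := by positivity
    have hωP : ω * P = 2 * π / 3 := by rw [hP]; field_simp
    have hsigns : ∀ L₀ ≥ S, (∃ L ≥ L₀, 0 < emdenDeriv m θ B (u L) (u' L) t - y' t -
          c * (emden m θ B (u L) t - y t)) ∧
        ∃ L ≥ L₀, emdenDeriv m θ B (u L) (u' L) t - y' t -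
          c * (emden m θ B (u L) t - y t) < 0 := by
      intro L₀ hL₀
      set ℓ : Fin 3 → ℝ := ![L₀, L₀ + P, L₀ + 2 * P] with hℓ
      have hℓ0 : ∀ i, L₀ ≤ ℓ i := fun i => by
        fin_cases i <;> simp [hℓ] <;> linarith
      have k1 := hpair (ℓ 0) (hL₀.trans (hℓ0 0)) (ℓ 1) (hL₀.trans (hℓ0 1)) (by
        rw [show ω * (ℓ 1 - ℓ 0) = 2 * π / 3 by simp [hℓ, hωP]]
        exact three_quarters_le_sin_two_pi_div_three)
      have k2 := hpair (ℓ 1) (hL₀.trans (hℓ0 1)) (ℓ 2) (hL₀.trans (hℓ0 2)) (by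
        rw [show ℓ 2 - ℓ 1 = P by simp [hℓ]; ring, hωP]
        exact three_quarters_le_sin_two_pi_div_three)
      have k3 := hpair (ℓ 2) (hL₀.trans (hℓ0 2)) (ℓ 0) (hL₀.trans (hℓ0 0)) (by
        rw [show ℓ 0 - ℓ 2 = -(2 * P) by simp [hℓ],
          show ω * -(2 * P) = 2 * π / 3 - 2 * π by linear_combination (-2) * hωP,
          Real.sin_sub_two_pi]
        exact three_quarters_le_sin_two_pi_div_three)
      obtain ⟨⟨i, hi⟩, ⟨j, hj⟩⟩ := exists_signs_of_cross_pos
        (v := fun i => emden m θ B (u (ℓ i)) t - y t)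
        (b := fun i => emdenDeriv m θ B (u (ℓ i)) (u' (ℓ i)) t - y' t -
          c * (emden m θ B (u (ℓ i)) t - y t))
        (by linarith) (by linarith) (by linarith)
      exact ⟨⟨ℓ i, hℓ0 i, hi⟩, ⟨ℓ j, hℓ0 j, hj⟩⟩
    constructor <;> refine frequently_atTop.2 fun L => ?_
    · obtain ⟨L', h1, h2⟩ := (hsigns (max S L) (le_max_left _ _)).1
      exact ⟨L', (le_max_right _ _).trans h1, h2⟩
    · obtain ⟨L', h1, h2⟩ := (hsigns (max S L) (le_max_left _ _)).2
      exact ⟨L', (le_max_right _ _).trans h1, h2⟩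

/-! ### Stability and counting of nondegenerate zeros -/

lemma exists_unique_zero_of_deriv_mul_pos {f f' : ℝ → ℝ} {T δ σ : ℝ} (hδ : 0 < δ)
    (hf : ∀ t, HasDerivAt f (f' t) t) (hpos : ∀ t ∈ Icc (T - δ) (T + δ), 0 < f' t * σ)
    (hl : f (T - δ) * σ < 0) (hr : 0 < f (T + δ) * σ) :
    ∃ z ∈ Ioo (T - δ) (T + δ), f z = 0 ∧ (∀ t ∈ Icc (T - δ) (T + δ), f t = 0 → t = z) ∧
      (0 < f T * σ → z < T) ∧ (f T * σ < 0 → T < z) := by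
  have hmono : StrictMonoOn (fun t => f t * σ) (Icc (T - δ) (T + δ)) :=
    strictMonoOn_of_hasDerivWithinAt_pos (convex_Icc _ _)
      (fun t _ => ((hf t).mul_const σ).continuousAt.continuousWithinAt)
      (fun t _ => ((hf t).mul_const σ).hasDerivWithinAt)
      (fun t ht => hpos t (interior_subset ht))
  have hσ : σ ≠ 0 := fun h => by simp [h] at hr
  have hT : T ∈ Icc (T - δ) (T + δ) := ⟨by linarith, by linarith⟩
  obtain ⟨z, hz, hz0⟩ := intermediate_value_Ioo (show T - δ ≤ T + δ by linarith)
    (fun t _ => ((hf t).mul_const σ).continuousAt.continuousWithinAt) ⟨hl, hr⟩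
  have hz' := Ioo_subset_Icc_self hz
  refine ⟨z, hz, (mul_eq_zero.1 hz0).resolve_right hσ, fun t ht h0 => ?_, fun h => ?_, fun h => ?_⟩
  · exact hmono.injOn ht hz' (by simp only [h0, zero_mul, hz0])
  · exact (hmono.lt_iff_lt hz' hT).1 (hz0.trans_lt h)
  · exact (hmono.lt_iff_lt hT hz').1 (h.trans_eq hz0.symm)

/-- Functions that are `C¹`-close to `g` have the same zeros as `g`, up to small displacements. -/
lemma exists_zero_count {g g' : ℝ → ℝ} {T : ℕ → ℝ} {n : ℕ} {a b : ℝ} (hT : StrictMono T)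
    (ha : a < T 0) (hb : T n < b) (hg : ∀ t, HasDerivAt g (g' t) t) (hg' : Continuous g')
    (hT0 : ∀ k, g (T k) = 0) (hz : ∀ t ∈ Icc a b, g t = 0 → ∃ k ≤ n, T k = t)
    (hnd : ∀ k, g' (T k) ≠ 0) :
    ∃ η > 0, ∀ f f' : ℝ → ℝ, (∀ t, HasDerivAt f (f' t) t) →
      (∀ t ∈ Icc a b, |f t - g t| < η ∧ |f' t - g' t| < η) → (∀ t ≤ a, f t ≠ 0) →
      ∃ z, f z = 0 ∧ {t | t < z ∧ f t = 0}.encard = n ∧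
        (0 < f (T n) * g' (T n) → z < T n) ∧ (f (T n) * g' (T n) < 0 → T n < z) := by
  have hδ : ∀ᶠ δ : ℝ in 𝓝[>] 0, 0 < δ ∧ ∀ k ∈ Iic n,
      (∀ t ∈ Icc (T k - δ) (T k + δ), 0 < g' t * g' (T k)) ∧ T k + δ < T (k + 1) - δ ∧
        a < T k - δ ∧ T k + δ < b := by
    refine (eventually_mem_nhdsWithin).and ((eventually_all_finite (finite_Iic n)).2 fun k hk => ?_)
    have h1 : ∀ᶠ t in 𝓝 (T k), 0 < g' t * g' (T k) :=
      (hg'.mul continuous_const).continuousAt.eventually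
        (lt_mem_nhds (mul_self_pos.2 (hnd k)))
    obtain ⟨ε, hε, hball⟩ := Metric.eventually_nhds_iff.1 h1
    have hk1 : T k < T (k + 1) := hT (Nat.lt_succ_self k)
    have hk2 : a < T k := ha.trans_le (hT.monotone (Nat.zero_le k))
    have hk3 : T k < b := (hT.monotone hk).trans_lt hb
    have hsm : ∀ c > 0, ∀ᶠ δ : ℝ in 𝓝[>] 0, δ < c := fun c hc =>
      mem_nhdsWithin_of_mem_nhds (gt_mem_nhds hc)
    filter_upwards [hsm ε hε, hsm ((T (k + 1) - T k) / 2) (by linarith),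
      hsm (T k - a) (by linarith), hsm (b - T k) (by linarith)] with δ d1 d2 d3 d4
    refine ⟨fun t ht => hball ?_, by linarith, by linarith, by linarith⟩
    rw [Real.dist_eq, abs_lt]
    constructor <;> linarith [ht.1, ht.2]
  obtain ⟨δ, hδ0, hδ⟩ := hδ.exists
  set W : Set ℝ := ⋃ k ∈ Iic n, Icc (T k - δ) (T k + δ) with hW
  have hWc : IsCompact W := (finite_Iic n).isCompact_biUnion fun k _ => isCompact_Icc
  have hKc : IsCompact (Icc a b \ ⋃ k ∈ Iic n, Ioo (T k - δ) (T k + δ)) :=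
    isCompact_Icc.diff (isOpen_biUnion fun k _ => isOpen_Ioo)
  obtain ⟨c₁, hc₁, hW'⟩ := hWc.exists_forall_le' (f := fun t => |g' t|) hg'.abs.continuousOn
    (a := 0) (fun t ht => by
      obtain ⟨k, hk, htk⟩ := mem_iUnion₂.1 ht
      exact abs_pos.2 (left_ne_zero_of_mul ((hδ k hk).1 t htk).ne'))
  have hgc : Continuous g := continuous_iff_continuousAt.2 fun t => (hg t).continuousAt
  obtain ⟨c₂, hc₂, hK'⟩ := hKc.exists_forall_le' (f := fun t => |g t|) hgc.abs.continuousOn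
    (a := 0) (fun t ht => by
      refine abs_pos.2 fun h0 => ht.2 ?_
      obtain ⟨k, hk, rfl⟩ := hz t ht.1 h0
      exact mem_iUnion₂.2 ⟨k, hk, by linarith, by linarith⟩)
  have hsign : ∀ {x y c : ℝ}, |x - y| < c → c ≤ |y| → 0 < x * y := fun {x y c} h1 h2 => by
    have h3 := sq_lt_sq.2 (h1.trans_le h2)
    nlinarith [sq_nonneg x]
  refine ⟨min c₁ c₂, lt_min hc₁ hc₂, fun f f' hf hclose hf0 => ?_⟩
  have hfK : ∀ t ∈ Icc a b, (∀ k ≤ n, t ∉ Ioo (T k - δ) (T k + δ)) → 0 < f t * g t :=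
    fun t ht hk => hsign ((hclose t ht).1.trans_le (min_le_right _ _)) (hK' t ⟨ht, fun h => by
      obtain ⟨k, hkn, hkt⟩ := mem_iUnion₂.1 h
      exact hk k hkn hkt⟩)
  have hfW : ∀ k ≤ n, ∀ t ∈ Icc (T k - δ) (T k + δ), 0 < f' t * g' (T k) := fun k hk t ht => by
    obtain ⟨h1, -, h3, h4⟩ := hδ k hk
    have h5 := hsign ((hclose t ⟨by linarith [ht.1], by linarith [ht.2]⟩).2.trans_le
      (min_le_left _ _)) (hW' t (mem_iUnion₂.2 ⟨k, hk, ht⟩))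
    have h6 := mul_pos h5 (h1 t ht)
    have h7 := left_ne_zero_of_mul (h1 t ht).ne'
    have h8 : 0 < g' t ^ 2 := by positivity
    refine pos_of_mul_pos_left (b := g' t ^ 2) ?_ h8.le
    linarith
  have hsep : ∀ j k, j < k → j ≤ n → T j + δ < T k - δ := fun j k hjk hj =>
    (hδ j hj).2.1.trans_le (sub_le_sub_right (hT.monotone hjk) δ)
  have hwin : ∀ k ≤ n, ∃ z ∈ Ioo (T k - δ) (T k + δ), f z = 0 ∧
      (∀ t ∈ Icc (T k - δ) (T k + δ), f t = 0 → t = z) ∧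
      (0 < f (T k) * g' (T k) → z < T k) ∧ (f (T k) * g' (T k) < 0 → T k < z) := by
    intro k hk
    obtain ⟨h1, h2, h3, h4⟩ := hδ k hk
    have hmono : StrictMonoOn (fun t => g t * g' (T k)) (Icc (T k - δ) (T k + δ)) :=
      strictMonoOn_of_hasDerivWithinAt_pos (convex_Icc _ _)
        (fun t _ => ((hg t).mul_const _).continuousAt.continuousWithinAt)
        (fun t _ => ((hg t).mul_const _).hasDerivWithinAt)
        (fun t ht => h1 t (interior_subset ht))
    have hmid : T k ∈ Icc (T k - δ) (T k + δ) := ⟨by linarith, by linarith⟩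
    have hend : ∀ t ∈ Icc (T k - δ) (T k + δ), t ∉ Ioo (T k - δ) (T k + δ) → 0 < f t * g t := by
      intro t ht hnt
      refine hfK t ⟨by linarith [ht.1], by linarith [ht.2]⟩ fun j hj hjt => ?_
      rcases lt_trichotomy j k with h | rfl | h
      · linarith [hsep j k h hj, ht.1, hjt.2]
      · exact hnt hjt
      · linarith [hsep k j h hk, ht.2, hjt.1]
    have hL : T k - δ ∈ Icc (T k - δ) (T k + δ) := left_mem_Icc.2 (by linarith)
    have hR : T k + δ ∈ Icc (T k - δ) (T k + δ) := right_mem_Icc.2 (by linarith)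
    have gL := hmono hL hmid (by linarith)
    have gR := hmono hmid hR (by linarith)
    simp only [hT0, zero_mul] at gL gR
    have fL := hend _ hL (fun h => lt_irrefl _ h.1)
    have fR := hend _ hR (fun h => lt_irrefl _ h.2)
    refine exists_unique_zero_of_deriv_mul_pos hδ0 hf (hfW k hk) ?_ ?_
    · have := mul_neg_of_pos_of_neg fL gL
      have h8 := sq_nonneg (g (T k - δ))
      by_contra! hcon
      nlinarith [mul_nonneg h8 hcon]
    · have := mul_pos fR gR
      have h8 := sq_nonneg (g (T k + δ))
      by_contra! hcon
      nlinarith [mul_nonneg h8 (neg_nonneg.2 hcon)]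
  choose! z hzI hz0 hzu hzl hzr using hwin
  have hzlt : ∀ j k, j < k → k ≤ n → z j < z k := fun j k hjk hk => by
    have := hsep j k hjk (hjk.le.trans hk)
    linarith [(hzI j (hjk.le.trans hk)).2, (hzI k hk).1]
  have hset : {t | t < z n ∧ f t = 0} = z '' Iio n := by
    ext t
    constructor
    · rintro ⟨htn, ht0⟩
      have hta : a < t := not_le.1 fun h => hf0 t h ht0
      have htb : t ≤ b := by linarith [(hzI n le_rfl).2, (hδ n (mem_Iic.2 le_rfl)).2.2.2]
      have hex : ∃ k ≤ n, t ∈ Ioo (T k - δ) (T k + δ) := by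
        by_contra! hcon
        have := hfK t ⟨hta.le, htb⟩ hcon
        simp [ht0] at this
      obtain ⟨k, hk, hkt⟩ := hex
      have htz := hzu k hk t (Ioo_subset_Icc_self hkt) ht0
      refine ⟨k, lt_of_le_of_ne hk fun h => ?_, htz.symm⟩
      rw [htz, h] at htn
      exact lt_irrefl _ htn
    · rintro ⟨k, hk, rfl⟩
      exact ⟨hzlt k n hk le_rfl, hz0 k (le_of_lt hk)⟩
  have hinj : InjOn z (Iio n) := fun j hj k hk h => by
    by_contra hne
    rcases lt_or_gt_of_ne hne with h' | h'
    · exact (hzlt j k h' (le_of_lt hk)).ne h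
    · exact (hzlt k j h' (le_of_lt hj)).ne' h
  refine ⟨z n, hz0 n le_rfl, ?_, hzl n le_rfl, hzr n le_rfl⟩
  rw [hset, hinj.encard_image, ← Finset.coe_Iio, encard_coe_eq_coe_finsetCard, Nat.card_Iio]

/-! ### Critical points in Emden–Fowler coordinates -/

namespace EFSol

variable {p α m κ : ℝ} {y y' : ℝ → ℝ}

lemma hasDerivAt_sub_mul (h : EFSol p α m κ y y') (c t : ℝ) :
    HasDerivAt (fun t => y' t - c * y t)
      (-α * y' t + y t - y t ^ p + κ * Real.exp (2 * m * t) * y t - c * y' t) t :=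
  (h.hd' t).sub ((h.hd t).const_mul c)

lemma exists_close (hp : 1 < p) (hm : 0 ≤ m) (hκ : 0 ≤ κ) (h : EFSol p α m κ y y') (c t₀ t₁ : ℝ)
    {η : ℝ} (hη : 0 < η) :
    ∃ ε > 0, ∀ t ∈ Icc t₀ t₁, ∀ a a' : ℝ, |a - y t| < ε → |a' - y' t| < ε →
      |a' - c * a - (y' t - c * y t)| < η ∧
      |(-α * a' + a - a ^ p + κ * Real.exp (2 * m * t) * a - c * a') -
        (-α * y' t + y t - y t ^ p + κ * Real.exp (2 * m * t) * y t - c * y' t)| < η := by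
  obtain ⟨M, hM⟩ := (isCompact_Icc (a := t₀) (b := t₁)).exists_bound_of_continuousOn
    h.continuous_fst.continuousOn
  obtain ⟨K, hK, hlip⟩ := exists_rpow_lipschitz hp (M + 1)
  set C : ℝ := |α| + |c| + 1 + K + κ * Real.exp (2 * m * t₁) with hC
  have hC0 : 0 < C := by positivity
  refine ⟨min 1 (η / (C + 1)), by positivity, fun t ht a a' ha ha' => ?_⟩
  set ε := min 1 (η / (C + 1)) with hε
  have hε0 : 0 < ε := by positivity
  have hεη : C * ε < η := by
    have h1 : (C + 1) * ε ≤ η := by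
      rw [← le_div_iff₀' (by linarith)]; exact min_le_right _ _
    linarith
  have hy := hM t ht
  rw [Real.norm_eq_abs] at hy
  have haM : |a| ≤ M + 1 := by
    have := abs_sub_abs_le_abs_sub a (y t)
    linarith [min_le_left 1 (η / (C + 1))]
  have hr := hlip a (y t) haM (by linarith)
  have hE : κ * Real.exp (2 * m * t) ≤ κ * Real.exp (2 * m * t₁) :=
    mul_le_mul_of_nonneg_left
      (Real.exp_le_exp.2 (mul_le_mul_of_nonneg_left ht.2 (by linarith))) hκ
  have b1 : |c * (a - y t)| ≤ |c| * ε := by rw [abs_mul]; gcongr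
  have b2 : |c * (a' - y' t)| ≤ |c| * ε := by rw [abs_mul]; gcongr
  have b3 : |α * (a' - y' t)| ≤ |α| * ε := by rw [abs_mul]; gcongr
  have b4 : |κ * Real.exp (2 * m * t) * (a - y t)| ≤ κ * Real.exp (2 * m * t₁) * ε := by
    rw [abs_mul, abs_of_nonneg (by positivity)]; gcongr
  have b5 : |a ^ p - y t ^ p| ≤ K * ε := hr.trans (by gcongr)
  have hCe : C * ε = |α| * ε + |c| * ε + ε + K * ε + κ * Real.exp (2 * m * t₁) * ε := by
    rw [hC]; ring
  have e1 : 0 ≤ |α| * ε := by positivity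
  have e2 : 0 ≤ K * ε := by positivity
  have e3 : 0 ≤ κ * Real.exp (2 * m * t₁) * ε := by positivity
  rw [abs_le] at b1 b2 b3 b4 b5
  rw [abs_lt] at ha ha'
  constructor <;> rw [abs_lt] <;> constructor <;> linarith

/-- A degenerate critical point of the radial function `e^{-mθt} y` forces this function to be
constant. -/
lemma deriv_eq_of_degenerate {d θ B : ℝ} (hc : EFConst d p α m θ B)
    (h : EFSol p α m (m ^ 2) y y') {T : ℝ} (h1 : y' T - m * θ * y T = 0)
    (h2 : -α * y' T + y T - y T ^ p + m ^ 2 * Real.exp (2 * m * T) * y T - m * θ * y' T = 0)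
    {t : ℝ} (ht : T ≤ t) : y' t - m * θ * y t = 0 := by
  set c := y T * Real.exp (-(m * θ * T)) with hcdef
  have hcT : c * Real.exp (m * θ * T) = y T := by
    rw [hcdef, mul_assoc, ← Real.exp_add, neg_add_cancel, Real.exp_zero, mul_one]
  have hlin : α * (m * θ) + (m * θ) ^ 2 = 1 := by
    rw [hc.hαm]; linear_combination hc.hmθ
  have hpow : ∀ s, (c * Real.exp (m * θ * s)) ^ p =
      m ^ 2 * Real.exp (2 * m * s) * (c * Real.exp (m * θ * s)) := by
    intro s
    have key : y T ^ p = m ^ 2 * Real.exp (2 * m * T) * y T := by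
      linear_combination -h2 - (α + m * θ) * h1 - y T * hlin
    have e1 : c * Real.exp (m * θ * s) = Real.exp (m * θ * (s - T)) * y T := by
      rw [← hcT, mul_left_comm, ← Real.exp_add]
      ring_nf
    have e2 : Real.exp (m * θ * (s - T)) ^ p * Real.exp (2 * m * T) =
        Real.exp (2 * m * s) * Real.exp (m * θ * (s - T)) := by
      rw [← Real.exp_mul, ← Real.exp_add, ← Real.exp_add]
      congr 1
      linear_combination m * (s - T) * hc.hθp
    rw [e1, mul_rpow_of_pos_left (Real.exp_pos _), key]
    linear_combination m ^ 2 * y T * e2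
  have hsol : EFSol p α m (m ^ 2) (fun s => c * Real.exp (m * θ * s))
      (fun s => c * (m * θ * Real.exp (m * θ * s))) := by
    refine ⟨fun s => (hasDerivAt_exp_mul (m * θ) s).const_mul c, fun s => ?_⟩
    refine (((hasDerivAt_exp_mul (m * θ) s).const_mul (m * θ)).const_mul c).congr_deriv ?_
    rw [hpow s]
    linear_combination c * Real.exp (m * θ * s) * hlin
  obtain ⟨M₁, hM₁⟩ := (isCompact_Icc (a := T) (b := t)).exists_bound_of_continuousOn
    h.continuous_fst.continuousOn
  obtain ⟨M₂, hM₂⟩ := (isCompact_Icc (a := T) (b := t)).exists_bound_of_continuousOn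
    hsol.continuous_fst.continuousOn
  obtain ⟨C, -, hC⟩ := exists_bound_sub hc.hp hc.hα.le hc.hm.le (sq_nonneg m) one_pos
    (max M₁ M₂) T t
  have h0 := hC _ _ _ _ h hsol (fun s hs => (hM₁ s hs).trans (le_max_left _ _))
    (fun s hs => (hM₂ s hs).trans (le_max_right _ _)) t (right_mem_Icc.2 ht)
  have hph : phase α 1 (y - fun s => c * Real.exp (m * θ * s))
      (y' - fun s => c * (m * θ * Real.exp (m * θ * s))) T = 0 := by
    have e1 : y' T - c * (m * θ * Real.exp (m * θ * T)) = 0 := by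
      linear_combination h1 - m * θ * hcT
    simp [phase, Pi.sub_apply, hcT, e1]
  rw [hph, norm_zero, mul_zero] at h0
  have h3 := abs_nonpos_iff.1 h0.1
  have h4 := abs_nonpos_iff.1 h0.2
  linear_combination h4 - m * θ * h3

end EFSol

/-- The critical points of the regular solutions oscillate around those of the singular one. -/
lemma exists_critical_crossing {d p α m θ B ω : ℝ} (hc : EFConst d p α m θ B) (hω0 : 0 < ω)
    (hω : α ^ 2 / 4 + ω ^ 2 = p - 1)
    {u u' : ℝ → ℝ → ℝ} (hu : ∀ L > 0, RadSol d p 1 (u L) (u' L) ∧ u L 0 = Real.exp (m * θ * L))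
    {y y' : ℝ → ℝ} (h : EFSol p α m (m ^ 2) y y') (hy : Tendsto y atBot (𝓝 1))
    {S : ℕ → ℝ} (hS : StrictMono S) (hS0 : ∀ t, y' t - m * θ * y t = 0 ↔ ∃ k, S k = t) (n : ℕ) :
    (∃ᶠ L in atTop, ∃ z, S n < z ∧ u' L (Real.exp (m * z)) = 0 ∧
      {t | t < z ∧ u' L (Real.exp (m * t)) = 0}.encard = n) ∧
    ∃ᶠ L in atTop, ∃ z < S n, u' L (Real.exp (m * z)) = 0 ∧
      {t | t < z ∧ u' L (Real.exp (m * t)) = 0}.encard = n := by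
  have hm := hc.hm
  have hn1 : S n < S (n + 1) := hS (Nat.lt_succ_self n)
  obtain ⟨t₀, ht₀, hdec, hconv, hfreq⟩ := exists_convergence hc hω0 hω hu h hy (S 0 - 1)
    ((S n + S (n + 1)) / 2)
  have hg := h.hasDerivAt_sub_mul (m * θ)
  have hzero : ∀ k, y' (S k) - m * θ * y (S k) = 0 := fun k => (hS0 _).2 ⟨k, rfl⟩
  have hnd : ∀ k, -α * y' (S k) + y (S k) - y (S k) ^ p +
      m ^ 2 * Real.exp (2 * m * S k) * y (S k) - m * θ * y' (S k) ≠ 0 := fun k h0 => by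
    have hk : S k < S (k + 1) := hS (Nat.lt_succ_self k)
    obtain ⟨j, hj⟩ := (hS0 _).1 (h.deriv_eq_of_degenerate hc (hzero k) h0
      (show S k ≤ (S k + S (k + 1)) / 2 by linarith))
    have h1 : k < j := hS.lt_iff_lt.1 (by linarith)
    have h2 : j < k + 1 := hS.lt_iff_lt.1 (by linarith)
    omega
  have hpc : Continuous fun t => y t ^ p :=
    h.continuous_fst.rpow_const fun _ => Or.inr (by linarith [hc.hp])
  obtain ⟨η, hη, hcount⟩ := exists_zero_count (n := n) (a := t₀) (b := (S n + S (n + 1)) / 2)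
    hS (by linarith) (by linarith) hg
    (by have := h.continuous_fst; have := h.continuous_snd; fun_prop)
    hzero (fun t ht h0 => by
      obtain ⟨k, rfl⟩ := (hS0 t).1 h0
      exact ⟨k, Nat.lt_succ_iff.1 (hS.lt_iff_lt.1 (by linarith [ht.2])), rfl⟩)
    hnd
  obtain ⟨ε, hε, hclose⟩ := h.exists_close hc.hp hm.le (sq_nonneg m) (m * θ) t₀
    ((S n + S (n + 1)) / 2) hη
  have hiff : ∀ L t, emdenDeriv m θ B (u L) (u' L) t - m * θ * emden m θ B (u L) t = 0 ↔
      u' L (Real.exp (m * t)) = 0 := fun L t => by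
    have hB := hc.hB
    rw [emdenDeriv_sub, mul_eq_zero_iff_left (by positivity)]
  set σ := -α * y' (S n) + y (S n) - y (S n) ^ p + m ^ 2 * Real.exp (2 * m * S n) * y (S n) -
    m * θ * y' (S n)
  have hev : ∀ᶠ L in atTop, ∃ z, u' L (Real.exp (m * z)) = 0 ∧
      {t | t < z ∧ u' L (Real.exp (m * t)) = 0}.encard = n ∧
      (0 < (emdenDeriv m θ B (u L) (u' L) (S n) - m * θ * emden m θ B (u L) (S n)) * σ →
        z < S n) ∧
      ((emdenDeriv m θ B (u L) (u' L) (S n) - m * θ * emden m θ B (u L) (S n)) * σ < 0 →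
        S n < z) := by
    filter_upwards [hdec, hconv ε hε, eventually_gt_atTop 0] with L h1 h2 h3
    have hsol := (hu L h3).1.efSol hc
    rw [mul_one] at hsol
    have := hcount _ _ (hsol.hasDerivAt_sub_mul (m * θ))
      (fun t ht => hclose t ht _ _ (h2 t ht).1 (h2 t ht).2)
      (fun t ht => ((emdenDeriv_sub_neg_iff hc t _ _).2 (h1 _ ⟨Real.exp_pos _,
        Real.exp_le_exp.2 (mul_le_mul_of_nonneg_left ht hm.le)⟩)).ne)
    simp only [hiff] at this
    exact this
  have hn0 : S 0 ≤ S n := hS.monotone (Nat.zero_le n)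
  have hf := hfreq (S n) ⟨by linarith, by linarith⟩ (m * θ)
  have hshift : ∀ L, emdenDeriv m θ B (u L) (u' L) (S n) - y' (S n) -
      m * θ * (emden m θ B (u L) (S n) - y (S n)) =
      emdenDeriv m θ B (u L) (u' L) (S n) - m * θ * emden m θ B (u L) (S n) := fun L => by
    linear_combination -hzero n
  simp only [hshift] at hf
  have hsign : (∃ᶠ L in atTop,
      (emdenDeriv m θ B (u L) (u' L) (S n) - m * θ * emden m θ B (u L) (S n)) * σ < 0) ∧
      ∃ᶠ L in atTop,
        0 < (emdenDeriv m θ B (u L) (u' L) (S n) - m * θ * emden m θ B (u L) (S n)) * σ := by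
    rcases lt_or_gt_of_ne (hnd n) with hσ | hσ
    · exact ⟨hf.1.mono fun L hL => mul_neg_of_pos_of_neg hL hσ,
        hf.2.mono fun L hL => mul_pos_of_neg_of_neg hL hσ⟩
    · exact ⟨hf.2.mono fun L hL => mul_neg_of_neg_of_pos hL hσ,
        hf.1.mono fun L hL => mul_pos hL hσ⟩
  exact ⟨(hsign.1.and_eventually hev).mono fun L ⟨hL, z, h1, h2, _, h4⟩ => ⟨z, h4 hL, h1, h2⟩,
    (hsign.2.and_eventually hev).mono fun L ⟨hL, z, h1, h2, h3, _⟩ => ⟨z, h3 hL, h1, h2⟩⟩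

/-! ### The constants, and the link with the original variables -/

lemma thetaP_pos {p : ℝ} (hp : 1 < p) : 0 < thetaP p :=
  div_pos two_pos (by linarith)

lemma thetaP_mul {p : ℝ} (hp : 1 < p) : thetaP p * (p - 1) = 2 :=
  div_mul_cancel₀ _ (by linarith)

lemma two_mul_thetaP_lt {N : ℕ} (hN : 3 ≤ N) {p : ℝ} (hp : 1 < p) (hpS : pSob N < p) :
    2 * thetaP p < (N : ℝ) - 2 := by
  have hN' : (3 : ℝ) ≤ N := by exact_mod_cast hN
  rw [pSob, div_lt_iff₀ (by linarith)] at hpS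
  rw [thetaP, mul_div_assoc', div_lt_iff₀ (by linarith)]
  linarith

lemma mConst_sq {N : ℕ} {p : ℝ} (hq : 0 < thetaP p * ((N : ℝ) - 2 - thetaP p)) :
    mConst N p ^ 2 = (thetaP p * ((N : ℝ) - 2 - thetaP p))⁻¹ := by
  rw [mConst, ← Real.rpow_natCast, ← Real.rpow_mul hq.le, ← Real.rpow_neg_one]
  norm_num

lemma efConst {N : ℕ} (hN : 3 ≤ N) {p : ℝ} (hp : 1 < p) (hpS : pSob N < p) :
    EFConst ((N : ℝ) - 1) p (alphaConst N p) (mConst N p) (thetaP p) (Aconst N p)⁻¹ := by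
  have hN' : (3 : ℝ) ≤ N := by exact_mod_cast hN
  have hθ := thetaP_pos hp
  have hθN := two_mul_thetaP_lt hN hp hpS
  have hq : 0 < thetaP p * ((N : ℝ) - 2 - thetaP p) := mul_pos hθ (by linarith)
  have hm : 0 < mConst N p := Real.rpow_pos_of_pos hq _
  refine ⟨hp, by linarith, mul_pos hm (by linarith), hm, hθ,
    inv_pos.2 (Real.rpow_pos_of_pos hq _), thetaP_mul hp, ?_, by rw [alphaConst]; ring, ?_⟩
  · rw [mConst_sq hq, show (N : ℝ) - 1 - 1 - thetaP p = N - 2 - thetaP p by ring,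
      inv_mul_cancel₀ hq.ne']
  · rw [mConst_sq hq, Aconst, Real.inv_rpow (Real.rpow_pos_of_pos hq _).le, ← Real.rpow_mul hq.le,
      one_div_mul_cancel (by linarith), Real.rpow_one]

lemma alphaConst_sq_lt {N : ℕ} (hN : 3 ≤ N) {p : ℝ} (hp : 1 < p) (hpS : pSob N < p)
    (hJL : pJLcond N p) : alphaConst N p ^ 2 / 4 < p - 1 := by
  have hN' : (3 : ℝ) ≤ N := by exact_mod_cast hN
  have hθ := thetaP_pos hp
  have hθp := thetaP_mul hp
  have hθN := two_mul_thetaP_lt hN hp hpS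
  have hq : 0 < thetaP p * ((N : ℝ) - 2 - thetaP p) := mul_pos hθ (by linarith)
  have hr2 : √((N : ℝ) - 1) ^ 2 = N - 1 := Real.sq_sqrt (by linarith)
  have hr1 : 1 < √((N : ℝ) - 1) := by
    rw [Real.lt_sqrt one_pos.le]; linarith
  have hD : (N : ℝ) - 4 - 2 * √((N : ℝ) - 1) < 2 * thetaP p := by
    rcases le_or_gt ((N : ℝ) - 4 - 2 * √((N : ℝ) - 1)) 0 with h | h
    · linarith
    · have hN11 : 11 ≤ N := by
        by_contra! hcon
        have h10 : (N : ℝ) ≤ 10 := by exact_mod_cast Nat.lt_succ_iff.1 hcon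
        nlinarith [mul_nonneg (by linarith : (0 : ℝ) ≤ N - 2) (by linarith : (0 : ℝ) ≤ 10 - N)]
      have h1 : p - 1 < 4 / ((N : ℝ) - 4 - 2 * √((N : ℝ) - 1)) := by linarith [hJL hN11]
      rw [lt_div_iff₀ h] at h1
      by_contra! hcon
      nlinarith
  set x : ℝ := (N : ℝ) - 2 - 2 * thetaP p with hx
  have hx0 : 0 < x := by linarith
  have hfac : 0 < (2 + 2 * √((N : ℝ) - 1) - x) * (x - 2 + 2 * √((N : ℝ) - 1)) :=
    mul_pos (by linarith) (by linarith)
  rw [alphaConst, mul_pow, mConst_sq hq, ← hx, inv_mul_eq_div, div_div, div_lt_iff₀ (by linarith)]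
  have h2 : (p - 1) * (thetaP p * ((N : ℝ) - 2 - thetaP p) * 4) = 8 * (N - 2 - thetaP p) := by
    linear_combination 4 * ((N : ℝ) - 2 - thetaP p) * hθp
  rw [h2]
  linarith

lemma IsEntireSingODE.efSol {N : ℕ} {p : ℝ} {y y' y'' : ℝ → ℝ} (h : IsEntireSingODE N p y y' y'') :
    EFSol p (alphaConst N p) (mConst N p) (mConst N p ^ 2) y y' :=
  ⟨h.1, fun t => (h.2.1 t).congr_deriv (by linear_combination h.2.2.2.1 t)⟩

lemma IsIVPSol.radSol {N : ℕ} {p γ : ℝ} {u u' u'' : ℝ → ℝ} (h : IsIVPSol N p γ u u' u'') :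
    RadSol ((N : ℝ) - 1) p 1 u u' where
  cont := fun s hs => (h.1 s hs).continuousWithinAt
  cont' := fun s hs => (h.2.1 s hs).continuousWithinAt
  zero' := h.2.2.2.2.1
  hd := fun s hs => (h.1 s (le_of_lt hs)).hasDerivAt (Ici_mem_nhds hs)
  hd' := fun s hs => ((h.2.1 s (le_of_lt hs)).hasDerivAt (Ici_mem_nhds hs)).congr_deriv (by
    have := h.2.2.2.2.2 s hs
    rw [fNL] at this
    linear_combination this)

lemma deriv_ustar_exp_eq_zero_iff {N : ℕ} {p : ℝ} {y y' : ℝ → ℝ} (hA : 0 < Aconst N p)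
    (hm : 0 < mConst N p) (hy : ∀ t, HasDerivAt y (y' t) t) (t : ℝ) :
    deriv (ustar N p y) (Real.exp (mConst N p * t)) = 0 ↔
      y' t - mConst N p * thetaP p * y t = 0 := by
  set m := mConst N p
  have hx := Real.exp_pos (m * t)
  have hlog : Real.log (Real.exp (m * t)) / m = t := by
    rw [Real.log_exp, mul_div_cancel_left₀ _ hm.ne']
  have h1 : HasDerivAt (fun s => y (Real.log s / m)) (y' t * ((Real.exp (m * t))⁻¹ / m))
      (Real.exp (m * t)) :=
    HasDerivAt.comp (h₂ := y) (Real.exp (m * t)) (by rw [hlog]; exact hy t)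
      ((Real.hasDerivAt_log hx.ne').div_const m)
  have h2 := ((Real.hasDerivAt_rpow_const (p := -thetaP p) (Or.inl hx.ne')).const_mul
    (Aconst N p)).mul h1
  have h3 : HasDerivAt (ustar N p y) (Aconst N p * Real.exp (m * t) ^ (-thetaP p - 1) / m *
      (y' t - m * thetaP p * y t)) (Real.exp (m * t)) := by
    refine h2.congr_deriv ?_
    rw [hlog, Real.rpow_sub_one hx.ne']
    field_simp
    ring
  rw [h3.deriv, mul_eq_zero_iff_left (by positivity)]

lemma isNthCritPt_exp {m z : ℝ} (hm : 0 < m) {u' : ℝ → ℝ} {n : ℕ}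
    (hz : u' (Real.exp (m * z)) = 0)
    (hcard : {t | t < z ∧ u' (Real.exp (m * t)) = 0}.encard = n) :
    IsNthCritPt u' n (Real.exp (m * z)) := by
  refine ⟨Real.exp_pos _, hz, ?_⟩
  have hinj : Function.Injective fun t : ℝ => Real.exp (m * t) :=
    Real.exp_injective.comp (mul_right_injective₀ hm.ne')
  rw [← hcard, ← hinj.encard_image {t | t < z ∧ u' (Real.exp (m * t)) = 0}]
  refine congrArg encard (Set.ext fun x => ?_)
  constructor
  · rintro ⟨h0, hx, h1⟩
    have he : Real.exp (m * (Real.log x / m)) = x := by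
      rw [mul_div_cancel₀ _ hm.ne', Real.exp_log h0]
    refine ⟨Real.log x / m, ⟨?_, by rwa [he]⟩, he⟩
    rw [← he, Real.exp_lt_exp] at hx
    exact lt_of_mul_lt_mul_left hx hm.le
  · rintro ⟨t, ⟨ht, h1⟩, rfl⟩
    exact ⟨Real.exp_pos _, Real.exp_lt_exp.2 (mul_lt_mul_of_pos_left ht hm), h1⟩

/-- Theorem 6.1: for `p_S < p < p_JL`, `λ_{n+1}(γ)` oscillates around
`λ_{n+1}* = (s_{n+1}*)²` infinitely many times as `γ → ∞`. -/
theorem lambda_oscillates (N : ℕ) (hN : 3 ≤ N) (p : ℝ) (hp : 1 < p)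
    (hpS : pSob N < p) (hJL : pJLcond N p)
    (ys ys' ys'' : ℝ → ℝ) (hys : IsEntireSingODE N p ys ys' ys'')
    (sstar : ℕ → ℝ) (hsm : StrictMono sstar) (hspos : ∀ k, 0 < sstar k)
    (hschar : ∀ x : ℝ, 0 < x → (deriv (ustar N p ys) x = 0 ↔ ∃ k, sstar k = x))
    (U U' U'' : ℝ → ℝ → ℝ)
    (hU : ∀ γ > (1:ℝ), IsIVPSol N p γ (U γ) (U' γ) (U'' γ))
    (n : ℕ) :
    ∀ Γ > (1:ℝ),
      (∃ γ > Γ, ∃ s : ℝ, IsNthCritPt (U' γ) n s ∧ sstar n ^ 2 < s ^ 2) ∧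
      (∃ γ > Γ, ∃ s : ℝ, IsNthCritPt (U' γ) n s ∧ s ^ 2 < sstar n ^ 2) := by
  have hc := efConst hN hp hpS
  have hm := hc.hm
  have hθ := hc.hθ
  have hgap := alphaConst_sq_lt hN hp hpS hJL
  set m := mConst N p
  set θ := thetaP p
  have hexp : ∀ k, Real.exp (m * (Real.log (sstar k) / m)) = sstar k := fun k => by
    rw [mul_div_cancel₀ _ hm.ne', Real.exp_log (hspos k)]
  have hS : StrictMono fun k => Real.log (sstar k) / m := fun j k hjk =>
    div_lt_div_of_pos_right (Real.log_lt_log (hspos j) (hsm hjk)) hm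
  have hS0 : ∀ t, ys' t - m * θ * ys t = 0 ↔ ∃ k, Real.log (sstar k) / m = t := fun t => by
    rw [← deriv_ustar_exp_eq_zero_iff (inv_pos.1 hc.hB) hm hys.1, hschar _ (Real.exp_pos _)]
    refine exists_congr fun k => ?_
    rw [← hexp k, Real.exp_eq_exp, mul_right_inj' hm.ne', hexp]
  have hω : alphaConst N p ^ 2 / 4 + √(p - 1 - alphaConst N p ^ 2 / 4) ^ 2 = p - 1 := by
    rw [Real.sq_sqrt (by linarith)]; ring
  have hcross := exists_critical_crossing (u := fun L => U (Real.exp (m * θ * L)))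
    (u' := fun L => U' (Real.exp (m * θ * L))) hc (Real.sqrt_pos.2 (by linarith)) hω
    (fun L hL => by
      have h1 := hU (Real.exp (m * θ * L)) (Real.one_lt_exp_iff.2 (by positivity))
      exact ⟨h1.radSol, h1.2.2.2.1⟩)
    hys.efSol hys.2.2.2.2 hS hS0 n
  intro Γ _
  have hΓ : ∀ᶠ L in atTop, Γ < Real.exp (m * θ * L) :=
    (Real.tendsto_exp_atTop.comp (tendsto_id.const_mul_atTop (mul_pos hm hθ))).eventually
      (eventually_gt_atTop Γ)
  constructor
  · obtain ⟨L, ⟨z, h1, h2, h3⟩, h4⟩ := (hcross.1.and_eventually hΓ).exists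
    refine ⟨_, h4, _, isNthCritPt_exp hm h2 h3, pow_lt_pow_left₀ ?_ (hspos n).le two_ne_zero⟩
    rw [← hexp n]
    exact Real.exp_lt_exp.2 (mul_lt_mul_of_pos_left h1 hm)
  · obtain ⟨L, ⟨z, h1, h2, h3⟩, h4⟩ := (hcross.2.and_eventually hΓ).exists
    refine ⟨_, h4, _, isNthCritPt_exp hm h2 h3,
      pow_lt_pow_left₀ ?_ (Real.exp_pos _).le two_ne_zero⟩
    rw [← hexp n]
    exact Real.exp_lt_exp.2 (mul_lt_mul_of_pos_left h1 hm)
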